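/- arXiv:2407.03226 — 3 statements merged into one kernel-verified Lean document; each statement's English description precedes it below -/
import Mathlib

section
/- Let ξ be a real number such that 1, ξ, ξ², ξ³ are linearly independent over ℚ, let c > 0 and suppose that for every sufficiently large X there exists a non-zero x ∈ ℤ⁴ with |x₀| ≤ X and max_{1≤i≤3}|x₀ξⁱ − x_i| ≤ cX^{−λ₃}, where λ₃ is the smallest positive root of T² − γ³T + γ and γ = (1+√5)/2. Let (x_i)_{i≥1} be a sequence of minimal points for ξ in ℤ⁴, set W_i = span_ℝ(x_{i−1}, x_i), I = {i ≥ 2 : W_i ≠ W_{i+1}}, U_i = W_i + W_{i+1} for i ∈ I, and J = {i ∈ I : U_i ≠ U_j where j is the successor of i in I}. Then there are only finitely many i ∈ I such that i, the successor j of i in I, and the successor k of j in I all belong to J. -/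
noncomputable section

/-- ‖x‖ for an integer point of ℤ⁴, as a real number. -/
def znorm (x : Fin 4 → ℤ) : ℝ :=
  max (max |(x 0 : ℝ)| |(x 1 : ℝ)|) (max |(x 2 : ℝ)| |(x 3 : ℝ)|)

/-- L(x) = max_{1≤k≤3}|x₀ξᵏ − x_k| for an integer point of ℤ⁴. -/
def zL (ξ : ℝ) (x : Fin 4 → ℤ) : ℝ :=
  max (max |(x 0 : ℝ) * ξ - (x 1 : ℝ)| |(x 0 : ℝ) * ξ ^ 2 - (x 2 : ℝ)|)
    |(x 0 : ℝ) * ξ ^ 3 - (x 3 : ℝ)|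

/-- The approximation hypothesis. -/
def ApproxHyp (ξ c lam : ℝ) : Prop :=
  ∃ X₀ : ℝ, ∀ X : ℝ, X₀ ≤ X →
    ∃ x : Fin 4 → ℤ, x ≠ 0 ∧ |(x 0 : ℝ)| ≤ X ∧
      ∀ i : Fin 4, 1 ≤ (i : ℕ) →
        |(x 0 : ℝ) * ξ ^ (i : ℕ) - (x i : ℝ)| ≤ c * X ^ (-lam)

/-- A sequence of minimal points for ξ in ℤ⁴ (indexed from 1). -/
def IsMinimalSeq (ξ : ℝ) (x : ℕ → Fin 4 → ℤ) : Prop :=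
  (∀ i, 1 ≤ i → x i ≠ 0) ∧
  (∀ i, 1 ≤ i → znorm (x i) < znorm (x (i + 1))) ∧
  (∀ i, 1 ≤ i → zL ξ (x (i + 1)) < zL ξ (x i)) ∧
  (∀ i, 1 ≤ i → ∀ y : Fin 4 → ℤ, y ≠ 0 → zL ξ y < zL ξ (x i) →
    znorm (x (i + 1)) ≤ znorm y)

/-- The real vector attached to an integer point. -/
def rvec (x : Fin 4 → ℤ) : Fin 4 → ℝ := fun k => (x k : ℝ)

/-- W_i = span_ℝ(x_{i−1}, x_i). -/
def Wspace (x : ℕ → Fin 4 → ℤ) (i : ℕ) : Submodule ℝ (Fin 4 → ℝ) :=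
  Submodule.span ℝ {rvec (x (i - 1)), rvec (x i)}

/-- I = {i ≥ 2 : W_i ≠ W_{i+1}}. -/
def Iset (x : ℕ → Fin 4 → ℤ) : Set ℕ :=
  {i | 2 ≤ i ∧ Wspace x i ≠ Wspace x (i + 1)}

/-- U_i = W_i + W_{i+1}. -/
def Uspace (x : ℕ → Fin 4 → ℤ) (i : ℕ) : Submodule ℝ (Fin 4 → ℝ) :=
  Wspace x i ⊔ Wspace x (i + 1)

/-- i < j are consecutive elements of S (j is the successor of i in S). -/
def ConsecIn (S : Set ℕ) (i j : ℕ) : Prop :=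
  i ∈ S ∧ j ∈ S ∧ i < j ∧ ∀ k ∈ S, i < k → j ≤ k

/-- J = {i ∈ I : U_i ≠ U_j where j is the successor of i in I}. -/
def Jset (x : ℕ → Fin 4 → ℤ) : Set ℕ :=
  {i | i ∈ Iset x ∧ ∀ j, ConsecIn (Iset x) i j → Uspace x i ≠ Uspace x j}


/-- The golden ratio γ = (1+√5)/2. -/
def gold : ℝ := (1 + Real.sqrt 5) / 2

/-- λ₃, the smallest positive root of T² − γ³T + γ. -/
def lambda3 : ℝ := (gold ^ 3 - Real.sqrt (gold ^ 6 - 4 * gold)) / 2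

theorem abs_mul_le_mul {u v a b : ℝ} (hu : |u| ≤ a) (hv : |v| ≤ b) : |u * v| ≤ a * b := by
  rw [abs_mul]
  exact mul_le_mul hu hv (abs_nonneg _) ((abs_nonneg _).trans hu)

theorem abs_le_znorm (x : Fin 4 → ℤ) (i : Fin 4) : |(x i : ℝ)| ≤ znorm x := by
  unfold znorm
  fin_cases i <;> simp

theorem znorm_le {x : Fin 4 → ℤ} {r : ℝ} (h : ∀ i, |(x i : ℝ)| ≤ r) : znorm x ≤ r := by
  unfold znorm
  simp [h]

theorem znorm_lt {x : Fin 4 → ℤ} {r : ℝ} (h : ∀ i, |(x i : ℝ)| < r) : znorm x < r := by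
  unfold znorm
  simp [h]

/-- The error `x₀ ξ ^ i - x_i`. -/
def err (ξ : ℝ) (x : Fin 4 → ℤ) (i : Fin 4) : ℝ := (x 0 : ℝ) * ξ ^ (i : ℕ) - x i

theorem err_zero (ξ : ℝ) (x : Fin 4 → ℤ) : err ξ x 0 = 0 := by simp [err]

theorem coord_eq (ξ : ℝ) (x : Fin 4 → ℤ) (i : Fin 4) :
    (x i : ℝ) = x 0 * ξ ^ (i : ℕ) - err ξ x i := by simp [err]

theorem zL_nonneg (ξ : ℝ) (x : Fin 4 → ℤ) : 0 ≤ zL ξ x := by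
  unfold zL
  exact le_max_of_le_right (abs_nonneg _)

theorem abs_err_le (ξ : ℝ) (x : Fin 4 → ℤ) (i : Fin 4) : |err ξ x i| ≤ zL ξ x := by
  fin_cases i
  · simpa [err] using zL_nonneg ξ x
  all_goals simp [err, zL]

theorem zL_le {ξ r : ℝ} {x : Fin 4 → ℤ} (h : ∀ i, |err ξ x i| ≤ r) : zL ξ x ≤ r := by
  have h1 := h 1
  have h2 := h 2
  have h3 := h 3
  simp [err] at h1 h2 h3
  simp [zL, h1, h2, h3]

theorem zL_lt {ξ r : ℝ} {x : Fin 4 → ℤ} (h : ∀ i, |err ξ x i| < r) : zL ξ x < r := by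
  have h1 := h 1
  have h2 := h 2
  have h3 := h 3
  simp [err] at h1 h2 h3
  simp [zL, h1, h2, h3]

theorem exists_abs_err_eq (ξ : ℝ) (x : Fin 4 → ℤ) : ∃ i, |err ξ x i| = zL ξ x := by
  by_contra! h
  exact lt_irrefl _ (zL_lt fun i => lt_of_le_of_ne (abs_err_le ξ x i) (h i))

/-- Upper bounds for the powers of `ξ`. -/
def PowBound (ξ R : ℝ) : Prop := 1 ≤ R ∧ ∀ i : Fin 4, |ξ ^ (i : ℕ)| ≤ R

/-- The quadratic forms attached to a point: its `2 × 2` Hankel minors. -/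
def minor (x : Fin 4 → ℤ) : Fin 3 → ℤ :=
  ![x 1 * x 3 - x 2 ^ 2, x 1 * x 2 - x 0 * x 3, x 0 * x 2 - x 1 ^ 2]

/-- The first bilinear contraction. -/
def contr₀ (x y : Fin 4 → ℤ) : ℤ := minor x 0 * y 0 + minor x 1 * y 1 + minor x 2 * y 2

/-- The second bilinear contraction. -/
def contr₁ (x y : Fin 4 → ℤ) : ℤ := minor x 0 * y 1 + minor x 1 * y 2 + minor x 2 * y 3

theorem abs_minor_le {ξ R : ℝ} (hR : PowBound ξ R) {x : Fin 4 → ℤ} (hL : zL ξ x ≤ znorm x)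
    (i : Fin 3) : |(minor x i : ℝ)| ≤ 6 * R * (znorm x * zL ξ x) := by
  obtain ⟨hR1, hR⟩ := hR
  have e1 := abs_err_le ξ x 1
  have e2 := abs_err_le ξ x 2
  have e3 := abs_err_le ξ x 3
  have c1 := coord_eq ξ x 1
  have c2 := coord_eq ξ x 2
  have c3 := coord_eq ξ x 3
  have x0 := abs_le_znorm x 0
  have l0 := zL_nonneg ξ x
  simp at c1 c2 c3
  generalize err ξ x 1 = u1 at *
  generalize err ξ x 2 = u2 at *
  generalize err ξ x 3 = u3 at *
  set N := znorm x
  set L := zL ξ x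
  have N0 : 0 ≤ N := (abs_nonneg _).trans x0
  have hLL : L * L ≤ R * (N * L) := by nlinarith [mul_nonneg N0 l0]
  have hNL : N * L ≤ R * (N * L) := by nlinarith [mul_nonneg N0 l0]
  have k1 : ∀ {s : ℝ} {u : ℝ}, |s| ≤ R → |u| ≤ L → |x 0 * (s * u)| ≤ R * (N * L) := by
    intro s u hs hu
    calc _ ≤ N * (R * L) := abs_mul_le_mul x0 (abs_mul_le_mul hs hu)
      _ = _ := by ring
  have k2 : ∀ {s u : ℝ}, |s| ≤ L → |u| ≤ L → |s * u| ≤ R * (N * L) := fun hs hu =>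
    (abs_mul_le_mul hs hu).trans hLL
  have k3 : ∀ {u : ℝ}, |u| ≤ L → |x 0 * u| ≤ R * (N * L) := fun hu =>
    (abs_mul_le_mul x0 hu).trans hNL
  have hr1 : |ξ| ≤ R := by simpa using hR 1
  have hr2 : |ξ ^ 2| ≤ R := by simpa using hR 2
  have hr3 : |ξ ^ 3| ≤ R := by simpa using hR 3
  fin_cases i
  · have : (minor x 0 : ℝ) = -(x 0 * (ξ * u3)) - x 0 * (ξ ^ 3 * u1) + 2 * (x 0 * (ξ ^ 2 * u2))
        + u1 * u3 - u2 * u2 := by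
      simp only [minor, Matrix.cons_val_zero]
      push_cast
      rw [c1, c2, c3]
      ring
    simp only [Fin.zero_eta, this]
    have := abs_le.1 (k1 hr1 e3)
    have := abs_le.1 (k1 hr3 e1)
    have := abs_le.1 (k1 hr2 e2)
    have := abs_le.1 (k2 e1 e3)
    have := abs_le.1 (k2 e2 e2)
    rw [abs_le]
    constructor <;> linarith
  · have : (minor x 1 : ℝ) = -(x 0 * (ξ * u2)) - x 0 * (ξ ^ 2 * u1) + x 0 * u3 + u1 * u2 := by
      simp only [minor, Matrix.cons_val_one]
      push_cast
      rw [c1, c2, c3]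
      ring
    simp only [Fin.mk_one, this]
    have := abs_le.1 (k1 hr1 e2)
    have := abs_le.1 (k1 hr2 e1)
    have := abs_le.1 (k3 e3)
    have := abs_le.1 (k2 e1 e2)
    rw [abs_le]
    constructor <;> linarith
  · have : (minor x 2 : ℝ) = -(x 0 * u2) + 2 * (x 0 * (ξ * u1)) - u1 * u1 := by
      simp only [minor, Matrix.cons_val]
      push_cast
      rw [c1, c2]
      ring
    simp only [Fin.reduceFinMk, this]
    have := abs_le.1 (k1 hr1 e1)
    have := abs_le.1 (k3 e2)
    have := abs_le.1 (k2 e1 e1)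
    rw [abs_le]
    constructor <;> linarith

/-- The value of the polynomial with coefficients `minor x` at `ξ` is quadratic in the errors. -/
theorem abs_minor_eval_le {ξ R : ℝ} (hR : PowBound ξ R) (x : Fin 4 → ℤ) :
    |(minor x 0 : ℝ) + minor x 1 * ξ + minor x 2 * ξ ^ 2| ≤ 4 * R * (zL ξ x * zL ξ x) := by
  obtain ⟨hR1, hR⟩ := hR
  have e1 := abs_err_le ξ x 1
  have e2 := abs_err_le ξ x 2
  have e3 := abs_err_le ξ x 3
  have c1 := coord_eq ξ x 1
  have c2 := coord_eq ξ x 2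
  have c3 := coord_eq ξ x 3
  have hr1 : |ξ| ≤ R := by simpa using hR 1
  have hr2 : |ξ ^ 2| ≤ R := by simpa using hR 2
  simp at c1 c2 c3
  generalize err ξ x 1 = u1 at *
  generalize err ξ x 2 = u2 at *
  generalize err ξ x 3 = u3 at *
  have l0 := zL_nonneg ξ x
  set L := zL ξ x
  have hLL : L * L ≤ R * (L * L) := by nlinarith [mul_nonneg l0 l0]
  have : (minor x 0 : ℝ) + minor x 1 * ξ + minor x 2 * ξ ^ 2 =
      u1 * u3 - u2 * u2 + ξ * (u1 * u2) - ξ ^ 2 * (u1 * u1) := by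
    simp only [minor, Matrix.cons_val]
    push_cast
    rw [c1, c2, c3]
    ring
  rw [this]
  have := abs_le.1 ((abs_mul_le_mul e1 e3).trans hLL)
  have := abs_le.1 ((abs_mul_le_mul e2 e2).trans hLL)
  have := abs_le.1 (abs_mul_le_mul hr1 (abs_mul_le_mul e1 e2))
  have := abs_le.1 (abs_mul_le_mul hr2 (abs_mul_le_mul e1 e1))
  rw [abs_le]
  constructor <;> linarith

theorem abs_contr_le {ξ R : ℝ} (hR : PowBound ξ R) {x : Fin 4 → ℤ} (hL : zL ξ x ≤ znorm x)
    (y : Fin 4 → ℤ) :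
    |(contr₀ x y : ℝ)| ≤ 20 * R ^ 2 * (znorm y * zL ξ x * zL ξ x + znorm x * zL ξ x * zL ξ y) ∧
    |(contr₁ x y : ℝ)| ≤ 20 * R ^ 2 * (znorm y * zL ξ x * zL ξ x + znorm x * zL ξ x * zL ξ y) := by
  have q := abs_minor_eval_le hR x
  have q0 := abs_minor_le hR hL 0
  have q1 := abs_minor_le hR hL 1
  have q2 := abs_minor_le hR hL 2
  obtain ⟨hR1, hR⟩ := hR
  have e1 := abs_err_le ξ y 1
  have e2 := abs_err_le ξ y 2
  have e3 := abs_err_le ξ y 3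
  have c1 := coord_eq ξ y 1
  have c2 := coord_eq ξ y 2
  have c3 := coord_eq ξ y 3
  have hr1 : |ξ| ≤ R := by simpa using hR 1
  have y0 := abs_le_znorm y 0
  have x0 := abs_le_znorm x 0
  simp at c1 c2 c3
  have lx := zL_nonneg ξ x
  have ly := zL_nonneg ξ y
  generalize err ξ y 1 = u1 at *
  generalize err ξ y 2 = u2 at *
  generalize err ξ y 3 = u3 at *
  set Lx := zL ξ x
  set Ly := zL ξ y
  set Nx := znorm x
  set Ny := znorm y
  have Nx0 : 0 ≤ Nx := (abs_nonneg _).trans x0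
  have Ny0 : 0 ≤ Ny := (abs_nonneg _).trans y0
  have t1 : 0 ≤ Ny * Lx * Lx := by positivity
  have t2 : 0 ≤ Nx * Lx * Ly := by positivity
  have hRR : R ≤ R ^ 2 := by nlinarith
  have w1 : R * (Ny * Lx * Lx) ≤ R ^ 2 * (Ny * Lx * Lx) := by gcongr
  have w2 : R * (Nx * Lx * Ly) ≤ R ^ 2 * (Nx * Lx * Ly) := by gcongr
  constructor
  · have : (contr₀ x y : ℝ) = y 0 * ((minor x 0 : ℝ) + minor x 1 * ξ + minor x 2 * ξ ^ 2)
        - minor x 1 * u1 - minor x 2 * u2 := by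
      simp only [contr₀]
      push_cast
      rw [c1, c2]
      ring
    rw [this]
    have := abs_le.1 (abs_mul_le_mul y0 q)
    have := abs_le.1 (abs_mul_le_mul q1 e1)
    have := abs_le.1 (abs_mul_le_mul q2 e2)
    rw [abs_le]
    constructor <;> linarith
  · have : (contr₁ x y : ℝ) =
        ξ * (y 0 * ((minor x 0 : ℝ) + minor x 1 * ξ + minor x 2 * ξ ^ 2))
        - minor x 0 * u1 - minor x 1 * u2 - minor x 2 * u3 := by
      simp only [contr₁]
      push_cast
      rw [c1, c2, c3]
      ring
    rw [this]
    have := abs_le.1 (abs_mul_le_mul hr1 (abs_mul_le_mul y0 q))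
    have := abs_le.1 (abs_mul_le_mul q0 e1)
    have := abs_le.1 (abs_mul_le_mul q1 e2)
    have := abs_le.1 (abs_mul_le_mul q2 e3)
    rw [abs_le]
    constructor <;> linarith

/-- The Plücker coordinates of a pair of points. -/
def plucker (x y : Fin 4 → ℤ) (i j : Fin 4) : ℤ := x i * y j - x j * y i

theorem plucker_zero_eq (ξ : ℝ) (x y : Fin 4 → ℤ) (j : Fin 4) :
    (plucker x y 0 j : ℝ) = y 0 * err ξ x j - x 0 * err ξ y j := by
  simp only [plucker]
  push_cast
  rw [coord_eq ξ x j, coord_eq ξ y j]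
  ring

theorem abs_plucker_le {ξ R : ℝ} (hR : PowBound ξ R) {x y : Fin 4 → ℤ}
    (hN : znorm x ≤ znorm y) (hL : zL ξ y ≤ zL ξ x) (h1 : zL ξ x ≤ znorm x) (i j : Fin 4) :
    |(plucker x y i j : ℝ)| ≤ 6 * R * (znorm y * zL ξ x) := by
  obtain ⟨hR1, hR⟩ := hR
  have ri := hR i
  have rj := hR j
  have xi := abs_err_le ξ x i
  have xj := abs_err_le ξ x j
  have yi := (abs_err_le ξ y i).trans hL
  have yj := (abs_err_le ξ y j).trans hL
  have x0 := (abs_le_znorm x 0).trans hN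
  have y0 := abs_le_znorm y 0
  have lx := zL_nonneg ξ x
  have hLN := h1.trans hN
  set L := zL ξ x
  set N := znorm y
  have N0 : 0 ≤ N := lx.trans hLN
  have hLL : L * L ≤ R * (N * L) := by nlinarith [mul_nonneg N0 lx]
  have : (plucker x y i j : ℝ) = ξ ^ (i : ℕ) * (y 0 * err ξ x j) - ξ ^ (i : ℕ) * (x 0 * err ξ y j)
      - ξ ^ (j : ℕ) * (y 0 * err ξ x i) + ξ ^ (j : ℕ) * (x 0 * err ξ y i)
      + err ξ x i * err ξ y j - err ξ x j * err ξ y i := by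
    simp only [plucker]
    push_cast
    rw [coord_eq ξ x j, coord_eq ξ y j, coord_eq ξ x i, coord_eq ξ y i]
    ring
  rw [this]
  have := abs_le.1 (abs_mul_le_mul ri (abs_mul_le_mul y0 xj))
  have := abs_le.1 (abs_mul_le_mul ri (abs_mul_le_mul x0 yj))
  have := abs_le.1 (abs_mul_le_mul rj (abs_mul_le_mul y0 xi))
  have := abs_le.1 (abs_mul_le_mul rj (abs_mul_le_mul x0 yi))
  have := abs_le.1 ((abs_mul_le_mul xi yj).trans hLL)
  have := abs_le.1 ((abs_mul_le_mul xj yi).trans hLL)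
  rw [abs_le]
  constructor <;> linarith

/-- The contractions of the two bases of a lattice of rank two are related by a linear identity. -/
theorem contr_relation {a b a' c' : Fin 4 → ℤ} {α β γ δ : ℤ} (ha : ∀ i, a' i = α * a i + β * b i)
    (hc : ∀ i, c' i = γ * a i + δ * b i) :
    (contr₁ a' c' * a 0 - contr₀ a' c' * a 1 =
      (α * δ - β * γ) * (contr₁ a b * a' 0 - contr₀ a b * a' 1)) ∧
    (contr₁ a' c' * a 1 - contr₀ a' c' * a 2 =
      (α * δ - β * γ) * (contr₁ a b * a' 1 - contr₀ a b * a' 2)) ∧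
    (contr₁ a' c' * a 2 - contr₀ a' c' * a 3 =
      (α * δ - β * γ) * (contr₁ a b * a' 2 - contr₀ a b * a' 3)) := by
  simp only [contr₀, contr₁, minor, Matrix.cons_val, ha, hc]
  refine ⟨by ring, by ring, by ring⟩

theorem contr₀_self (x : Fin 4 → ℤ) : contr₀ x x = 0 := by
  simp only [contr₀, minor, Matrix.cons_val]
  ring

theorem contr₁_self (x : Fin 4 → ℤ) : contr₁ x x = 0 := by
  simp only [contr₁, minor, Matrix.cons_val]
  ring

/-- Three successive points, with comparison of their sizes and of their errors. -/
structure Triple (ξ R : ℝ) (c a b : Fin 4 → ℤ) : Prop where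
  pow : PowBound ξ R
  one_le : 1 ≤ znorm c
  norm_ca : znorm c ≤ znorm a
  norm_ab : znorm a ≤ znorm b
  L_ac : zL ξ a ≤ zL ξ c
  L_ba : zL ξ b ≤ zL ξ a
  L_le : zL ξ c ≤ 1
  L_pos : 0 < zL ξ b
  lead_a : znorm a ≤ R * |(a 0 : ℝ)|
  indep : LinearIndependent ℝ ![rvec c, rvec a, rvec b]

/-- A point with vanishing Hankel minors is a multiple of a point on the twisted cubic. -/
theorem exists_cube_dvd_of_minor_eq_zero {a : Fin 4 → ℤ} (h : minor a = 0) (ha : a 0 ≠ 0) :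
    ∃ r s : ℤ, r ≠ 0 ∧ r ^ 3 ∣ a 0 ∧ s * a 0 = r * a 1 ∧ s * a 1 = r * a 2 ∧
      s * a 2 = r * a 3 := by
  have h1 : a 1 * a 2 - a 0 * a 3 = 0 := by simpa [minor] using congrFun h 1
  have h2 : a 0 * a 2 - a 1 ^ 2 = 0 := by simpa [minor] using congrFun h 2
  have hg : Int.gcd (a 0) (a 1) ≠ 0 := by
    rw [Ne, Int.gcd_eq_zero_iff]
    tauto
  obtain ⟨g, r, s, hcop, hr, hs⟩ : ∃ g r s : ℤ, IsCoprime r s ∧ a 0 = r * g ∧ a 1 = s * g := by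
    obtain ⟨r, s, hcop, hr, hs⟩ := Int.exists_gcd_one (m := a 0) (n := a 1) (by omega)
    exact ⟨_, r, s, Int.isCoprime_iff_gcd_eq_one.2 hcop, hr, hs⟩
  have hr0 : r ≠ 0 := by rintro rfl; simp at hr; exact ha hr
  have hg0 : g ≠ 0 := by rintro rfl; simp at hr; exact ha hr
  have e1 : s * a 2 = r * a 3 := by
    apply mul_left_cancel₀ hg0
    linear_combination h1 - a 2 * hs + a 3 * hr
  have e2 : r * a 2 = s ^ 2 * g := by
    apply mul_left_cancel₀ hg0
    linear_combination h2 - a 2 * hr + (a 1 + s * g) * hs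
  obtain ⟨t, ht⟩ : r ∣ a 2 := hcop.dvd_of_dvd_mul_left ⟨a 3, e1⟩
  have e3 : r ^ 2 ∣ s ^ 2 * g := ⟨t, by linear_combination -e2 + r * ht⟩
  have e4 : r ^ 2 ∣ g := (hcop.pow (m := 2) (n := 2)).dvd_of_dvd_mul_left e3
  refine ⟨r, s, hr0, ?_, ?_, ?_, e1⟩
  · rw [hr, pow_succ']
    exact mul_dvd_mul_left r e4
  · linear_combination s * hr - r * hs
  · linear_combination s * hs - e2

theorem exists_primitive {v : Fin 3 → ℤ} (hv : v ≠ 0) :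
    ∃ (g : ℤ) (q u : Fin 3 → ℤ), g ≠ 0 ∧ (∀ i, v i = g * q i) ∧
      u 0 * q 0 + u 1 * q 1 + u 2 * q 2 = 1 := by
  obtain ⟨g, hg⟩ := (inferInstance : (Ideal.span (Set.range v)).IsPrincipal).principal
  have hg' : Ideal.span (Set.range v) = Ideal.span {g} := hg
  have hq : ∀ i, ∃ q, v i = g * q := fun i => by
    have : v i ∈ Ideal.span {g} := hg' ▸ Ideal.subset_span ⟨i, rfl⟩
    exact Ideal.mem_span_singleton.1 this
  choose q hq using hq
  have hg0 : g ≠ 0 := by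
    rintro rfl
    exact hv (funext fun i => by simp [hq i])
  have hmem : g ∈ Ideal.span (Set.range v) := hg' ▸ Ideal.mem_span_singleton_self g
  obtain ⟨u, hu⟩ := Ideal.mem_span_range_iff_exists_fun.1 hmem
  refine ⟨g, q, u, hg0, hq, ?_⟩
  rw [Fin.sum_univ_three] at hu
  apply mul_left_cancel₀ hg0
  rw [hq, hq, hq] at hu
  linear_combination hu

/-- The vectors annihilated by the two shifts of a nonzero `q` form a plane. -/
theorem not_forall_annihilated {q : Fin 3 → ℝ} (hq : q ≠ 0) {v : Fin 3 → Fin 4 → ℝ}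
    (hv : LinearIndependent ℝ v)
    (h0 : ∀ i, q 0 * v i 0 + q 1 * v i 1 + q 2 * v i 2 = 0)
    (h1 : ∀ i, q 0 * v i 1 + q 1 * v i 2 + q 2 * v i 3 = 0) : False := by
  set A : Matrix (Fin 2) (Fin 4) ℝ := !![q 0, q 1, q 2, 0; 0, q 0, q 1, q 2] with hA
  have hrows : LinearIndependent ℝ A.row := by
    rw [Fintype.linearIndependent_iff]
    intro f hf
    have f0 := congrFun hf 0
    have f1 := congrFun hf 1
    have f2 := congrFun hf 2
    have f3 := congrFun hf 3
    simp [Fin.sum_univ_two, hA, Matrix.row] at f0 f1 f2 f3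
    have hne : q 0 ≠ 0 ∨ q 1 ≠ 0 ∨ q 2 ≠ 0 := by
      by_contra! hcon
      exact hq (funext fun i => by fin_cases i <;> simp [hcon])
    have : f 0 = 0 ∧ f 1 = 0 := by
      rcases eq_or_ne (q 0) 0 with z0 | z0
      · rcases eq_or_ne (q 2) 0 with z2 | z2
        · have z1 : q 1 ≠ 0 := by tauto
          simp only [z0, z2, mul_zero, add_zero, zero_add, mul_eq_zero, z1, or_false] at f1 f2
          exact ⟨f1, f2⟩
        · have g1 : f 1 = 0 := f3.resolve_right z2
          simp only [g1, zero_mul, add_zero, mul_eq_zero, z2, or_false] at f2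
          exact ⟨f2, g1⟩
      · have g0 : f 0 = 0 := f0.resolve_right z0
        simp only [g0, zero_mul, zero_add, mul_eq_zero, z0, or_false] at f1
        exact ⟨g0, f1⟩
    intro i
    fin_cases i
    · exact this.1
    · exact this.2
  have hrank : Module.finrank ℝ (LinearMap.range A.mulVecLin) = 2 := by
    simpa [Matrix.rank] using hrows.rank_matrix
  have hker := LinearMap.finrank_range_add_finrank_ker A.mulVecLin
  rw [hrank] at hker
  simp at hker
  have hmem : ∀ i, v i ∈ LinearMap.ker A.mulVecLin := by
    intro i
    rw [LinearMap.mem_ker, Matrix.mulVecLin_apply]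
    ext j
    fin_cases j
    · simpa [hA, Matrix.mulVec, dotProduct, Fin.sum_univ_four] using h0 i
    · simpa [hA, Matrix.mulVec, dotProduct, Fin.sum_univ_four, add_assoc] using h1 i
  have hli : LinearIndependent ℝ fun i => (⟨v i, hmem i⟩ : LinearMap.ker A.mulVecLin) :=
    LinearIndependent.of_comp (LinearMap.ker A.mulVecLin).subtype hv
  have := hli.fintype_card_le_finrank
  simp at this
  omega

namespace Triple
variable {ξ R : ℝ} {c a b : Fin 4 → ℤ}

theorem R_pos (h : Triple ξ R c a b) : 0 < R := lt_of_lt_of_le one_pos h.pow.1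

theorem a_pos (h : Triple ξ R c a b) : 0 < |(a 0 : ℝ)| := by
  have h1 := h.one_le.trans (h.norm_ca.trans h.lead_a)
  have := h.R_pos
  by_contra! h0
  have : R * |(a 0 : ℝ)| ≤ 0 := mul_nonpos_of_nonneg_of_nonpos this.le h0
  linarith

theorem a_ne (h : Triple ξ R c a b) : a 0 ≠ 0 := by
  have := h.a_pos
  rintro h0
  simp [h0] at this

theorem not_proportional_left (h : Triple ξ R c a b) : ¬ ∀ i, c 0 * a i = a 0 * c i := by
  intro hp
  have := Fintype.linearIndependent_iff.1 h.indep ![(a 0 : ℝ), -(c 0 : ℝ), 0] (by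
    ext i
    simp [Fin.sum_univ_three, rvec]
    have : (c 0 * a i : ℝ) = a 0 * c i := by exact_mod_cast hp i
    linarith) 0
  simp at this
  exact h.a_ne this

theorem not_proportional_right (h : Triple ξ R c a b) : ¬ ∀ i, b 0 * a i = a 0 * b i := by
  intro hp
  have := Fintype.linearIndependent_iff.1 h.indep ![0, (b 0 : ℝ), -(a 0 : ℝ)] (by
    ext i
    simp [Fin.sum_univ_three, rvec]
    have : (b 0 * a i : ℝ) = a 0 * b i := by exact_mod_cast hp i
    linarith) 2
  simp at this
  exact h.a_ne this

theorem minor_ne_zero (h : Triple ξ R c a b)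
    (hsmall : (4 * R ^ 2) ^ 3 * (znorm a * zL ξ c ^ 3) < 1) : minor a ≠ 0 := by
  intro hm
  obtain ⟨r, s, hr0, ⟨w, hw⟩, h0, h1, h2⟩ := exists_cube_dvd_of_minor_eq_zero hm h.a_ne
  have hR := h.R_pos
  have hap := h.a_pos
  have hr3 : |(r : ℝ)| ^ 3 ≤ znorm a := by
    have hw0 : w ≠ 0 := by
      rintro rfl
      simp at hw
      exact h.a_ne hw
    have : |r| ^ 3 ≤ |a 0| := by
      rw [hw, abs_mul, abs_pow]
      exact le_mul_of_one_le_right (by positivity) (Int.one_le_abs hw0)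
    have : |(r : ℝ)| ^ 3 ≤ |(a 0 : ℝ)| := by exact_mod_cast this
    exact this.trans (abs_le_znorm a 0)
  have key : ∀ i j : Fin 4, (j : ℕ) = i + 1 → s * c i = r * c j := by
    intro i j hij
    have e : |(a 1 * c i - a 0 * c j : ℝ)| ≤ 4 * R * (znorm a * zL ξ c) := by
      have xi := h.pow.2 i
      have x1 : |ξ| ≤ R := by simpa using h.pow.2 1
      have a0 := abs_le_znorm a 0
      have c0 := (abs_le_znorm c 0).trans h.norm_ca
      have ci := abs_err_le ξ c i
      have cj := abs_err_le ξ c j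
      have a1 := (abs_err_le ξ a 1).trans h.L_ac
      have id : (a 1 * c i - a 0 * c j : ℝ) = -(ξ * (a 0 * err ξ c i))
          - ξ ^ (i : ℕ) * (c 0 * err ξ a 1) + err ξ a 1 * err ξ c i + a 0 * err ξ c j := by
        simp only [err, hij, pow_succ]
        simp
        ring
      rw [id]
      have hN : 1 ≤ znorm a := h.one_le.trans h.norm_ca
      have hL0 := zL_nonneg ξ c
      have w1 : 1 * (znorm a * zL ξ c) ≤ R * (znorm a * zL ξ c) := by
        gcongr
        exact h.pow.1
      have w2 : zL ξ c * zL ξ c ≤ znorm a * zL ξ c := by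
        gcongr
        exact h.L_le.trans hN
      have := abs_le.1 (abs_mul_le_mul x1 (abs_mul_le_mul a0 ci))
      have := abs_le.1 (abs_mul_le_mul xi (abs_mul_le_mul c0 a1))
      have := abs_le.1 (abs_mul_le_mul a1 ci)
      have := abs_le.1 (abs_mul_le_mul a0 cj)
      rw [abs_le]
      constructor <;> linarith
    have e2 : |((s * c i - r * c j : ℤ) : ℝ)| ≤ 4 * R ^ 2 * (|(r : ℝ)| * zL ξ c) := by
      have id : (a 0 : ℝ) * ((s * c i - r * c j : ℤ) : ℝ) = r * (a 1 * c i - a 0 * c j) := by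
        have : (s * a 0 : ℝ) = r * a 1 := by exact_mod_cast h0
        push_cast
        linear_combination (c i : ℝ) * this
      have id2 := congrArg abs id
      rw [abs_mul, abs_mul] at id2
      refine le_of_mul_le_mul_left (a := |(a 0 : ℝ)|) ?_ hap
      rw [id2]
      calc _ ≤ |(r : ℝ)| * (4 * R * ((R * |(a 0 : ℝ)|) * zL ξ c)) := by
            refine mul_le_mul_of_nonneg_left (e.trans ?_) (abs_nonneg _)
            have := zL_nonneg ξ c
            gcongr
            exact h.lead_a
        _ = _ := by ring
    have e3 : |((s * c i - r * c j : ℤ) : ℝ)| ^ 3 < 1 := by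
      calc _ ≤ (4 * R ^ 2 * (|(r : ℝ)| * zL ξ c)) ^ 3 := by gcongr
        _ = (4 * R ^ 2) ^ 3 * (|(r : ℝ)| ^ 3 * zL ξ c ^ 3) := by ring
        _ ≤ (4 * R ^ 2) ^ 3 * (znorm a * zL ξ c ^ 3) := by
            have := zL_nonneg ξ c
            gcongr
        _ < 1 := hsmall
    have e4 : |((s * c i - r * c j : ℤ) : ℝ)| < 1 := by
      by_contra! hge
      exact absurd (one_le_pow₀ hge (n := 3)) (not_le.2 e3)
    have e5 : |s * c i - r * c j| < 1 := by exact_mod_cast e4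
    rw [Int.abs_lt_one_iff] at e5
    linarith
  apply h.not_proportional_left
  have k0 : c 0 * a 0 = a 0 * c 0 := by ring
  have k1 : c 0 * a 1 = a 0 * c 1 := by
    apply mul_left_cancel₀ hr0
    linear_combination (-c 0) * h0 + a 0 * key 0 1 rfl
  have k2 : c 0 * a 2 = a 0 * c 2 := by
    apply mul_left_cancel₀ hr0
    linear_combination (-c 0) * h1 + a 0 * key 1 2 rfl + s * k1
  have k3 : c 0 * a 3 = a 0 * c 3 := by
    apply mul_left_cancel₀ hr0
    linear_combination (-c 0) * h2 + a 0 * key 2 3 rfl + s * k2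
  intro i
  fin_cases i
  · exact k0
  · exact k1
  · exact k2
  · exact k3

/-- A rank one condition: a quantity of size `Q` controls the vanishing of the contractions. -/
theorem exists_of_contr_eq_zero (h : Triple ξ R c a b) (hm : minor a ≠ 0)
    (h0 : contr₀ a b = 0) (h1 : contr₁ a b = 0) :
    ∃ Q : ℝ, Q ≤ 6 * R * (znorm a * zL ξ a) ∧ Q ^ 2 ≤ 12 * R * (znorm b * zL ξ a) ∧
      1 ≤ 6 * R * (Q * zL ξ c) := by
  obtain ⟨g, q, u, hg, hgq, hu⟩ := exists_primitive hm
  obtain ⟨k, hk⟩ := Finite.exists_max fun i => |(q i : ℝ)|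
  have hR := h.R_pos
  have hap := h.a_pos
  have hLa : zL ξ a ≤ znorm a := (h.L_ac.trans h.L_le).trans (h.one_le.trans h.norm_ca)
  have gen0 : ∀ y : Fin 4 → ℤ, contr₀ a y = g * (q 0 * y 0 + q 1 * y 1 + q 2 * y 2) := fun y => by
    simp only [contr₀, hgq]
    ring
  have gen1 : ∀ y : Fin 4 → ℤ, contr₁ a y = g * (q 0 * y 1 + q 1 * y 2 + q 2 * y 3) := fun y => by
    simp only [contr₁, hgq]
    ring
  have a0 : q 0 * a 0 + q 1 * a 1 + q 2 * a 2 = 0 := by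
    simpa [gen0, hg] using contr₀_self a
  have a1 : q 0 * a 1 + q 1 * a 2 + q 2 * a 3 = 0 := by
    simpa [gen1, hg] using contr₁_self a
  have b0 : q 0 * b 0 + q 1 * b 1 + q 2 * b 2 = 0 := by simpa [gen0, hg] using h0
  have b1 : q 0 * b 1 + q 1 * b 2 + q 2 * b 3 = 0 := by simpa [gen1, hg] using h1
  refine ⟨|(q k : ℝ)|, ?_, ?_, ?_⟩
  · refine le_trans ?_ (abs_minor_le h.pow hLa k)
    have : |q k| ≤ |minor a k| := by
      rw [hgq, abs_mul]
      exact le_mul_of_one_le_left (abs_nonneg _) (Int.one_le_abs hg)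
    exact_mod_cast this
  · set m : Fin 3 → Fin 3 → ℤ :=
      ![![plucker a b 2 3, -plucker a b 1 3, plucker a b 1 2],
        ![-plucker a b 1 3, plucker a b 0 3 + plucker a b 1 2, -plucker a b 0 2],
        ![plucker a b 1 2, -plucker a b 0 2, plucker a b 0 1]] with hmdef
    have hsymm : ∀ i j, m i j = m j i := by
      intro i j
      fin_cases i <;> fin_cases j <;> simp [hmdef]
    have hpar : ∀ i, m i 0 * q 1 = m i 1 * q 0 ∧ m i 0 * q 2 = m i 2 * q 0 ∧
        m i 1 * q 2 = m i 2 * q 1 := by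
      intro i
      fin_cases i
      · simp only [hmdef, plucker, Matrix.cons_val, Fin.zero_eta]
        refine ⟨?_, ?_, ?_⟩
        · linear_combination b 3 * a1 - a 3 * b1
        · linear_combination -b 2 * a1 + a 2 * b1
        · linear_combination b 1 * a1 - a 1 * b1
      · simp only [hmdef, plucker, Matrix.cons_val, Fin.mk_one]
        refine ⟨?_, ?_, ?_⟩
        · linear_combination -b 3 * a0 + a 3 * b0 - b 2 * a1 + a 2 * b1
        · linear_combination b 2 * a0 - a 2 * b0 + b 1 * a1 - a 1 * b1
        · linear_combination -b 1 * a0 + a 1 * b0 - b 0 * a1 + a 0 * b1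
      · simp only [hmdef, plucker, Matrix.cons_val, Fin.reduceFinMk]
        refine ⟨?_, ?_, ?_⟩
        · linear_combination b 2 * a0 - a 2 * b0
        · linear_combination -b 1 * a0 + a 1 * b0
        · linear_combination b 0 * a0 - a 0 * b0
    have hrow : ∀ i j, m i j = (u 0 * m i 0 + u 1 * m i 1 + u 2 * m i 2) * q j := by
      intro i j
      obtain ⟨p1, p2, p3⟩ := hpar i
      fin_cases j
      · simp only [Fin.zero_eta]
        linear_combination (-m i 0) * hu + u 1 * p1 + u 2 * p2
      · simp only [Fin.mk_one]
        linear_combination (-m i 1) * hu - u 0 * p1 + u 2 * p3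
      · simp only [Fin.reduceFinMk]
        linear_combination (-m i 2) * hu - u 0 * p2 - u 1 * p3
    obtain ⟨t, ht⟩ : ∃ t, ∀ i j, m i j = t * q i * q j := by
      refine ⟨u 0 * (u 0 * m 0 0 + u 1 * m 0 1 + u 2 * m 0 2) +
        u 1 * (u 0 * m 1 0 + u 1 * m 1 1 + u 2 * m 1 2) +
        u 2 * (u 0 * m 2 0 + u 1 * m 2 1 + u 2 * m 2 2), fun i j => ?_⟩
      have e0 := (hsymm i 0).trans (hrow 0 i)
      have e1 := (hsymm i 1).trans (hrow 1 i)
      have e2 := (hsymm i 2).trans (hrow 2 i)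
      rw [hrow i j]
      linear_combination u 0 * q j * e0 + u 1 * q j * e1 + u 2 * q j * e2
    have ht0 : t ≠ 0 := by
      rintro rfl
      have z : ∀ i j, m i j = 0 := fun i j => by simp [ht]
      have z01 : plucker a b 0 1 = 0 := by simpa [hmdef] using z 2 2
      have z02 : plucker a b 0 2 = 0 := by simpa [hmdef] using z 1 2
      have z12 : plucker a b 1 2 = 0 := by simpa [hmdef] using z 0 2
      have z03 : plucker a b 0 3 = 0 := by simpa [hmdef, z12] using z 1 1
      simp only [plucker] at z01 z02 z03
      apply h.not_proportional_right
      intro i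
      fin_cases i
      · simp only [Fin.zero_eta]
        ring
      · simp only [Fin.mk_one]
        linarith
      · simp only [Fin.reduceFinMk]
        linarith
      · simp only [Fin.reduceFinMk]
        linarith
    have hle : |q k| ^ 2 ≤ |m k k| := by
      rw [ht, mul_assoc, abs_mul, ← pow_two, abs_pow]
      exact le_mul_of_one_le_left (by positivity) (Int.one_le_abs ht0)
    have hle' : |(q k : ℝ)| ^ 2 ≤ |(m k k : ℝ)| := by exact_mod_cast hle
    refine hle'.trans ?_
    have pl := abs_plucker_le h.pow h.norm_ab h.L_ba hLa
    have p01 := abs_le.1 (pl 0 1)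
    have p03 := abs_le.1 (pl 0 3)
    have p12 := abs_le.1 (pl 1 2)
    have p23 := abs_le.1 (pl 2 3)
    rw [abs_le]
    fin_cases k
    · simp only [hmdef, Matrix.cons_val, Fin.zero_eta]
      constructor <;> linarith
    · simp only [hmdef, Matrix.cons_val, Fin.mk_one]
      push_cast
      constructor <;> linarith
    · simp only [hmdef, Matrix.cons_val, Fin.reduceFinMk]
      constructor <;> linarith
  · have hq0 : (fun i => (q i : ℝ)) ≠ 0 := by
      intro hz
      have z : ∀ i, q i = 0 := fun i => by simpa using congrFun hz i
      simp [z] at hu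
    have hne : q 0 * c 0 + q 1 * c 1 + q 2 * c 2 ≠ 0 ∨ q 0 * c 1 + q 1 * c 2 + q 2 * c 3 ≠ 0 := by
      by_contra! hcon
      refine not_forall_annihilated hq0 h.indep (fun i => ?_) (fun i => ?_)
      · fin_cases i
        · simpa [rvec] using (by exact_mod_cast hcon.1 :
            (q 0 * c 0 + q 1 * c 1 + q 2 * c 2 : ℝ) = 0)
        · simpa [rvec] using (by exact_mod_cast a0 :
            (q 0 * a 0 + q 1 * a 1 + q 2 * a 2 : ℝ) = 0)
        · simpa [rvec] using (by exact_mod_cast b0 :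
            (q 0 * b 0 + q 1 * b 1 + q 2 * b 2 : ℝ) = 0)
      · fin_cases i
        · simpa [rvec] using (by exact_mod_cast hcon.2 :
            (q 0 * c 1 + q 1 * c 2 + q 2 * c 3 : ℝ) = 0)
        · simpa [rvec] using (by exact_mod_cast a1 :
            (q 0 * a 1 + q 1 * a 2 + q 2 * a 3 : ℝ) = 0)
        · simpa [rvec] using (by exact_mod_cast b1 :
            (q 0 * b 1 + q 1 * b 2 + q 2 * b 3 : ℝ) = 0)
    have hp : ∀ i, |(plucker a c 0 i : ℝ)| ≤ 2 * (znorm a * zL ξ c) := by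
      intro i
      rw [plucker_zero_eq ξ]
      have := abs_le.1 (abs_mul_le_mul ((abs_le_znorm c 0).trans h.norm_ca)
        ((abs_err_le ξ a i).trans h.L_ac))
      have := abs_le.1 (abs_mul_le_mul (abs_le_znorm a 0) (abs_err_le ξ c i))
      rw [abs_le]
      constructor <;> linarith
    have fin : ∀ z : ℤ, z ≠ 0 → ∀ i j l : Fin 4, a 0 * z =
        q 0 * plucker a c 0 i + q 1 * plucker a c 0 j + q 2 * plucker a c 0 l →
        1 ≤ 6 * R * (|(q k : ℝ)| * zL ξ c) := by
      intro z hz i j l heq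
      have heq' : (a 0 * z : ℝ) =
        q 0 * plucker a c 0 i + q 1 * plucker a c 0 j + q 2 * plucker a c 0 l := by
        exact_mod_cast heq
      have e1 : |(a 0 * z : ℝ)| ≤ 6 * (|(q k : ℝ)| * (znorm a * zL ξ c)) := by
        rw [heq', abs_le]
        have := abs_le.1 (abs_mul_le_mul (hk 0) (hp i))
        have := abs_le.1 (abs_mul_le_mul (hk 1) (hp j))
        have := abs_le.1 (abs_mul_le_mul (hk 2) (hp l))
        constructor <;> linarith
      rw [abs_mul] at e1
      have e2 : (1 : ℝ) ≤ |(z : ℝ)| := by exact_mod_cast Int.one_le_abs hz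
      refine le_of_mul_le_mul_left (a := |(a 0 : ℝ)|) ?_ hap
      calc _ ≤ |(a 0 : ℝ)| * |(z : ℝ)| := by gcongr
        _ ≤ 6 * (|(q k : ℝ)| * (znorm a * zL ξ c)) := e1
        _ ≤ 6 * (|(q k : ℝ)| * ((R * |(a 0 : ℝ)|) * zL ξ c)) := by
            have := zL_nonneg ξ c
            gcongr
            exact h.lead_a
        _ = _ := by ring
    rcases hne with hne | hne
    · refine fin _ hne 0 1 2 ?_
      simp only [plucker]
      linear_combination c 0 * a0
    · refine fin _ hne 1 2 3 ?_
      simp only [plucker]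
      linear_combination c 0 * a1

end Triple

theorem exists_abs_eq_znorm (x : Fin 4 → ℤ) : ∃ i, |(x i : ℝ)| = znorm x := by
  by_contra! h
  exact lt_irrefl _ (znorm_lt fun i => lt_of_le_of_ne (abs_le_znorm x i) (h i))

theorem exists_int_eq_znorm (x : Fin 4 → ℤ) : ∃ k : ℤ, (k : ℝ) = znorm x := by
  obtain ⟨i, hi⟩ := exists_abs_eq_znorm x
  exact ⟨|x i|, by rw [← hi]; push_cast; rfl⟩

theorem one_le_znorm {x : Fin 4 → ℤ} (hx : x ≠ 0) : 1 ≤ znorm x := by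
  obtain ⟨i, hi⟩ := Function.ne_iff.1 hx
  have h1 : (1 : ℝ) ≤ |(x i : ℝ)| := by exact_mod_cast Int.one_le_abs hi
  exact h1.trans (abs_le_znorm x i)

theorem znorm_le_lead {ξ R : ℝ} (hR : PowBound ξ R) {x : Fin 4 → ℤ} (hx : x ≠ 0)
    (hL : zL ξ x ≤ 1 / 2) : znorm x ≤ (R + 1) * |(x 0 : ℝ)| := by
  have h1 : znorm x ≤ R * |(x 0 : ℝ)| + 1 / 2 := by
    apply znorm_le
    intro i
    rw [coord_eq ξ x i]
    have := abs_mul_le_mul (hR.2 i) le_rfl (v := (x 0 : ℝ))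
    rw [mul_comm] at this
    have := abs_le.1 this
    have := abs_le.1 ((abs_err_le ξ x i).trans hL)
    rw [abs_le]
    constructor <;> linarith
  have h2 := one_le_znorm hx
  rcases eq_or_ne (x 0) 0 with h0 | h0
  · simp [h0] at h1
    linarith
  · have : (1 : ℝ) ≤ |(x 0 : ℝ)| := by exact_mod_cast Int.one_le_abs h0
    linarith

theorem abs_sub_lt_max {u v : ℝ} (h : 0 < u * v) : |u - v| < max |u| |v| := by
  rcases mul_pos_iff.1 h with ⟨hu, hv⟩ | ⟨hu, hv⟩
  · rw [abs_of_pos hu, abs_of_pos hv, abs_lt]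
    constructor
    · linarith [le_max_right u v]
    · linarith [le_max_left u v]
  · rw [abs_of_neg hu, abs_of_neg hv, abs_lt]
    constructor
    · linarith [le_max_left (-u) (-v)]
    · linarith [le_max_right (-u) (-v)]

namespace IsMinimalSeq
variable {ξ : ℝ} {x : ℕ → Fin 4 → ℤ}

theorem zL_pos (h : IsMinimalSeq ξ x) {m : ℕ} (hm : 1 ≤ m) : 0 < zL ξ (x m) :=
  (zL_nonneg ξ _).trans_lt (h.2.2.1 m hm)

theorem le_znorm (h : IsMinimalSeq ξ x) {m : ℕ} (hm : 1 ≤ m) : (m : ℝ) ≤ znorm (x m) := by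
  induction m, hm using Nat.le_induction with
  | base => simpa using one_le_znorm (h.1 1 le_rfl)
  | succ m hm ih =>
    obtain ⟨k, hk⟩ := exists_int_eq_znorm (x m)
    obtain ⟨k', hk'⟩ := exists_int_eq_znorm (x (m + 1))
    have h1 := h.2.1 m hm
    rw [← hk, ← hk'] at h1
    have h2 : k + 1 ≤ k' := by exact_mod_cast h1
    have h3 : (k : ℝ) + 1 ≤ k' := by exact_mod_cast h2
    push_cast
    linarith

theorem znorm_mono (h : IsMinimalSeq ξ x) {m n : ℕ} (hm : 1 ≤ m) (hmn : m ≤ n) :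
    znorm (x m) ≤ znorm (x n) := by
  induction n, hmn using Nat.le_induction with
  | base => exact le_rfl
  | succ n hn ih => exact ih.trans (h.2.1 n (hm.trans hn)).le

theorem eq_zero_of_lt (h : IsMinimalSeq ξ x) {m : ℕ} (hm : 1 ≤ m) {z : Fin 4 → ℤ}
    (hL : zL ξ z < zL ξ (x m)) (hN : znorm z < znorm (x (m + 1))) : z = 0 := by
  by_contra hz
  exact absurd (h.2.2.2 m hm z hz hL) (not_le.2 hN)

/-- The approximation hypothesis bounds the errors of minimal points. -/
theorem exists_log_bound (h : IsMinimalSeq ξ x) {R c lam : ℝ} (hR : PowBound ξ R) (hc : 0 < c)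
    (hlam : 0 < lam) (happ : ApproxHyp ξ c lam) :
    ∃ M : ℝ, ∃ N : ℕ, ∀ m ≥ N, lam * Real.log (znorm (x (m + 1))) ≤ -Real.log (zL ξ (x m)) + M := by
  obtain ⟨X₀, hX₀⟩ := happ
  have hR0 : 0 < R := lt_of_lt_of_le one_pos hR.1
  refine ⟨Real.log c + lam * Real.log (2 * R), max 1 ⌈2 * R * (|X₀| + c + 1)⌉₊, fun m hm => ?_⟩
  have hm1 : 1 ≤ m := (le_max_left _ _).trans hm
  have hbig : 2 * R * (|X₀| + c + 1) ≤ znorm (x (m + 1)) := by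
    calc _ ≤ ((⌈2 * R * (|X₀| + c + 1)⌉₊ : ℕ) : ℝ) := Nat.le_ceil _
      _ ≤ ((m + 1 : ℕ) : ℝ) := by exact_mod_cast ((le_max_right _ _).trans hm).trans (Nat.le_succ m)
      _ ≤ _ := h.le_znorm (by omega)
  set N := znorm (x (m + 1)) with hN
  have hT : |X₀| + c + 1 ≤ N / (2 * R) := by
    rw [le_div_iff₀ (by positivity)]
    linarith
  have hT1 : 1 ≤ N / (2 * R) := by linarith [abs_nonneg X₀]
  obtain ⟨z, hz, hz0, hzL⟩ := hX₀ (N / (2 * R)) (by linarith [le_abs_self X₀])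
  set T := N / (2 * R) with hTdef
  have hTN : 2 * R * T = N := by rw [hTdef]; field_simp
  have hpow : T ^ (-lam) ≤ 1 := Real.rpow_le_one_of_one_le_of_nonpos hT1 (by linarith)
  have hpos : 0 < T ^ (-lam) := Real.rpow_pos_of_pos (by linarith) _
  have herr : ∀ i, |err ξ z i| ≤ c * T ^ (-lam) := by
    intro i
    rcases Nat.eq_zero_or_pos (i : ℕ) with hi | hi
    · have : i = 0 := Fin.ext hi
      rw [this, err_zero, abs_zero]
      positivity
    · exact hzL i hi
  have hnorm : znorm z < N := by
    apply znorm_lt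
    intro i
    rw [coord_eq ξ z i]
    have := abs_le.1 (abs_mul_le_mul hz0 (hR.2 i))
    have := abs_le.1 (herr i)
    have : c * T ^ (-lam) ≤ c * 1 := by gcongr
    have : 1 * T ≤ R * T := by gcongr; exact hR.1
    rw [abs_lt]
    constructor <;> linarith [abs_nonneg X₀]
  have hle : zL ξ (x m) ≤ c * T ^ (-lam) := by
    by_contra! hlt
    exact hz (h.eq_zero_of_lt hm1 ((zL_le herr).trans_lt hlt) hnorm)
  have hlog := Real.log_le_log (h.zL_pos hm1) hle
  rw [Real.log_mul hc.ne' hpos.ne', Real.log_rpow (by linarith)] at hlog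
  have hTlog : Real.log T = Real.log N - Real.log (2 * R) := by
    rw [← hTN, Real.log_mul (by positivity) (by positivity)]
    ring
  rw [hTlog] at hlog
  linarith

theorem exists_zL_le (h : IsMinimalSeq ξ x) {lam M : ℝ} {N : ℕ} (hlam : 0 < lam)
    (hM : ∀ m ≥ N, lam * Real.log (znorm (x (m + 1))) ≤ -Real.log (zL ξ (x m)) + M)
    {ε : ℝ} (hε : 0 < ε) : ∃ N' : ℕ, ∀ m ≥ N', zL ξ (x m) ≤ ε := by
  have htend : Filter.Tendsto (fun m : ℕ => lam * Real.log ((m : ℝ) + 1)) Filter.atTop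
      Filter.atTop :=
    (Real.tendsto_log_atTop.comp
      (Filter.tendsto_atTop_add_const_right _ _ tendsto_natCast_atTop_atTop)).const_mul_atTop hlam
  obtain ⟨N₁, hN₁⟩ := Filter.eventually_atTop.1 (htend.eventually_ge_atTop (M - Real.log ε))
  refine ⟨max 1 (max N N₁), fun m hm => ?_⟩
  have hm1 : 1 ≤ m := (le_max_left _ _).trans hm
  have hmN : N ≤ m := ((le_max_left _ _).trans (le_max_right _ _)).trans hm
  have hmN₁ : N₁ ≤ m := ((le_max_right _ _).trans (le_max_right _ _)).trans hm
  have h1 := hM m hmN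
  have h2 := hN₁ m hmN₁
  have h3 : Real.log ((m : ℝ) + 1) ≤ Real.log (znorm (x (m + 1))) := by
    apply Real.log_le_log (by positivity)
    exact_mod_cast h.le_znorm (m := m + 1) (by omega)
  have h4 := mul_le_mul_of_nonneg_left h3 hlam.le
  rw [← Real.log_le_log_iff (h.zL_pos hm1) hε]
  linarith

/-- Consecutive minimal points are linearly independent. -/
theorem pair_indep (h : IsMinimalSeq ξ x) {m : ℕ} (hm : 1 ≤ m) :
    LinearIndependent ℝ ![rvec (x m), rvec (x (m + 1))] := by
  rw [LinearIndependent.pair_iff]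
  intro s t hst
  have hc : ∀ i, s * x m i = -(t * x (m + 1) i) := fun i => by
    have := congrFun hst i
    simp [rvec] at this
    linarith
  have hcN : ∀ i, |s| * |(x m i : ℝ)| = |t| * |(x (m + 1) i : ℝ)| := fun i => by
    rw [← abs_mul, ← abs_mul, hc, abs_neg]
  have hcL : ∀ i, |s| * |err ξ (x m) i| = |t| * |err ξ (x (m + 1)) i| := fun i => by
    rw [← abs_mul, ← abs_mul, ← abs_neg (t * _)]
    congr 1
    simp only [err]
    linear_combination ξ ^ (i : ℕ) * hc 0 - hc i
  have hN := h.2.1 m hm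
  have hL := h.2.2.1 m hm
  have hN1 := one_le_znorm (h.1 m hm)
  obtain ⟨i, hi⟩ := exists_abs_eq_znorm (x (m + 1))
  obtain ⟨j, hj⟩ := exists_abs_err_eq ξ (x m)
  have e1 : |t| * znorm (x (m + 1)) ≤ |s| * znorm (x m) := by
    rw [← hi, ← hcN]
    exact mul_le_mul_of_nonneg_left (abs_le_znorm _ _) (abs_nonneg _)
  have e2 : |s| * zL ξ (x m) ≤ |t| * zL ξ (x (m + 1)) := by
    rw [← hj, hcL]
    exact mul_le_mul_of_nonneg_left (abs_err_le _ _ _) (abs_nonneg _)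
  have ht : t = 0 := by
    by_contra ht
    have ht' : 0 < |t| := abs_pos.2 ht
    have f1 : |t| < |s| := by
      by_contra! hle
      have : |s| * znorm (x m) ≤ |t| * znorm (x m) := by gcongr
      have : |t| * znorm (x m) < |t| * znorm (x (m + 1)) := by gcongr
      linarith
    have f2 : |t| * zL ξ (x (m + 1)) < |t| * zL ξ (x m) := by gcongr
    have f3 : |t| * zL ξ (x m) ≤ |s| * zL ξ (x m) :=
      mul_le_mul_of_nonneg_right f1.le (zL_nonneg _ _)
    linarith
  refine ⟨?_, ht⟩
  have : |s| ≤ 0 := by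
    by_contra! hs
    have := mul_pos hs (h.zL_pos hm)
    simp [ht] at e2
    linarith
  exact abs_eq_zero.1 (le_antisymm this (abs_nonneg _))

/-- Consecutive minimal points generate the integer points of the plane they span. -/
theorem exists_int_combination (h : IsMinimalSeq ξ x) {m : ℕ} (hm : 1 ≤ m) {z : Fin 4 → ℤ}
    (hz : rvec z ∈ Submodule.span ℝ {rvec (x m), rvec (x (m + 1))}) :
    ∃ s t : ℤ, ∀ i, z i = s * x m i + t * x (m + 1) i := by
  obtain ⟨s, t, hst⟩ := Submodule.mem_span_pair.1 hz
  have hc : ∀ i, (z i : ℝ) = s * x m i + t * x (m + 1) i := fun i => by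
    have := congrFun hst i
    simp [rvec] at this
    linarith
  have hs := abs_sub_round s
  have ht := abs_sub_round t
  refine ⟨round s, round t, ?_⟩
  set w : Fin 4 → ℤ := fun i => z i - (round s * x m i + round t * x (m + 1) i) with hw
  have hwr : ∀ i, (w i : ℝ) = (s - round s) * x m i + (t - round t) * x (m + 1) i := fun i => by
    simp only [hw]
    push_cast
    rw [hc i]
    ring
  have hN := h.2.1 m hm
  have hL := h.2.2.1 m hm
  have hw0 : w = 0 := by
    apply h.eq_zero_of_lt hm
    · apply zL_lt
      intro i
      have : err ξ w i = (s - round s) * err ξ (x m) i + (t - round t) * err ξ (x (m + 1)) i := by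
        simp only [err, hwr]
        ring
      rw [this]
      have := abs_le.1 (abs_mul_le_mul hs (abs_err_le ξ (x m) i))
      have := abs_le.1 (abs_mul_le_mul ht (abs_err_le ξ (x (m + 1)) i))
      rw [abs_lt]
      constructor <;> linarith
    · apply znorm_lt
      intro i
      rw [hwr]
      have := abs_le.1 (abs_mul_le_mul hs (abs_le_znorm (x m) i))
      have := abs_le.1 (abs_mul_le_mul ht (abs_le_znorm (x (m + 1)) i))
      rw [abs_lt]
      constructor <;> linarith
  intro i
  have := congrFun hw0 i
  simp only [hw, Pi.zero_apply] at this
  linarith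

/-- A lower bound for the area spanned by consecutive minimal points. -/
theorem exists_le_plucker (h : IsMinimalSeq ξ x) {m : ℕ} (hm : 1 ≤ m)
    (h0 : x m 0 ≠ 0) (h0' : x (m + 1) 0 ≠ 0)
    (hξ : ∀ i : Fin 4, zL ξ (x m) < |ξ ^ (i : ℕ)|) :
    ∃ j, |(x (m + 1) 0 : ℝ)| * zL ξ (x m) ≤ 3 * |(plucker (x m) (x (m + 1)) 0 j : ℝ)| := by
  have hN := h.2.1 m hm
  have hL := h.2.2.1 m hm
  set u := x m with hu
  set v := x (m + 1) with hv
  have sgn : ∀ w : Fin 4 → ℤ, w 0 ≠ 0 → zL ξ w ≤ zL ξ u →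
      ∀ i : Fin 4, 0 < (w 0 * ξ ^ (i : ℕ)) * w i := by
    intro w hw hwL i
    have h1 : (1 : ℝ) ≤ |(w 0 : ℝ)| := by exact_mod_cast Int.one_le_abs hw
    have h2 : |(w 0 * ξ ^ (i : ℕ) : ℝ) - w i| < |(w 0 * ξ ^ (i : ℕ) : ℝ)| := by
      calc _ ≤ zL ξ w := abs_err_le ξ w i
        _ ≤ zL ξ u := hwL
        _ < 1 * |ξ ^ (i : ℕ)| := by simpa using hξ i
        _ ≤ |(w 0 : ℝ)| * |ξ ^ (i : ℕ)| := by gcongr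
        _ = _ := (abs_mul _ _).symm
    rw [← sq_lt_sq] at h2
    nlinarith [sq_nonneg (w i : ℝ)]
  obtain ⟨σ, hσ, hσ0⟩ : ∃ σ : ℤ, |σ| = 1 ∧ 0 < (σ * u 0 : ℝ) * v 0 := by
    have hp : (u 0 * v 0 : ℝ) ≠ 0 := by exact_mod_cast mul_ne_zero h0 h0'
    rcases lt_or_gt_of_ne hp with hlt | hgt
    · exact ⟨-1, by simp, by push_cast; linarith⟩
    · exact ⟨1, by simp, by push_cast; linarith⟩
  have hσ' : |(σ : ℝ)| = 1 := by exact_mod_cast hσ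
  have hσσ : (σ : ℝ) * σ = 1 := by
    rw [← abs_mul_abs_self, hσ']
    norm_num
  have same : ∀ i, 0 < (v i : ℝ) * (σ * u i) := by
    intro i
    have a1 := sgn u h0 le_rfl i
    have a2 := sgn v h0' hL.le i
    have hξi : ξ ^ (i : ℕ) ≠ 0 := abs_pos.1 ((zL_nonneg ξ u).trans_lt (hξ i))
    have a3 : 0 < ((σ * u 0 : ℝ) * v 0 * (ξ ^ (i : ℕ)) ^ 2) * ((v i : ℝ) * (σ * u i)) := by
      have := mul_pos a1 a2
      calc 0 < _ := this
        _ = (σ * σ : ℝ) * (u 0 * ξ ^ (i : ℕ) * u i * (v 0 * ξ ^ (i : ℕ) * v i)) := by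
            rw [hσσ, one_mul]
        _ = _ := by ring
    exact (pos_iff_pos_of_mul_pos a3).1 (by positivity)
  have hz : zL ξ u ≤ zL ξ (fun i => v i - σ * u i) := by
    by_contra! hlt
    have hz0 := h.eq_zero_of_lt hm hlt (by
      apply znorm_lt
      intro i
      push_cast
      refine (abs_sub_lt_max (same i)).trans_le ?_
      rw [abs_mul, hσ', one_mul]
      exact max_le (abs_le_znorm v i) ((abs_le_znorm u i).trans hN.le))
    obtain ⟨i, hi⟩ := exists_abs_eq_znorm v
    have hvi := congrFun hz0 i
    have hvi' : (v i : ℝ) = σ * u i := by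
      have : v i = σ * u i := by simpa [sub_eq_zero] using hvi
      exact_mod_cast this
    have : znorm v ≤ znorm u := by
      rw [← hi, hvi', abs_mul, hσ', one_mul]
      exact abs_le_znorm u i
    linarith
  by_contra! hcon
  have hv0 : 0 < |(v 0 : ℝ)| := abs_pos.2 (by exact_mod_cast h0')
  set τ : ℝ := |(u 0 : ℝ)| / |(v 0 : ℝ)| with hτ
  have hτ0 : 0 ≤ τ := by positivity
  have hτu : (σ * u 0 : ℝ) = τ * v 0 := by
    have e1 : |(σ * u 0 : ℝ)| = τ * |(v 0 : ℝ)| := by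
      rw [abs_mul, hσ', one_mul, hτ]
      field_simp
    rcases mul_pos_iff.1 hσ0 with ⟨p1, p2⟩ | ⟨p1, p2⟩
    · rwa [abs_of_pos p1, abs_of_pos p2] at e1
    · rw [abs_of_neg p1, abs_of_neg p2] at e1
      linarith
  have hsmall : ∀ j, |σ * err ξ u j - τ * err ξ v j| < zL ξ u / 3 := by
    intro j
    have e1 := hcon j
    rw [plucker_zero_eq ξ] at e1
    have e2 : |(v 0 * err ξ u j - u 0 * err ξ v j : ℝ)|
        = |(v 0 : ℝ)| * |σ * err ξ u j - τ * err ξ v j| := by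
      rw [← abs_mul, ← one_mul |(v 0 * err ξ u j - u 0 * err ξ v j : ℝ)|, ← hσ', ← abs_mul]
      congr 1
      linear_combination (-err ξ v j) * hτu
    rw [e2] at e1
    by_contra! hge
    have := mul_le_mul_of_nonneg_left hge hv0.le
    linarith
  obtain ⟨j, hj⟩ := exists_abs_err_eq ξ u
  obtain ⟨i, hi⟩ := exists_abs_err_eq ξ (fun i => v i - σ * u i)
  have hL0 := zL_nonneg ξ u
  have hσj : ∀ j, |σ * err ξ u j| = |err ξ u j| := fun j => by rw [abs_mul, hσ', one_mul]
  have b1 : zL ξ u ≤ τ * zL ξ u + zL ξ u / 3 := by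
    have t1 : |σ * err ξ u j| ≤ |σ * err ξ u j - τ * err ξ v j| + |τ * err ξ v j| := by
      simpa using abs_add_le (σ * err ξ u j - τ * err ξ v j) (τ * err ξ v j)
    rw [hσj, hj, abs_mul, abs_of_nonneg hτ0] at t1
    have t2 : τ * |err ξ v j| ≤ τ * zL ξ u := by
      gcongr
      exact (abs_err_le ξ v j).trans hL.le
    have := hsmall j
    linarith
  have ez : err ξ (fun i => v i - σ * u i) i = err ξ v i - σ * err ξ u i := by
    simp only [err]
    push_cast
    ring
  have b2 : τ * zL ξ u ≤ zL ξ u / 3 + |1 - τ| * zL ξ u := by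
    have t1 : τ * |err ξ v i - σ * err ξ u i| ≤
        |σ * err ξ u i - τ * err ξ v i| + |1 - τ| * |err ξ u i| := by
      rw [← hσj i, ← abs_mul, ← abs_of_nonneg hτ0, ← abs_mul, abs_of_nonneg hτ0]
      have : τ * (err ξ v i - σ * err ξ u i) =
        -(σ * err ξ u i - τ * err ξ v i) + (1 - τ) * (σ * err ξ u i) := by ring
      rw [this]
      refine (abs_add_le _ _).trans ?_
      rw [abs_neg]
    rw [← ez, hi] at t1
    have t2 : |1 - τ| * |err ξ u i| ≤ |1 - τ| * zL ξ u := by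
      gcongr
      exact abs_err_le ξ u i
    have t3 : τ * zL ξ u ≤ τ * zL ξ (fun i => v i - σ * u i) := by gcongr
    have := hsmall i
    linarith
  have hLpos : 0 < zL ξ u := h.zL_pos hm
  have c1 : 2 / 3 ≤ τ := by
    by_contra! hlt
    have := mul_lt_mul_of_pos_right hlt hLpos
    linarith
  rcases le_total τ 1 with hle | hle
  · rw [abs_of_nonneg (by linarith)] at b2
    have b3 : (2 * τ - 4 / 3) * zL ξ u ≤ 0 := by linarith
    have : τ = 2 / 3 := by
      by_contra hne
      have : 0 < 2 * τ - 4 / 3 := by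
        have := lt_of_le_of_ne c1 (Ne.symm hne)
        linarith
      have := mul_pos this hLpos
      linarith
    have hs := hsmall j
    have t1 : |σ * err ξ u j| ≤ |σ * err ξ u j - τ * err ξ v j| + |τ * err ξ v j| := by
      simpa using abs_add_le (σ * err ξ u j - τ * err ξ v j) (τ * err ξ v j)
    rw [hσj, hj, abs_mul, abs_of_nonneg hτ0] at t1
    have t2 : τ * |err ξ v j| ≤ τ * zL ξ u := by
      gcongr
      exact (abs_err_le ξ v j).trans hL.le
    rw [this] at t1 t2 hs
    linarith
  · rw [abs_of_nonpos (by linarith)] at b2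
    linarith

end IsMinimalSeq

theorem dvd_mul_contr {a : Fin 4 → ℤ} {p q d : ℤ}
    (h0 : d ∣ q * a 0 - p * a 1) (h1 : d ∣ q * a 1 - p * a 2) (h2 : d ∣ q * a 2 - p * a 3)
    (c : Fin 4 → ℤ) :
    d ∣ p * contr₀ a c ∧ d ∣ p * contr₁ a c ∧ d ∣ q * contr₀ a c ∧ d ∣ q * contr₁ a c := by
  obtain ⟨u0, h0⟩ := h0
  obtain ⟨u1, h1⟩ := h1
  obtain ⟨u2, h2⟩ := h2
  have hp : ∀ i, d ∣ p * minor a i := by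
    intro i
    fin_cases i <;> simp only [minor, Fin.zero_eta, Fin.mk_one, Fin.reduceFinMk, Matrix.cons_val]
    · exact ⟨a 2 * u1 - a 1 * u2, by linear_combination a 2 * h1 - a 1 * h2⟩
    · exact ⟨a 0 * u2 - a 2 * u0, by linear_combination a 0 * h2 - a 2 * h0⟩
    · exact ⟨a 1 * u0 - a 0 * u1, by linear_combination a 1 * h0 - a 0 * h1⟩
  have hq : ∀ i, d ∣ q * minor a i := by
    intro i
    fin_cases i <;> simp only [minor, Fin.zero_eta, Fin.mk_one, Fin.reduceFinMk, Matrix.cons_val]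
    · exact ⟨a 3 * u1 - a 2 * u2, by linear_combination a 3 * h1 - a 2 * h2⟩
    · exact ⟨a 1 * u2 - a 3 * u0, by linear_combination a 1 * h2 - a 3 * h0⟩
    · exact ⟨a 2 * u0 - a 1 * u1, by linear_combination a 2 * h0 - a 1 * h1⟩
  simp only [contr₀, contr₁, mul_add, ← mul_assoc]
  exact ⟨((hp 0).mul_right _ |>.add ((hp 1).mul_right _)).add ((hp 2).mul_right _),
    ((hp 0).mul_right _ |>.add ((hp 1).mul_right _)).add ((hp 2).mul_right _),
    ((hq 0).mul_right _ |>.add ((hq 1).mul_right _)).add ((hq 2).mul_right _),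
    ((hq 0).mul_right _ |>.add ((hq 1).mul_right _)).add ((hq 2).mul_right _)⟩

/-- The minors of three points that contain the first coordinate. -/
def leadMinor (x y z : Fin 4 → ℤ) (j k : Fin 4) : ℤ :=
  x 0 * plucker y z j k - y 0 * plucker x z j k + z 0 * plucker x y j k

theorem Triple.abs_leadMinor_le {ξ R : ℝ} {c a b : Fin 4 → ℤ} (h : Triple ξ R c a b)
    (j k : Fin 4) : |(leadMinor c a b j k : ℝ)| ≤ 6 * (znorm b * zL ξ a * zL ξ c) := by
  have hb0 := abs_le_znorm b 0
  have ha0 := (abs_le_znorm a 0).trans h.norm_ab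
  have hc0 := ((abs_le_znorm c 0).trans h.norm_ca).trans h.norm_ab
  have key : ∀ j k : Fin 4, |(c 0 * (err ξ a j * err ξ b k) : ℝ)| ≤ znorm b * zL ξ a * zL ξ c ∧
      |(a 0 * (err ξ c j * err ξ b k) : ℝ)| ≤ znorm b * zL ξ a * zL ξ c ∧
      |(b 0 * (err ξ c j * err ξ a k) : ℝ)| ≤ znorm b * zL ξ a * zL ξ c := by
    intro j k
    have ca := (abs_err_le ξ a j).trans h.L_ac
    have bk := (abs_err_le ξ b k).trans h.L_ba
    have ak := abs_err_le ξ a k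
    have cj := abs_err_le ξ c j
    refine ⟨?_, ?_, ?_⟩
    · exact (abs_mul_le_mul hc0 (abs_mul_le_mul ca bk)).trans (by linarith)
    · exact (abs_mul_le_mul ha0 (abs_mul_le_mul cj bk)).trans (by linarith)
    · exact (abs_mul_le_mul hb0 (abs_mul_le_mul cj ak)).trans (by linarith)
  have e : (leadMinor c a b j k : ℝ) =
      c 0 * (err ξ a j * err ξ b k) - c 0 * (err ξ a k * err ξ b j)
      - a 0 * (err ξ c j * err ξ b k) + a 0 * (err ξ c k * err ξ b j)
      + b 0 * (err ξ c j * err ξ a k) - b 0 * (err ξ c k * err ξ a j) := by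
    simp only [leadMinor, plucker]
    push_cast
    rw [coord_eq ξ a j, coord_eq ξ b j, coord_eq ξ c j, coord_eq ξ a k, coord_eq ξ b k,
      coord_eq ξ c k]
    ring
  rw [e]
  obtain ⟨u1, u2, u3⟩ := key j k
  obtain ⟨v1, v2, v3⟩ := key k j
  rw [abs_le] at *
  constructor <;> linarith

theorem det_cast_ne_zero_iff (v : Fin 4 → Fin 4 → ℤ) :
    LinearIndependent ℝ (fun i => rvec (v i)) ↔ (Matrix.of v).det ≠ 0 := by
  have h : (fun i => rvec (v i)) = ((Matrix.of v).map (Int.cast : ℤ → ℝ)).row := rfl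
  rw [h, Matrix.linearIndependent_rows_iff_isUnit, Matrix.isUnit_iff_isUnit_det, isUnit_iff_ne_zero]
  have := (Int.castRingHom ℝ).map_det (Matrix.of v)
  have h2 : ((Matrix.of v).map (Int.cast : ℤ → ℝ)).det = ((Matrix.of v).det : ℝ) := this.symm
  rw [h2]
  exact_mod_cast Iff.rfl

/-- A point outside of a rational hyperplane cannot be too close to it. -/
theorem Triple.volume_le {ξ R : ℝ} {c a b n y m : Fin 4 → ℤ} (h : Triple ξ R c a b)
    (h' : Triple ξ R m n y) (hn : ¬ LinearIndependent ℝ ![rvec c, rvec a, rvec b, rvec n])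
    (hy : LinearIndependent ℝ ![rvec c, rvec a, rvec b, rvec y]) :
    znorm n ≤ 108 * R ^ 2 * ((znorm b * zL ξ a * zL ξ c) * (znorm y * zL ξ n)) := by
  have e : ∀ z, ![rvec c, rvec a, rvec b, rvec z] = fun i => rvec (![c, a, b, z] i) := by
    intro z
    ext i
    fin_cases i <;> rfl
  rw [e, det_cast_ne_zero_iff, not_not] at hn
  rw [e, det_cast_ne_zero_iff] at hy
  have id : n 0 * (Matrix.of ![c, a, b, y]).det - y 0 * (Matrix.of ![c, a, b, n]).det =
      leadMinor c a b 2 3 * plucker n y 0 1 - leadMinor c a b 1 3 * plucker n y 0 2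
      + leadMinor c a b 1 2 * plucker n y 0 3 := by
    simp only [Matrix.det_succ_row_zero, leadMinor, plucker, Fin.sum_univ_succ]
    simp [Fin.succAbove]
    ring
  rw [hn, mul_zero, sub_zero] at id
  have hid : (n 0 * (Matrix.of ![c, a, b, y]).det : ℝ) =
      leadMinor c a b 2 3 * plucker n y 0 1 - leadMinor c a b 1 3 * plucker n y 0 2
      + leadMinor c a b 1 2 * plucker n y 0 3 := by exact_mod_cast id
  have hdet : (1 : ℝ) ≤ |((Matrix.of ![c, a, b, y]).det : ℝ)| := by
    exact_mod_cast Int.one_le_abs hy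
  have hL : zL ξ n ≤ znorm n := (h'.L_ac.trans h'.L_le).trans (h'.one_le.trans h'.norm_ca)
  have hp := fun j => abs_plucker_le h.pow h'.norm_ab h'.L_ba hL 0 j
  have k1 := abs_mul_le_mul (h.abs_leadMinor_le 2 3) (hp 1)
  have k2 := abs_mul_le_mul (h.abs_leadMinor_le 1 3) (hp 2)
  have k3 := abs_mul_le_mul (h.abs_leadMinor_le 1 2) (hp 3)
  have hR := h.R_pos
  have key : |(n 0 * (Matrix.of ![c, a, b, y]).det : ℝ)| ≤
      108 * R * ((znorm b * zL ξ a * zL ξ c) * (znorm y * zL ξ n)) := by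
    rw [hid]
    rw [abs_le] at *
    constructor <;> linarith
  rw [abs_mul] at key
  calc znorm n ≤ R * |(n 0 : ℝ)| := h'.lead_a
    _ ≤ R * (|(n 0 : ℝ)| * |((Matrix.of ![c, a, b, y]).det : ℝ)|) := by
        gcongr
        exact le_mul_of_one_le_right (abs_nonneg _) hdet
    _ ≤ R * (108 * R * ((znorm b * zL ξ a * zL ξ c) * (znorm y * zL ξ n))) := by gcongr
    _ = _ := by ring

/-- Two successive triples which span the same plane lattice. -/
structure Step (ξ R : ℝ) (c a b c' a' b' : Fin 4 → ℤ) : Prop where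
  left : Triple ξ R c a b
  right : Triple ξ R c' a' b'
  comb : ∃ α β γ δ : ℤ, (∀ i, a' i = α * a i + β * b i) ∧ (∀ i, c' i = γ * a i + δ * b i) ∧
    |α * δ - β * γ| = 1
  lead_b : znorm b ≤ R * |(b 0 : ℝ)|
  area_left : ∃ j, |(b 0 : ℝ)| * zL ξ a ≤ 3 * |(plucker a b 0 j : ℝ)|
  area_right : ∃ j, |(a' 0 : ℝ)| * zL ξ c' ≤ 3 * |(plucker c' a' 0 j : ℝ)|

namespace Triple
variable {ξ R : ℝ} {c a b : Fin 4 → ℤ}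

theorem one_le_a (h : Triple ξ R c a b) : 1 ≤ znorm a := h.one_le.trans h.norm_ca

theorem one_le_b (h : Triple ξ R c a b) : 1 ≤ znorm b := h.one_le_a.trans h.norm_ab

theorem L_a_pos (h : Triple ξ R c a b) : 0 < zL ξ a := h.L_pos.trans_le h.L_ba

theorem L_c_pos (h : Triple ξ R c a b) : 0 < zL ξ c := h.L_a_pos.trans_le h.L_ac

theorem L_a_le (h : Triple ξ R c a b) : zL ξ a ≤ 1 := h.L_ac.trans h.L_le

theorem abs_contr_ab_le (h : Triple ξ R c a b) :
    |(contr₀ a b : ℝ)| ≤ 40 * R ^ 2 * (znorm b * zL ξ a * zL ξ a) ∧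
    |(contr₁ a b : ℝ)| ≤ 40 * R ^ 2 * (znorm b * zL ξ a * zL ξ a) := by
  have hL : zL ξ a ≤ znorm a := h.L_a_le.trans h.one_le_a
  obtain ⟨h0, h1⟩ := abs_contr_le h.pow hL b
  have e : znorm a * zL ξ a * zL ξ b ≤ znorm b * zL ξ a * zL ξ a := by
    have := h.norm_ab
    have := h.L_ba
    have := h.L_a_pos
    have := h.L_pos
    have := h.one_le_b
    gcongr
  have : 20 * R ^ 2 * (znorm a * zL ξ a * zL ξ b) ≤ 20 * R ^ 2 * (znorm b * zL ξ a * zL ξ a) := by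
    gcongr
  constructor <;> linarith

theorem abs_contr_ac_le (h : Triple ξ R c a b) :
    |(contr₀ a c : ℝ)| ≤ 40 * R ^ 2 * (znorm a * zL ξ a * zL ξ c) ∧
    |(contr₁ a c : ℝ)| ≤ 40 * R ^ 2 * (znorm a * zL ξ a * zL ξ c) := by
  have hL : zL ξ a ≤ znorm a := h.L_a_le.trans h.one_le_a
  obtain ⟨h0, h1⟩ := abs_contr_le h.pow hL c
  have e : znorm c * zL ξ a * zL ξ a ≤ znorm a * zL ξ a * zL ξ c := by
    have := h.norm_ca
    have := h.L_ac
    have := h.L_a_pos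
    have := h.one_le_a
    gcongr
  have : 20 * R ^ 2 * (znorm c * zL ξ a * zL ξ a) ≤ 20 * R ^ 2 * (znorm a * zL ξ a * zL ξ c) := by
    gcongr
  constructor <;> linarith

end Triple

namespace Step
variable {ξ R : ℝ} {c a b c' a' b' : Fin 4 → ℤ}

theorem abs_plucker_eq (h : Step ξ R c a b c' a' b') (i j : Fin 4) :
    |(plucker c' a' i j : ℝ)| = |(plucker a b i j : ℝ)| := by
  obtain ⟨α, β, γ, δ, h1, h2, h3⟩ := h.comb
  have : plucker c' a' i j = -(α * δ - β * γ) * plucker a b i j := by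
    simp only [plucker, h1, h2]
    ring
  rw [← Int.cast_abs, this, abs_mul, abs_neg, h3, one_mul, Int.cast_abs]

theorem area_le (h : Step ξ R c a b c' a' b') :
    znorm a' * zL ξ c' ≤ 18 * R ^ 2 * (znorm b * zL ξ a) := by
  obtain ⟨j, hj⟩ := h.area_right
  rw [h.abs_plucker_eq] at hj
  have hL : zL ξ a ≤ znorm a := h.left.L_a_le.trans h.left.one_le_a
  have h1 := abs_plucker_le h.left.pow h.left.norm_ab h.left.L_ba hL 0 j
  have hR := h.left.R_pos
  have := h.right.L_c_pos
  calc znorm a' * zL ξ c' ≤ (R * |(a' 0 : ℝ)|) * zL ξ c' := by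
        gcongr
        exact h.right.lead_a
    _ = R * (|(a' 0 : ℝ)| * zL ξ c') := by ring
    _ ≤ R * (3 * (6 * R * (znorm b * zL ξ a))) := by
        exact mul_le_mul_of_nonneg_left (hj.trans (by gcongr)) hR.le
    _ = _ := by ring

theorem area_ge (h : Step ξ R c a b c' a' b') :
    znorm b * zL ξ a ≤ 18 * R ^ 2 * (znorm a' * zL ξ c') := by
  obtain ⟨j, hj⟩ := h.area_left
  rw [← h.abs_plucker_eq] at hj
  have hL : zL ξ c' ≤ znorm c' := h.right.L_le.trans h.right.one_le
  have h1 := abs_plucker_le h.left.pow h.right.norm_ca h.right.L_ac hL 0 j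
  have hR := h.left.R_pos
  have := h.left.L_a_pos
  calc znorm b * zL ξ a ≤ (R * |(b 0 : ℝ)|) * zL ξ a := by
        gcongr
        exact h.lead_b
    _ = R * (|(b 0 : ℝ)| * zL ξ a) := by ring
    _ ≤ R * (3 * (6 * R * (znorm a' * zL ξ c'))) := by
        exact mul_le_mul_of_nonneg_left (hj.trans (by gcongr)) hR.le
    _ = _ := by ring

theorem exists_relation (h : Step ξ R c a b c' a' b') : ∃ D : ℝ, |D| = 1 ∧
    a 0 * ((contr₁ a' c' : ℝ) - contr₀ a' c' * ξ) + contr₀ a' c' * err ξ a 1 =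
      D * (a' 0 * ((contr₁ a b : ℝ) - contr₀ a b * ξ) + contr₀ a b * err ξ a' 1) := by
  obtain ⟨α, β, γ, δ, h1, h2, h3⟩ := h.comb
  refine ⟨((α * δ - β * γ : ℤ) : ℝ), by rw [← Int.cast_abs, h3]; simp, ?_⟩
  have h4 := (contr_relation h1 h2).1
  have h5 : (contr₁ a' c' * a 0 - contr₀ a' c' * a 1 : ℝ) =
      ((α * δ - β * γ : ℤ) : ℝ) * (contr₁ a b * a' 0 - contr₀ a b * a' 1) := by exact_mod_cast h4
  have e1 := coord_eq ξ a 1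
  have e2 := coord_eq ξ a' 1
  simp only [Fin.val_one, pow_one] at e1 e2
  rw [e1, e2] at h5
  linear_combination h5

theorem abs_contr_mul_err_le (h : Step ξ R c a b c' a' b') : |(contr₀ a b * err ξ a' 1 : ℝ)| ≤
    720 * R ^ 4 * (znorm a' * zL ξ a' * zL ξ c' * zL ξ a) := by
  have h1 := abs_mul_le_mul h.left.abs_contr_ab_le.1 (abs_err_le ξ a' 1)
  refine h1.trans ?_
  have := h.left.L_a_pos
  have := h.right.L_a_pos
  calc _ = 40 * R ^ 2 * ((znorm b * zL ξ a) * zL ξ a * zL ξ a') := by ring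
    _ ≤ 40 * R ^ 2 * ((18 * R ^ 2 * (znorm a' * zL ξ c')) * zL ξ a * zL ξ a') := by
      have := h.area_ge
      gcongr ?_ * (?_ * _ * _)
    _ = _ := by ring

theorem abs_eval_contr_le (h : Step ξ R c a b c' a' b') : |(contr₁ a b : ℝ) - contr₀ a b * ξ| ≤
    840 * R ^ 5 * (znorm a * zL ξ a' * zL ξ c') := by
  obtain ⟨D, hD, hrel⟩ := h.exists_relation
  have hR1 := h.left.pow.1
  have hξ : |ξ| ≤ R := by simpa using h.left.pow.2 1
  have k1 := h.abs_contr_mul_err_le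
  obtain ⟨k2, k3⟩ := h.right.abs_contr_ac_le
  have p1 := h.left.L_a_pos
  have p2 := h.right.L_a_pos
  have p3 := h.right.L_c_pos
  have p4 := h.right.one_le_a
  have p5 := h.left.one_le_a
  have hT : 0 ≤ znorm a' * zL ξ a' * zL ξ c' := by positivity
  set T := znorm a' * zL ξ a' * zL ξ c' with hTdef
  have hLN : zL ξ a ≤ znorm a := h.left.L_a_le.trans p5
  have k4 : |(contr₁ a' c' : ℝ) - contr₀ a' c' * ξ| ≤ 80 * R ^ 3 * T := by
    have u1 := abs_mul_le_mul k2 hξ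
    have u2 : 40 * R ^ 2 * T ≤ 40 * R ^ 3 * T := by
      gcongr
      norm_num
    rw [abs_le] at *
    constructor <;> linarith
  have k5 := abs_mul_le_mul (abs_le_znorm a 0) k4
  have k6 := abs_mul_le_mul k2 ((abs_err_le ξ a 1).trans hLN)
  have k7 : |(a' 0 : ℝ)| * |(contr₁ a b : ℝ) - contr₀ a b * ξ| ≤ 840 * R ^ 4 * (T * znorm a) := by
    rw [← abs_mul]
    have e : |D * (a' 0 * ((contr₁ a b : ℝ) - contr₀ a b * ξ))| =
      |(a' 0 * ((contr₁ a b : ℝ) - contr₀ a b * ξ))| := by rw [abs_mul, hD, one_mul]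
    rw [← e]
    have e2 : D * (a' 0 * ((contr₁ a b : ℝ) - contr₀ a b * ξ)) =
      a 0 * ((contr₁ a' c' : ℝ) - contr₀ a' c' * ξ) + contr₀ a' c' * err ξ a 1
       - D * (contr₀ a b * err ξ a' 1) := by linear_combination -hrel
    rw [e2]
    have k8 : |D * (contr₀ a b * err ξ a' 1)| ≤ 720 * R ^ 4 * (T * znorm a) := by
      rw [abs_mul, hD, one_mul]
      refine k1.trans ?_
      gcongr
    have u1 : 80 * R ^ 3 * (T * znorm a) ≤ 80 * R ^ 4 * (T * znorm a) := by
      gcongr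
      norm_num
    have u2 : 40 * R ^ 2 * (T * znorm a) ≤ 40 * R ^ 4 * (T * znorm a) := by
      gcongr
      norm_num
    rw [abs_le] at *
    constructor <;> linarith
  have hpos : 0 < znorm a' := by linarith
  refine le_of_mul_le_mul_left ?_ hpos
  calc znorm a' * |(contr₁ a b : ℝ) - contr₀ a b * ξ|
      ≤ (R * |(a' 0 : ℝ)|) * |(contr₁ a b : ℝ) - contr₀ a b * ξ| := by
        gcongr
        exact h.right.lead_a
    _ = R * (|(a' 0 : ℝ)| * |(contr₁ a b : ℝ) - contr₀ a b * ξ|) := by ring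
    _ ≤ R * (840 * R ^ 4 * (T * znorm a)) := by gcongr
    _ = _ := by rw [hTdef]; ring

theorem abs_eval_contr_right_le (h : Step ξ R c a b c' a' b') :
    |(contr₁ a' c' : ℝ) - contr₀ a' c' * ξ| * znorm a ≤
    760 * R ^ 5 * (|(contr₁ a b : ℝ) - contr₀ a b * ξ| * znorm a' +
      znorm a' * zL ξ a' * zL ξ c' * zL ξ a) := by
  obtain ⟨D, hD, hrel⟩ := h.exists_relation
  have hR1 := h.left.pow.1
  have k1 := h.abs_contr_mul_err_le
  obtain ⟨k2, k3⟩ := h.right.abs_contr_ac_le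
  have p1 := h.left.L_a_pos
  have p2 := h.right.L_a_pos
  have p3 := h.right.L_c_pos
  have p4 := h.right.one_le_a
  have hT : 0 ≤ znorm a' * zL ξ a' * zL ξ c' * zL ξ a := by positivity
  have k5 := abs_mul_le_mul (abs_le_znorm a' 0) (le_refl |(contr₁ a b : ℝ) - contr₀ a b * ξ|)
  have k6 := abs_mul_le_mul k2 (abs_err_le ξ a 1)
  set T := znorm a' * zL ξ a' * zL ξ c' * zL ξ a with hTdef
  set E := |(contr₁ a b : ℝ) - contr₀ a b * ξ| with hE
  have hE0 : 0 ≤ E := abs_nonneg _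
  have k7 : |(a 0 : ℝ)| * |(contr₁ a' c' : ℝ) - contr₀ a' c' * ξ| ≤
      760 * R ^ 4 * (E * znorm a' + T) := by
    rw [← abs_mul]
    have e2 : a 0 * ((contr₁ a' c' : ℝ) - contr₀ a' c' * ξ) =
      D * (a' 0 * ((contr₁ a b : ℝ) - contr₀ a b * ξ)) + D * (contr₀ a b * err ξ a' 1)
       - contr₀ a' c' * err ξ a 1 := by linear_combination hrel
    rw [e2]
    have k8 : |D * (contr₀ a b * err ξ a' 1)| ≤ 720 * R ^ 4 * T := by
      rw [abs_mul, hD, one_mul]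
      exact k1
    have k9 : |D * (a' 0 * ((contr₁ a b : ℝ) - contr₀ a b * ξ))| ≤ znorm a' * E := by
      rw [abs_mul, hD, one_mul]
      exact k5
    have u1 : 1 * (znorm a' * E) ≤ 760 * R ^ 4 * (znorm a' * E) := by
      have : 1 ≤ R ^ 4 := one_le_pow₀ hR1
      gcongr
      linarith
    have u2 : 40 * R ^ 2 * T ≤ 40 * R ^ 4 * T := by
      gcongr
      norm_num
    rw [abs_le] at *
    constructor <;> linarith
  calc |(contr₁ a' c' : ℝ) - contr₀ a' c' * ξ| * znorm a
      ≤ |(contr₁ a' c' : ℝ) - contr₀ a' c' * ξ| * (R * |(a 0 : ℝ)|) := by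
        gcongr
        exact h.left.lead_a
    _ = R * (|(a 0 : ℝ)| * |(contr₁ a' c' : ℝ) - contr₀ a' c' * ξ|) := by ring
    _ ≤ R * (760 * R ^ 4 * (E * znorm a' + T)) := by gcongr
    _ = _ := by ring

theorem dvd_contr (h : Step ξ R c a b c' a' b') {d : ℤ}
    (h0 : d ∣ contr₀ a b) (h1 : d ∣ contr₁ a b) :
    d ∣ contr₀ a' c' * contr₀ a c ∧ d ∣ contr₀ a' c' * contr₁ a c ∧
      d ∣ contr₁ a' c' * contr₀ a c ∧ d ∣ contr₁ a' c' * contr₁ a c := by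
  obtain ⟨α, β, γ, δ, k1, k2, k3⟩ := h.comb
  obtain ⟨r0, r1, r2⟩ := contr_relation k1 k2
  refine dvd_mul_contr ?_ ?_ ?_ c
  · rw [r0]
    exact (dvd_sub (h1.mul_right _) (h0.mul_right _)).mul_left _
  · rw [r1]
    exact (dvd_sub (h1.mul_right _) (h0.mul_right _)).mul_left _
  · rw [r2]
    exact (dvd_sub (h1.mul_right _) (h0.mul_right _)).mul_left _

theorem contr_right_ne (h : Step ξ R c a b c' a' b')
    (hA : contr₀ a b ≠ 0 ∨ contr₁ a b ≠ 0) (hm : minor a' ≠ 0) :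
    contr₀ a' c' ≠ 0 ∨ contr₁ a' c' ≠ 0 := by
  by_contra! h0
  obtain ⟨α, β, γ, δ, k1, k2, k3⟩ := h.comb
  obtain ⟨r0, r1, r2⟩ := contr_relation k1 k2
  have hD : α * δ - β * γ ≠ 0 := by
    intro h0
    simp [h0] at k3
  simp only [h0.1, h0.2, zero_mul, sub_zero, zero_eq_mul, hD, false_or] at r0 r1 r2
  apply hm
  have key : ∀ i, contr₀ a b * minor a' i = 0 ∧ contr₁ a b * minor a' i = 0 := by
    intro i
    fin_cases i <;> simp only [minor, Fin.zero_eta, Fin.mk_one, Fin.reduceFinMk, Matrix.cons_val]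
    · exact ⟨by linear_combination a' 2 * r1 - a' 1 * r2,
        by linear_combination a' 3 * r1 - a' 2 * r2⟩
    · exact ⟨by linear_combination a' 0 * r2 - a' 2 * r0,
        by linear_combination a' 1 * r2 - a' 3 * r0⟩
    · exact ⟨by linear_combination a' 1 * r0 - a' 0 * r1,
        by linear_combination a' 2 * r0 - a' 1 * r1⟩
  ext i
  rcases hA with hA | hA
  · exact (mul_eq_zero.1 (key i).1).resolve_left hA
  · exact (mul_eq_zero.1 (key i).2).resolve_left hA

end Step

/-- Logarithmic data of the chain. -/
structure LogChain (lam M : ℝ) (X Y l k : ℕ → ℝ) (J : ℕ → Prop) : Prop where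
  one_le : 1 ≤ M
  X_nonneg : ∀ n, 0 ≤ X n
  X_le_Y : ∀ n, X n ≤ Y n
  Y_le_X : ∀ n, Y n ≤ X (n + 1)
  lam_Y : ∀ n, lam * Y n ≤ l n + M
  lam_X : ∀ n, lam * X n ≤ k n + M
  sum_le : ∀ n, l n + k n ≤ X n + M
  area_le : ∀ n, X (n + 1) - k (n + 1) ≤ Y n - l n + M
  area_ge : ∀ n, Y n - l n ≤ X (n + 1) - k (n + 1) + M
  vol : ∀ r a, r ≤ a → J a → (∀ t, r ≤ t → t < a → ¬ J t) →
    l r + k r - Y r + l (a + 1) + X (a + 1) - Y (a + 1) ≤ M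

namespace LogChain
variable {lam M : ℝ} {X Y l k : ℕ → ℝ} {J : ℕ → Prop}

theorem Y_nonneg (h : LogChain lam M X Y l k J) (n : ℕ) : 0 ≤ Y n :=
  (h.X_nonneg n).trans (h.X_le_Y n)

theorem rat_Y (h : LogChain lam M X Y l k J) (hlam : 849 / 2000 ≤ lam) (n : ℕ) :
    849 / 2000 * Y n ≤ l n + M :=
  (mul_le_mul_of_nonneg_right hlam (h.Y_nonneg n)).trans (h.lam_Y n)

theorem rat_X (h : LogChain lam M X Y l k J) (hlam : 849 / 2000 ≤ lam) (n : ℕ) :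
    849 / 2000 * X n ≤ k n + M :=
  (mul_le_mul_of_nonneg_right hlam (h.X_nonneg n)).trans (h.lam_X n)

theorem vol_self (h : LogChain lam M X Y l k J) {a : ℕ} (ha : J a) :
    l a + k a - Y a + l (a + 1) + X (a + 1) - Y (a + 1) ≤ M :=
  h.vol a a le_rfl ha fun _ ht ht' => absurd ht' (not_lt.2 ht)

theorem vol_pred (h : LogChain lam M X Y l k J) {a : ℕ} (h0 : ¬ J a) (ha : J (a + 1)) :
    l a + k a - Y a + l (a + 2) + X (a + 2) - Y (a + 2) ≤ M :=
  h.vol a (a + 1) (by omega) ha fun t ht ht' => by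
    obtain rfl : t = a := by omega
    exact h0

theorem vol_pred_pred (h : LogChain lam M X Y l k J) {a : ℕ} (h0 : ¬ J a) (h1 : ¬ J (a + 1))
    (ha : J (a + 2)) :
    l a + k a - Y a + l (a + 3) + X (a + 3) - Y (a + 3) ≤ M :=
  h.vol a (a + 2) (by omega) ha fun t ht ht' => by
    obtain rfl | rfl : t = a ∨ t = a + 1 := by omega
    · exact h0
    · exact h1

/-- Two consecutive indices outside `J` followed by one in `J` occur only early. -/
theorem bound_of_not_not_mem (h : LogChain lam M X Y l k J) (hlam : 849 / 2000 ≤ lam) {a : ℕ}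
    (h0 : ¬ J a) (h1 : ¬ J (a + 1)) (h2 : J (a + 2)) : X a ≤ 1000000 * M := by
  have hM := h.one_le
  have := h.X_nonneg a
  have := h.vol_pred_pred h0 h1 h2
  have := h.vol_pred h1 h2
  have := h.vol_self h2
  have := h.rat_Y hlam a
  have := h.rat_X hlam a
  have := h.rat_Y hlam (a + 1)
  have := h.rat_X hlam (a + 1)
  have := h.rat_Y hlam (a + 2)
  have := h.rat_X hlam (a + 2)
  have := h.rat_Y hlam (a + 3)
  have := h.rat_X hlam (a + 3)
  have := h.sum_le a
  have := h.sum_le (a + 3)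
  have := h.Y_le_X a
  have := h.Y_le_X (a + 1)
  have := h.Y_le_X (a + 2)
  linarith

/-- Three consecutive elements of `J`: first smallness estimate. -/
theorem allJ_first (h : LogChain lam M X Y l k J) (hlam : 849 / 2000 ≤ lam) {i : ℕ}
    (h0 : J i) (h1 : J (i + 1)) :
    Y (i + 2) - 3 * l (i + 2) + X (i + 1) - k (i + 2) ≤ 100 * M - 3 / 1000 * X (i + 2) := by
  have hM := h.one_le
  have := h.X_nonneg (i + 2)
  have := h.vol_self h0
  have := h.vol_self h1
  have := h.rat_Y hlam i
  have := h.rat_X hlam i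
  have := h.rat_Y hlam (i + 1)
  have := h.rat_X hlam (i + 1)
  have := h.rat_Y hlam (i + 2)
  have := h.rat_X hlam (i + 2)
  have := h.sum_le i
  have := h.Y_le_X i
  have := h.Y_le_X (i + 1)
  linarith

theorem allJ_second (h : LogChain lam M X Y l k J) (hlam : 849 / 2000 ≤ lam) {i : ℕ}
    (h1 : J (i + 1)) (h2 : J (i + 2)) :
    Y (i + 1) - 2 * l (i + 1) + X (i + 2) - l (i + 3) - k (i + 3)
      ≤ 100 * M - 3 / 1000 * X (i + 2) := by
  have hM := h.one_le
  have := h.X_nonneg (i + 2)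
  have := h.vol_self h1
  have := h.vol_self h2
  have := h.rat_Y hlam (i + 1)
  have := h.rat_X hlam (i + 1)
  have := h.rat_Y hlam (i + 2)
  have := h.rat_X hlam (i + 2)
  have := h.rat_Y hlam (i + 3)
  have := h.rat_X hlam (i + 3)
  have := h.sum_le (i + 1)
  have := h.Y_le_X (i + 1)
  have := h.Y_le_X (i + 2)
  linarith

/-- The values at `ξ` of the polynomials attached to the chain tend to zero along `J`. -/
theorem eval_small (h : LogChain lam M X Y l k J) (hlam : 849 / 2000 ≤ lam) {i : ℕ} (h0 : J i) :
    X i - l (i + 1) - k (i + 1) ≤ 100 * M - 3 / 1000 * X (i + 1) := by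
  have hM := h.one_le
  have := h.vol_self h0
  have := h.rat_Y hlam (i + 1)
  have := h.rat_X hlam (i + 1)
  have := h.rat_X hlam i
  have := h.area_ge i
  have := h.X_nonneg i
  have := h.X_le_Y i
  have := h.Y_le_X i
  linarith

variable {g : ℝ}

/-- An isolated index outside `J` forces all the estimates around it to be sharp. -/
structure Rigid (lam M g : ℝ) (X Y l k : ℕ → ℝ) (a : ℕ) : Prop where
  sum_ge : X a - 100 * M ≤ l a + k a
  k_le : k a ≤ lam * X a + 100 * M
  X_succ_le : X (a + 1) ≤ Y a + 100 * M
  X_succ_succ_le : X (a + 2) ≤ Y (a + 1) + 100 * M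
  X_le_Y : (1 - lam) * X a ≤ lam * Y a + 300 * M
  sum_ge' : X (a + 2) - 100 * M ≤ l (a + 2) + k (a + 2)
  growth : lam * g * X (a + 1) ≤ (1 - lam) * X (a + 2) + 100 * M

theorem rigid (h : LogChain lam M X Y l k J) (hlam : 849 / 2000 ≤ lam)
    (hlam' : lam ≤ 42451 / 100000) (hg : 1618 / 1000 ≤ g) (hg' : g ≤ 16181 / 10000)
    (hgg : g ^ 2 = g + 1) (hrel : lam ^ 2 - (2 * g + 1) * lam + g = 0) {a : ℕ}
    (h0 : ¬ J a) (h1 : J (a + 1)) : Rigid lam M g X Y l k a := by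
  have hM := h.one_le
  have v1 := h.vol_self h1
  have v0 := h.vol_pred h0 h1
  have f0 := h.sum_le a
  have f2 := h.sum_le (a + 2)
  have y0 := h.lam_Y a
  have y1 := h.lam_Y (a + 1)
  have y2 := h.lam_Y (a + 2)
  have x0 := h.lam_X a
  have x1 := h.lam_X (a + 1)
  have x2 := h.lam_X (a + 2)
  have o0 := h.Y_le_X a
  have o1 := h.Y_le_X (a + 1)
  have p0 := h.X_nonneg a
  have p2 := h.X_nonneg (a + 2)
  have q2 := h.Y_nonneg (a + 2)
  simp only [add_assoc, Nat.reduceAdd] at *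
  have w3 : 1 ≤ g - lam := by linarith
  have w3' : g - lam ≤ 2 := by linarith
  have w4 : 3 ≤ 2 * g + 1 - lam * g := by nlinarith
  have w4' : 2 * g + 1 - lam * g ≤ 4 := by nlinarith
  have t1 : 0 ≤ g * (M - (l a + k a - Y a + l (a + 2) + X (a + 2) - Y (a + 2))) :=
    mul_nonneg (by linarith) (by linarith)
  have t2 : 0 ≤ (g - lam - 1) * (X a + M - (l a + k a)) :=
    mul_nonneg (by linarith) (by linarith)
  have t3 : 0 ≤ (2 * g + 1 - lam * g - 1) * (X (a + 2) + M - (l (a + 2) + k (a + 2))) :=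
    mul_nonneg (by linarith) (by linarith)
  have t4 : 0 ≤ (1 + g + (2 * g + 1 - lam * g)) * (l (a + 2) + M - lam * Y (a + 2)) :=
    mul_nonneg (by linarith) (by linarith)
  have t5 : 0 ≤ (2 * g + 1 - lam * g) * (k (a + 2) + M - lam * X (a + 2)) :=
    mul_nonneg (by linarith) (by linarith)
  have t6 : 0 ≤ (g + (g - lam) - 1) * (l a + M - lam * Y a) :=
    mul_nonneg (by linarith) (by linarith)
  have t7 : 0 ≤ (g + (g - lam) - 1) * (k a + M - lam * X a) :=
    mul_nonneg (by linarith) (by linarith)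
  have t8 : 0 ≤ (lam - 2 / 5) * (X (a + 1) - Y a) := mul_nonneg (by linarith) (by linarith)
  have t9 : 0 ≤ (1 - lam - 2 / 5) * (X (a + 2) - Y (a + 1)) :=
    mul_nonneg (by linarith) (by linarith)
  have hw : (1 + g + (g - lam) + (2 * g + 1 - lam * g) + 2 + (1 + g + (2 * g + 1 - lam * g))
      + (2 * g + 1 - lam * g) + 2 * (g + (g - lam))) * M ≤ 30 * M :=
    mul_le_mul_of_nonneg_right (by linarith) (by linarith)
  have key : (M - (l (a + 1) + k (a + 1) - Y (a + 1) + l (a + 2) + X (a + 2) - Y (a + 2)))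
      + g * (M - (l a + k a - Y a + l (a + 2) + X (a + 2) - Y (a + 2)))
      + (g - lam) * (X a + M - (l a + k a))
      + (2 * g + 1 - lam * g) * (X (a + 2) + M - (l (a + 2) + k (a + 2)))
      + (l (a + 1) + M - lam * Y (a + 1)) + (k (a + 1) + M - lam * X (a + 1))
      + (1 + g + (2 * g + 1 - lam * g)) * (l (a + 2) + M - lam * Y (a + 2))
      + (2 * g + 1 - lam * g) * (k (a + 2) + M - lam * X (a + 2))
      + (g + (g - lam)) * (l a + M - lam * Y a) + (g + (g - lam)) * (k a + M - lam * X a)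
      + lam * (X (a + 1) - Y a) + (1 - lam) * (X (a + 2) - Y (a + 1))
      = (1 + g + (g - lam) + (2 * g + 1 - lam * g) + 2 + (1 + g + (2 * g + 1 - lam * g))
      + (2 * g + 1 - lam * g) + 2 * (g + (g - lam))) * M := by
    linear_combination (X a + Y a + g * X (a + 2) + g * Y (a + 2)) * hrel
      + (2 * lam - 1) * (X (a + 2) + Y (a + 2)) * hgg
  refine ⟨by linarith, by linarith, by linarith, by linarith, by linarith, by linarith, ?_⟩
  have s1 : lam * X (a + 1) ≤ (1 - lam) * Y (a + 2) - lam * X (a + 2) + 4 * M := by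
    linarith
  have s2 : g * lam * (lam * X (a + 1))
      ≤ g * lam * ((1 - lam) * Y (a + 2) - lam * X (a + 2) + 4 * M) :=
    mul_le_mul_of_nonneg_left s1 (mul_nonneg (by linarith) (by linarith))
  have s3 : g * (1 - lam) * (lam * Y (a + 2)) ≤ g * (1 - lam) * ((1 - lam) * X (a + 2) + 3 * M) :=
    mul_le_mul_of_nonneg_left (by linarith) (mul_nonneg (by linarith) (by linarith))
  have e1 : g * (1 - 2 * lam) * X (a + 2) = lam * (1 - lam) * X (a + 2) := by
    linear_combination X (a + 2) * hrel
  have e2 : g * lam * (4 * M) ≤ 2 * 1 * (4 * M) := by gcongr <;> linarith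
  have e3 : g * (1 - lam) * (3 * M) ≤ 2 * 1 * (3 * M) := by gcongr <;> linarith
  have e4 : 2 / 5 * (100 * M) ≤ lam * (100 * M) := by gcongr; linarith
  refine le_of_mul_le_mul_left (a := lam) ?_ (by linarith)
  linarith

variable {D : ℝ}

/-- An index of `J` bounds the growth two steps later. -/
theorem ratio (h : LogChain lam M X Y l k J) (hlam : 849 / 2000 ≤ lam) {t : ℕ} (h0 : J t) :
    X (t + 1) ≤ 7804 / 10000 * Y (t + 1) + 100 * M := by
  have := h.vol_self h0
  have := h.area_ge t
  have := h.area_le t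
  have := h.rat_Y hlam t
  have := h.rat_X hlam t
  have := h.rat_Y hlam (t + 1)
  have := h.rat_X hlam (t + 1)
  have := h.sum_le t
  have := h.Y_nonneg (t + 1)
  have := h.one_le
  linarith

/-- If `k` is sharp at `p + 1`, then `Y p` and `l p` are sharp. -/
theorem sharp_pred (h : LogChain lam M X Y l k J) (hlam : 849 / 2000 ≤ lam)
    (hlam' : lam ≤ 42451 / 100000) (hD : M ≤ D) {p : ℕ}
    (hk : k (p + 1) ≤ lam * X (p + 1) + D) :
    X (p + 1) ≤ Y p + 10 * D ∧ lam * X (p + 1) ≤ l p + 10 * D := by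
  have := h.area_le p
  have := h.lam_Y p
  have hM := h.one_le
  have h1 : X (p + 1) ≤ Y p + 6 * D := by
    refine le_of_mul_le_mul_left (a := 1 - lam) ?_ (by linarith)
    have : 1 / 2 * (6 * D) ≤ (1 - lam) * (6 * D) :=
      mul_le_mul_of_nonneg_right (by linarith) (by linarith)
    linarith
  have h2 : lam * X (p + 1) ≤ lam * (Y p + 6 * D) :=
    mul_le_mul_of_nonneg_left h1 (by linarith)
  have h3 : lam * (6 * D) ≤ 1 * (6 * D) := mul_le_mul_of_nonneg_right (by linarith) (by linarith)
  exact ⟨by linarith, by linarith⟩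

/-- Smallness estimates around a sharp index outside `J`. -/
theorem rigid_small (h : LogChain lam M X Y l k J) (hlam : 849 / 2000 ≤ lam)
    (hlam' : lam ≤ 42451 / 100000) (hg : 1618 / 1000 ≤ g) {j : ℕ}
    (hj : J j) (hr : Rigid lam M g X Y l k (j + 2)) :
    (Y (j + 2) - 3 * l (j + 2) + X (j + 1) - k (j + 2) ≤ 10000 * M - 1 / 1000 * X (j + 2)) ∧
    (Y (j + 1) - 2 * l (j + 1) + X (j + 2) - l (j + 3) - k (j + 3)
      ≤ 10000 * M - 1 / 1000 * X (j + 2)) ∧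
    (Y (j + 3) - 3 * l (j + 3) + X (j + 2) - k (j + 3) ≤ 10000 * M - 1 / 1000 * X (j + 2)) ∧
    (Y (j + 2) - 2 * l (j + 2) + X (j + 3) - l (j + 4) - k (j + 4)
      ≤ 10000 * M - 1 / 1000 * X (j + 2)) := by
  have hM := h.one_le
  have r1 := h.ratio hlam hj
  have r2 := hr.sum_ge
  have r3 := hr.X_succ_le
  have r4 := hr.X_succ_succ_le
  have r5 := hr.X_le_Y
  have r6 := hr.sum_ge'
  have r7 := hr.growth
  have o1 := h.Y_le_X (j + 1)
  have o2 := h.Y_le_X (j + 2)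
  have o3 := h.Y_le_X (j + 3)
  have x1 := h.rat_X hlam (j + 1)
  have x2 := h.rat_X hlam (j + 2)
  have x3 := h.rat_X hlam (j + 3)
  have y1 := h.rat_Y hlam (j + 1)
  have y2 := h.rat_Y hlam (j + 2)
  have y3 := h.rat_Y hlam (j + 3)
  have f2 := h.sum_le (j + 2)
  have n2 := h.X_nonneg (j + 2)
  have n3 := h.X_nonneg (j + 3)
  have n4 := h.X_nonneg (j + 4)
  have m2 := h.Y_nonneg (j + 2)
  simp only [add_assoc, Nat.reduceAdd] at *
  have a1 : (1 - 42451 / 100000) * X (j + 2) ≤ (1 - lam) * X (j + 2) :=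
    mul_le_mul_of_nonneg_right (by linarith) n2
  have a2 : lam * Y (j + 2) ≤ 42451 / 100000 * Y (j + 2) :=
    mul_le_mul_of_nonneg_right hlam' m2
  have a3 : 849 / 2000 * (1618 / 1000) * X (j + 3) ≤ lam * g * X (j + 3) := by gcongr
  have a4 : (1 - lam) * X (j + 4) ≤ (1 - 849 / 2000) * X (j + 4) := by gcongr
  refine ⟨by linarith, by linarith, by linarith, by linarith⟩

/-- The exponent of the last polynomial in the chain. -/
theorem rigid_gap (h : LogChain lam M X Y l k J) (hlam : 849 / 2000 ≤ lam)
    (hlam' : lam ≤ 42451 / 100000) (hg : 1618 / 1000 ≤ g) (hg' : g ≤ 16181 / 10000) {a : ℕ}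
    (hr : Rigid lam M g X Y l k a) :
    (lam * g - 1 + lam) * X a ≤ lam * (l (a + 2) + k (a + 2) - X (a + 1)) + 1000 * M := by
  have hM := h.one_le
  have o2 := h.Y_le_X a
  have r5 := hr.X_le_Y
  have r6 := hr.sum_ge'
  have r7 := hr.growth
  have hlg : 849 / 2000 * (1618 / 1000) ≤ lam * g := by gcongr
  have hlg' : lam * g ≤ 42451 / 100000 * (16181 / 10000) := by gcongr
  have e1 : (1 - lam) * X a ≤ lam * X (a + 1) + 300 * M := by
    have : lam * Y a ≤ lam * X (a + 1) := by gcongr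
    linarith
  have e2 : (lam * g - 1 + lam) * ((1 - lam) * X a)
      ≤ (lam * g - 1 + lam) * (lam * X (a + 1) + 300 * M) :=
    mul_le_mul_of_nonneg_left e1 (by linarith)
  have e3 : lam * (lam * g * X (a + 1)) ≤ lam * ((1 - lam) * X (a + 2) + 100 * M) :=
    mul_le_mul_of_nonneg_left r7 (by linarith)
  have e4 : lam * (1 - lam) * (X (a + 2) - 100 * M)
      ≤ lam * (1 - lam) * (l (a + 2) + k (a + 2)) :=
    mul_le_mul_of_nonneg_left r6 (mul_nonneg (by linarith) (by linarith))
  have c1 : (lam * g - 1 + lam) * (300 * M) ≤ 1 / 5 * (300 * M) := by gcongr; linarith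
  have c2 : lam * (100 * M) ≤ 1 * (100 * M) := by gcongr; linarith
  have c3 : lam * (1 - lam) * (100 * M) ≤ 1 * 1 * (100 * M) := by gcongr <;> linarith
  have c4 : 1 / 2 * (1000 * M) ≤ (1 - lam) * (1000 * M) := by gcongr; linarith
  refine le_of_mul_le_mul_left (a := 1 - lam) ?_ (by linarith)
  linarith

/-- Sharpness propagates to the index before. -/
theorem rigid_pred (h : LogChain lam M X Y l k J) (hlam : 849 / 2000 ≤ lam)
    (hlam' : lam ≤ 42451 / 100000) (hg : 1618 / 1000 ≤ g) (hg' : g ≤ 16181 / 10000)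
    (hgg : g ^ 2 = g + 1) (hrel : lam ^ 2 - (2 * g + 1) * lam + g = 0) {p : ℕ}
    (hr : Rigid lam M g X Y l k (p + 1)) (hD : M ≤ D)
    (hG : l p + k p ≤ X (p + 1) - (l (p + 3) + k (p + 3) - X (p + 2)) + D) :
    k p ≤ lam * X p + 100000 * D ∧ X p ≤ l p + k p + 100000 * D := by
  have hM := h.one_le
  have hD0 : 0 ≤ D := by linarith
  obtain ⟨s1, s2⟩ := h.sharp_pred (D := 100 * D) hlam hlam' (by linarith)
    (hr.k_le.trans (by linarith))
  have gap := h.rigid_gap hlam hlam' hg hg' hr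
  have f := h.sum_le p
  have x := h.lam_X p
  simp only [add_assoc, Nat.reduceAdd] at *
  have hlg : 849 / 2000 * (1618 / 1000) ≤ lam * g := by gcongr
  have hlg' : lam * g ≤ 42451 / 100000 * (16181 / 10000) := by gcongr
  have hll : 849 / 2000 * (849 / 2000) ≤ lam * lam := by gcongr
  have hll' : lam * lam ≤ 42451 / 100000 * (42451 / 100000) := by gcongr
  have hid : (1 - g * lam - lam ^ 2) * (1 - lam) = lam ^ 3 := by
    linear_combination (g - 1) * hrel + (2 * lam - 1) * hgg
  have c1 : lam * D ≤ 1 * D := by gcongr; linarith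
  have k1 : lam * k p ≤ (1 - g * lam - lam ^ 2) * X (p + 1) + 2001 * D := by
    have e1 : lam * (l p + k p)
        ≤ lam * (X (p + 1) - (l (p + 3) + k (p + 3) - X (p + 2)) + D) :=
      mul_le_mul_of_nonneg_left hG (by linarith)
    have e2 : lam * (lam * X (p + 1)) ≤ lam * (l p + 1000 * D) :=
      mul_le_mul_of_nonneg_left (by linarith) (by linarith)
    linarith
  have k2 : lam * X (p + 1) ≤ (1 - lam) * X p + 1003 * D := by linarith
  constructor
  · have e1 : (1 - g * lam - lam ^ 2) * (lam * X (p + 1))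
        ≤ (1 - g * lam - lam ^ 2) * ((1 - lam) * X p + 1003 * D) :=
      mul_le_mul_of_nonneg_left k2 (by linarith)
    have e2 : lam * (lam * k p) ≤ lam * ((1 - g * lam - lam ^ 2) * X (p + 1) + 2001 * D) :=
      mul_le_mul_of_nonneg_left k1 (by linarith)
    have e3 : (1 - g * lam - lam ^ 2) * (1 - lam) * X p = lam ^ 3 * X p := by rw [hid]
    have c2 : (1 - g * lam - lam ^ 2) * (1003 * D) ≤ 1 * (1003 * D) := by
      gcongr; linarith
    have c3 : 849 / 2000 * (849 / 2000) * (100000 * D) ≤ lam * lam * (100000 * D) := by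
      gcongr
    refine le_of_mul_le_mul_left (a := lam * lam) ?_ (by linarith)
    linarith
  · have e1 : lam * lam * X p ≤ (1 - g * lam - lam ^ 2) * X (p + 1) + 2002 * D := by
      have : lam * (lam * X p) ≤ lam * (k p + M) := mul_le_mul_of_nonneg_left x (by linarith)
      have : lam * M ≤ 1 * D := by gcongr; linarith
      linarith
    have e2 : (1 - lam) * (lam * lam * X p)
        ≤ (1 - lam) * ((1 - g * lam - lam ^ 2) * X (p + 1) + 2002 * D) :=
      mul_le_mul_of_nonneg_left e1 (by linarith)
    have e3 : (1 - g * lam - lam ^ 2) * (1 - lam) * X (p + 1) = lam ^ 3 * X (p + 1) := by rw [hid]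
    have e4 : lam * lam * (lam * X (p + 1)) ≤ lam * lam * (l p + 1000 * D) :=
      mul_le_mul_of_nonneg_left (by linarith) (by linarith)
    have e5 : lam * lam * (lam * X p) ≤ lam * lam * (k p + D) :=
      mul_le_mul_of_nonneg_left (by linarith) (by linarith)
    have c2 : (1 - lam) * (2002 * D) ≤ 1 * (2002 * D) := by gcongr; linarith
    have c3 : 849 / 2000 * (849 / 2000) * (90000 * D) ≤ lam * lam * (90000 * D) := by
      gcongr
    have c4 : lam * lam * (D + 1000 * D) ≤ 1 * 1 * (D + 1000 * D) := by gcongr <;> linarith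
    refine le_of_mul_le_mul_left (a := lam * lam) ?_ (by linarith)
    linarith

/-- If the value `k` at `p + 1` and the sum `l + k` at `p` are sharp, then `X (p + 1)` is large
compared with `X p`. -/
theorem growth_of_sharp (h : LogChain lam M X Y l k J) (hlam' : lam ≤ 42451 / 100000)
    (hD : M ≤ D) {p : ℕ} (hk : k p ≤ lam * X p + D) (hs : X p ≤ l p + k p + D)
    (hk' : k (p + 1) ≤ lam * X (p + 1) + D) :
    57549 / 100000 * X p ≤ 42451 / 100000 * X (p + 1) + 4 * D := by
  have := h.area_le p
  have := h.Y_le_X p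
  have a1 : lam * X p ≤ 42451 / 100000 * X p :=
    mul_le_mul_of_nonneg_right hlam' (h.X_nonneg _)
  have a2 : lam * X (p + 1) ≤ 42451 / 100000 * X (p + 1) :=
    mul_le_mul_of_nonneg_right hlam' (h.X_nonneg _)
  linarith

/-- The smallness estimates one step before a sharp index outside `J`. -/
theorem pred_small (h : LogChain lam M X Y l k J) (hlam : 849 / 2000 ≤ lam)
    (hlam' : lam ≤ 42451 / 100000) {i : ℕ} (hi : J i) (hD : M ≤ D)
    (hk : k (i + 2) ≤ lam * X (i + 2) + D) (hs : X (i + 2) ≤ l (i + 2) + k (i + 2) + D)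
    (hk' : k (i + 3) ≤ lam * X (i + 3) + D) (hr : X (i + 3) ≤ l (i + 3) + k (i + 3) + D) :
    (Y (i + 2) - 3 * l (i + 2) + X (i + 1) - k (i + 2) ≤ 10000 * D - 1 / 1000 * X (i + 2)) ∧
    (Y (i + 1) - 2 * l (i + 1) + X (i + 2) - l (i + 3) - k (i + 3)
      ≤ 10000 * D - 1 / 1000 * X (i + 2)) := by
  have hM := h.one_le
  have r1 := h.ratio hlam hi
  have s1 := (h.sharp_pred (p := i + 1) hlam hlam' hD hk).1
  have gr := h.growth_of_sharp hlam' hD hk hs hk'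
  have n2 := h.X_nonneg (i + 2)
  have o1 := h.Y_le_X (i + 1)
  have x2 := h.rat_X hlam (i + 2)
  have y2 := h.rat_Y hlam (i + 2)
  have y1 := h.rat_Y hlam (i + 1)
  have f2 := h.sum_le (i + 2)
  simp only [add_assoc, Nat.reduceAdd] at *
  have a1 : lam * X (i + 2) ≤ 42451 / 100000 * X (i + 2) := by gcongr
  refine ⟨by linarith, by linarith⟩

/-- The concluding bound on the chain. -/
theorem pred_bound (h : LogChain lam M X Y l k J) (hlam : 849 / 2000 ≤ lam)
    (hlam' : lam ≤ 42451 / 100000) (hg : 1618 / 1000 ≤ g) (hg' : g ≤ 16181 / 10000) {j : ℕ}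
    (hD : M ≤ D)
    (hk : k (j + 1) ≤ lam * X (j + 1) + D) (hs : X (j + 1) ≤ l (j + 1) + k (j + 1) + D)
    (hk' : k (j + 2) ≤ lam * X (j + 2) + D)
    (hr : Rigid lam M g X Y l k (j + 2))
    (hG : l j + k j ≤ X (j + 1) - (l (j + 4) + k (j + 4) - X (j + 3)) + D) :
    X (j + 1) ≤ 1000000 * D := by
  have hM := h.one_le
  have s1 := (h.sharp_pred (p := j) hlam hlam' hD hk).1
  have gr := h.growth_of_sharp hlam' hD hk hs hk'
  have gap := h.rigid_gap hlam hlam' hg hg' hr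
  have n1 := h.X_nonneg (j + 1)
  have n2 := h.X_nonneg (j + 2)
  have x0 := h.rat_X hlam j
  have y0 := h.rat_Y hlam j
  have f0 := h.sum_le j
  simp only [add_assoc, Nat.reduceAdd] at *
  have hlg : 849 / 2000 * (1618 / 1000) ≤ lam * g := by gcongr
  have z1 : 11 / 100 * X (j + 2) ≤ (lam * g + (lam - 1)) * X (j + 2) := by gcongr; linarith
  have z2 : lam * (1 / 4 * X (j + 2)) ≤ 42451 / 100000 * (1 / 4 * X (j + 2)) := by gcongr
  have z3 : 1 / 3 * (3000 * M) ≤ lam * (3000 * M) := by gcongr; linarith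
  have z : 1 / 4 * X (j + 2) ≤ l (j + 4) + k (j + 4) - X (j + 3) + 3000 * M := by
    refine le_of_mul_le_mul_left (a := lam) ?_ (by linarith)
    linarith
  linarith

end LogChain

/-- The chain together with the linear forms `A + B T` and `P + Q T` attached to it. -/
structure PolyChain (ξ lam M : ℝ) (X Y l k : ℕ → ℝ) (J : ℕ → Prop) (A B P Q : ℕ → ℤ) : Prop
    extends LogChain lam M X Y l k J where
  AB_ne : ∀ n, A (n + 1) ≠ 0 ∨ B (n + 1) ≠ 0
  PQ_ne : ∀ n, P n ≠ 0 ∨ Q n ≠ 0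
  A_le : ∀ n, |(A (n + 1) : ℝ)| ≤ Real.exp (M + Y n - 2 * l n)
  AB_eval : ∀ n, |(B (n + 1) : ℝ) - A (n + 1) * ξ| ≤ Real.exp (M + X n - l (n + 1) - k (n + 1))
  P_le : ∀ n, |(P n : ℝ)| ≤ Real.exp (M + X n - l n - k n)
  Q_le : ∀ n, |(Q n : ℝ)| ≤ Real.exp (M + X n - l n - k n)
  PQ_eval : ∀ n, |(Q (n + 1) : ℝ) - P (n + 1) * ξ| * Real.exp (X n) ≤
    Real.exp M * (|(B (n + 1) : ℝ) - A (n + 1) * ξ| * Real.exp (X (n + 1)) +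
      Real.exp (X (n + 1) - l (n + 1) - k (n + 1) - l n))
  dvd : ∀ n (d : ℤ), d ∣ A (n + 1) → d ∣ B (n + 1) →
    d ∣ P (n + 1) * P n ∧ d ∣ P (n + 1) * Q n ∧ d ∣ Q (n + 1) * P n ∧ d ∣ Q (n + 1) * Q n

/-- Two proportional nonzero integer points of the plane, compared through a linear form. -/
theorem exists_dvd_of_det_eq_zero {a b p q : ℤ} (hpq : p ≠ 0 ∨ q ≠ 0) (hdet : a * q = b * p)
    (ξ : ℝ) : ∃ d : ℤ, d ∣ a ∧ d ∣ b ∧ |(b : ℝ) - a * ξ| ≤ |(d : ℝ)| * |(q : ℝ) - p * ξ| := by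
  have hg₀ : Int.gcd p q ≠ 0 := by
    rw [Ne, Int.gcd_eq_zero_iff]
    tauto
  have hg : (Int.gcd p q : ℤ) ≠ 0 := by exact_mod_cast hg₀
  obtain ⟨p', hp⟩ := Int.gcd_dvd_left p q
  obtain ⟨q', hq⟩ := Int.gcd_dvd_right p q
  set g : ℤ := (Int.gcd p q : ℤ) with hgdef
  have hcop : IsCoprime p' q' := by
    rw [Int.isCoprime_iff_gcd_eq_one]
    have h1 : Int.gcd p q = Int.gcd (g * p') (g * q') := by rw [← hp, ← hq]
    rw [Int.gcd_mul_left] at h1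
    have h2 : g.natAbs = Int.gcd p q := by simp [hgdef]
    rw [h2] at h1
    exact Nat.eq_of_mul_eq_mul_left (Nat.pos_of_ne_zero hg₀) (by omega)
  have hdet' : a * q' = b * p' := by
    apply mul_left_cancel₀ hg
    linear_combination hdet - a * hq + b * hp
  obtain ⟨u, v, huv⟩ := hcop
  have ha : a = (u * a + v * b) * p' := by linear_combination (-a) * huv + v * hdet'
  have hb : b = (u * a + v * b) * q' := by linear_combination (-b) * huv - u * hdet'
  refine ⟨u * a + v * b, ⟨p', ha⟩, ⟨q', hb⟩, ?_⟩
  have h1 : (b : ℝ) - a * ξ = ((u * a + v * b : ℤ) : ℝ) * ((q' : ℝ) - p' * ξ) := by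
    have ha' : (a : ℝ) = ((u * a + v * b : ℤ) : ℝ) * p' := by exact_mod_cast ha
    have hb' : (b : ℝ) = ((u * a + v * b : ℤ) : ℝ) * q' := by exact_mod_cast hb
    linear_combination hb' - ξ * ha'
  have h2 : (q : ℝ) - p * ξ = (g : ℝ) * ((q' : ℝ) - p' * ξ) := by
    have hp' : (p : ℝ) = (g : ℝ) * p' := by exact_mod_cast hp
    have hq' : (q : ℝ) = (g : ℝ) * q' := by exact_mod_cast hq
    linear_combination hq' - ξ * hp'
  rw [h1, h2, abs_mul, abs_mul]
  have h3 : (1 : ℝ) ≤ |(g : ℝ)| := by exact_mod_cast Int.one_le_abs hg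
  gcongr
  exact le_mul_of_one_le_left (abs_nonneg _) h3

theorem det_eq_zero_trans {a b p q r s : ℤ} (hpq : p ≠ 0 ∨ q ≠ 0) (h1 : a * q = b * p)
    (h2 : p * s = q * r) : a * s = b * r := by
  rcases hpq with h | h <;> apply mul_left_cancel₀ h
  · linear_combination a * h2 + r * h1
  · linear_combination s * h1 + b * h2

theorem det_eq_zero_of_small {a b p q : ℤ} {ξ u v u' v' : ℝ} (ha : |(a : ℝ)| ≤ Real.exp u)
    (hpq : |(q : ℝ) - p * ξ| ≤ Real.exp v) (hp : |(p : ℝ)| ≤ Real.exp u')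
    (hab : |(b : ℝ) - a * ξ| ≤ Real.exp v') (h1 : u + v ≤ -1) (h2 : u' + v' ≤ -1) :
    a * q = b * p := by
  have e : Real.exp (-1) < 1 / 2 := by
    have := Real.exp_one_gt_d9
    rw [Real.exp_neg, inv_lt_comm₀ (Real.exp_pos _) (by norm_num)]
    norm_num
    linarith
  have k1 : |(a : ℝ)| * |(q : ℝ) - p * ξ| < 1 / 2 := by
    calc _ ≤ Real.exp u * Real.exp v := by gcongr
      _ = Real.exp (u + v) := (Real.exp_add _ _).symm
      _ ≤ Real.exp (-1) := Real.exp_le_exp.2 h1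
      _ < _ := e
  have k2 : |(p : ℝ)| * |(b : ℝ) - a * ξ| < 1 / 2 := by
    calc _ ≤ Real.exp u' * Real.exp v' := by gcongr
      _ = Real.exp (u' + v') := (Real.exp_add _ _).symm
      _ ≤ Real.exp (-1) := Real.exp_le_exp.2 h2
      _ < _ := e
  have : |((a * q - b * p : ℤ) : ℝ)| < 1 := by
    have : ((a * q - b * p : ℤ) : ℝ) = a * ((q : ℝ) - p * ξ) - p * ((b : ℝ) - a * ξ) := by
      push_cast
      ring
    rw [this]
    calc _ ≤ |(a : ℝ) * ((q : ℝ) - p * ξ)| + |(p : ℝ) * ((b : ℝ) - a * ξ)| := abs_sub _ _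
      _ < 1 := by rw [abs_mul, abs_mul]; linarith
  have : |a * q - b * p| < 1 := by exact_mod_cast this
  rw [Int.abs_lt_one_iff] at this
  linarith

/-- Bounded nonzero integer linear forms are bounded away from zero at an irrational number. -/
theorem exists_lower_bound_linear_form {ξ : ℝ} (hξ : Irrational ξ) (R : ℝ) :
    ∃ ε > 0, ∀ p q : ℤ, (p ≠ 0 ∨ q ≠ 0) → |(p : ℝ)| ≤ R → |(q : ℝ)| ≤ R →
      ε ≤ |(q : ℝ) - p * ξ| := by
  have hpos : ∀ p q : ℤ, (p ≠ 0 ∨ q ≠ 0) → 0 < |(q : ℝ) - p * ξ| := by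
    intro p q h
    rw [abs_pos]
    intro h0
    rcases eq_or_ne p 0 with rfl | hp
    · simp at h0
      tauto
    · exact (hξ.intCast_mul hp).ne_int q (by linarith)
  classical
  set S : Finset (ℤ × ℤ) :=
    insert (1, 0) (((Finset.Icc (-⌈R⌉) ⌈R⌉) ×ˢ (Finset.Icc (-⌈R⌉) ⌈R⌉)).filter
      fun v => v.1 ≠ 0 ∨ v.2 ≠ 0) with hS
  obtain ⟨w, hw, hmin⟩ := S.exists_min_image (fun v => |(v.2 : ℝ) - v.1 * ξ|)
    ⟨(1, 0), Finset.mem_insert_self _ _⟩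
  refine ⟨_, hpos w.1 w.2 ?_, fun p q h hp hq => hmin (p, q) ?_⟩
  · rcases Finset.mem_insert.1 hw with rfl | h
    · simp
    · exact (Finset.mem_filter.1 h).2
  · have aux : ∀ t : ℤ, |(t : ℝ)| ≤ R → t ∈ Finset.Icc (-⌈R⌉) ⌈R⌉ := by
      intro t ht
      have : ((|t| : ℤ) : ℝ) ≤ ⌈R⌉ := by push_cast; exact ht.trans (Int.le_ceil R)
      rw [Finset.mem_Icc]
      exact abs_le.1 (by exact_mod_cast this)
    exact Finset.mem_insert_of_mem (Finset.mem_filter.2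
      ⟨Finset.mem_product.2 ⟨aux p hp, aux q hq⟩, h⟩)

namespace PolyChain
variable {ξ lam M D g : ℝ} {X Y l k : ℕ → ℝ} {J : ℕ → Prop} {A B P Q : ℕ → ℤ}

theorem det_eq_zero (h : PolyChain ξ lam M X Y l k J A B P Q) {n : ℕ}
    (h1 : Y (n + 1) - 3 * l (n + 1) + X n - k (n + 1) ≤ -(2 * M) - 1)
    (h2 : Y n - 2 * l n + X (n + 1) - l (n + 2) - k (n + 2) ≤ -(2 * M) - 1) :
    A (n + 1) * B (n + 2) = B (n + 1) * A (n + 2) :=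
  det_eq_zero_of_small (h.A_le n) (h.AB_eval (n + 1)) (h.A_le (n + 1)) (h.AB_eval n)
    (by simp only [add_assoc, Nat.reduceAdd] at *; linarith) (by linarith)

theorem eval_le_of_det_eq_zero (h : PolyChain ξ lam M X Y l k J A B P Q) {n m : ℕ}
    (hdet : A (n + 1) * B (m + 1) = B (n + 1) * A (m + 1)) :
    |(B (n + 1) : ℝ) - A (n + 1) * ξ| ≤
      Real.exp (3 * M + (X (n + 1) - l (n + 1) - k (n + 1)) + (X n - l n - k n)
        + (X m - l (m + 1) - k (m + 1))) := by
  obtain ⟨d, hdA, hdB, hd⟩ := exists_dvd_of_det_eq_zero (h.AB_ne m) hdet ξ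
  have key : |(d : ℝ)| ≤ Real.exp (M + X (n + 1) - l (n + 1) - k (n + 1)) *
      Real.exp (M + X n - l n - k n) := by
    have aux : ∀ s t : ℤ, s ≠ 0 → t ≠ 0 → d ∣ s * t →
        |(s : ℝ)| ≤ Real.exp (M + X (n + 1) - l (n + 1) - k (n + 1)) →
        |(t : ℝ)| ≤ Real.exp (M + X n - l n - k n) →
        |(d : ℝ)| ≤ Real.exp (M + X (n + 1) - l (n + 1) - k (n + 1)) *
          Real.exp (M + X n - l n - k n) := by
      intro s t hs ht hst h1 h2
      have : |d| ≤ |s * t| :=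
        Int.le_of_dvd (abs_pos.2 (mul_ne_zero hs ht)) ((abs_dvd_abs d (s * t)).2 hst)
      calc |(d : ℝ)| ≤ |((s * t : ℤ) : ℝ)| := by exact_mod_cast this
        _ = |(s : ℝ)| * |(t : ℝ)| := by push_cast; exact abs_mul _ _
        _ ≤ _ := by gcongr
    obtain ⟨d1, d2, d3, d4⟩ := h.dvd n d hdA hdB
    rcases h.PQ_ne (n + 1) with hs | hs <;> rcases h.PQ_ne n with ht | ht
    · exact aux _ _ hs ht d1 (h.P_le _) (h.P_le _)
    · exact aux _ _ hs ht d2 (h.P_le _) (h.Q_le _)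
    · exact aux _ _ hs ht d3 (h.Q_le _) (h.P_le _)
    · exact aux _ _ hs ht d4 (h.Q_le _) (h.Q_le _)
  calc _ ≤ _ := hd
    _ ≤ (Real.exp (M + X (n + 1) - l (n + 1) - k (n + 1)) *
      Real.exp (M + X n - l n - k n)) * Real.exp (M + X m - l (m + 1) - k (m + 1)) := by
        gcongr
        exact h.AB_eval m
    _ = _ := by
        rw [← Real.exp_add, ← Real.exp_add]
        congr 1
        ring

theorem exists_le_eval (h : PolyChain ξ lam M X Y l k J A B P Q) (hlam : 849 / 2000 ≤ lam)
    (hξ : Irrational ξ) (D : ℝ) :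
    ∃ D', ∀ n, D' ≤ X n → X (n + 1) ≤ l (n + 1) + k (n + 1) + D →
      Real.exp (X n - X (n + 1) - D') ≤ |(B (n + 1) : ℝ) - A (n + 1) * ξ| := by
  obtain ⟨ε, hε, hmin⟩ := exists_lower_bound_linear_form hξ (Real.exp (M + D))
  set D1 := Real.log (2 * Real.exp (3 * M + D) / ε) with hD1
  set D2 := Real.log (2 * Real.exp M / ε) with hD2
  have e1 : Real.exp D1 = 2 * Real.exp (3 * M + D) / ε := Real.exp_log (by positivity)
  have e2 : Real.exp D2 = 2 * Real.exp M / ε := Real.exp_log (by positivity)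
  refine ⟨max D1 D2, fun n hn hs => ?_⟩
  have hb : ε ≤ |(Q (n + 1) : ℝ) - P (n + 1) * ξ| := by
    refine hmin _ _ (h.PQ_ne _) ((h.P_le _).trans ?_) ((h.Q_le _).trans ?_) <;>
    · rw [Real.exp_le_exp]
      linarith
  have hl : -M ≤ l n := by
    have := h.rat_Y hlam n
    have := h.Y_nonneg n
    linarith
  have herr : Real.exp M * Real.exp (X (n + 1) - l (n + 1) - k (n + 1) - l n)
      ≤ ε / 2 * Real.exp (X n) := by
    calc _ ≤ Real.exp M * Real.exp (2 * M + D) := by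
          gcongr
          linarith [h.one_le]
      _ = Real.exp (3 * M + D) := by rw [← Real.exp_add]; congr 1; ring
      _ = ε / 2 * Real.exp D1 := by rw [e1]; field_simp
      _ ≤ _ := by
          gcongr
          exact (le_max_left _ _).trans hn
  have hmain := h.PQ_eval n
  have h3 : ε * Real.exp (X n) ≤ |(Q (n + 1) : ℝ) - P (n + 1) * ξ| * Real.exp (X n) := by
    gcongr
  have h4 : ε / 2 * Real.exp (X n) ≤
      Real.exp M * (|(B (n + 1) : ℝ) - A (n + 1) * ξ| * Real.exp (X (n + 1))) := by
    linarith
  have h5 : Real.exp (X n - X (n + 1) - max D1 D2) * Real.exp D2 * Real.exp (X (n + 1))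
      ≤ Real.exp (X n) := by
    rw [← Real.exp_add, ← Real.exp_add, Real.exp_le_exp]
    linarith [le_max_right D1 D2]
  have h6 : ε / 2 * (Real.exp (X n - X (n + 1) - max D1 D2) * Real.exp D2 * Real.exp (X (n + 1)))
      = Real.exp M * (Real.exp (X n - X (n + 1) - max D1 D2) * Real.exp (X (n + 1))) := by
    rw [e2]
    field_simp
  have h7 : Real.exp M * (Real.exp (X n - X (n + 1) - max D1 D2) * Real.exp (X (n + 1)))
      ≤ Real.exp M * (|(B (n + 1) : ℝ) - A (n + 1) * ξ| * Real.exp (X (n + 1))) := by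
    rw [← h6]
    exact (mul_le_mul_of_nonneg_left h5 (by positivity)).trans h4
  exact le_of_mul_le_mul_right (le_of_mul_le_mul_left h7 (Real.exp_pos _)) (Real.exp_pos _)

/-- If an index is sharp and the attached linear form is proportional to a later one, then the
index before satisfies a strong inequality. -/
theorem exists_sum_le (h : PolyChain ξ lam M X Y l k J A B P Q) (hlam : 849 / 2000 ≤ lam)
    (hξ : Irrational ξ) (D : ℝ) :
    ∃ D', ∀ n m, D' ≤ X n → X (n + 1) ≤ l (n + 1) + k (n + 1) + D →
      A (n + 1) * B (m + 1) = B (n + 1) * A (m + 1) →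
      l n + k n ≤ X (n + 1) - (l (m + 1) + k (m + 1) - X m) + D' := by
  obtain ⟨D', hD'⟩ := h.exists_le_eval hlam hξ D
  refine ⟨max D' (D' + 3 * M + D), fun n m hn hs hdet => ?_⟩
  have h1 := (hD' n ((le_max_left _ _).trans hn) hs).trans (h.eval_le_of_det_eq_zero hdet)
  rw [Real.exp_le_exp] at h1
  have := le_max_right D' (D' + 3 * M + D)
  linarith

/-- The set `J` does not contain all large indices. -/
theorem not_eventually_mem (h : PolyChain ξ lam M X Y l k J A B P Q) (hlam : 849 / 2000 ≤ lam)
    (hξ : Irrational ξ) (hX : Filter.Tendsto X Filter.atTop Filter.atTop) (N : ℕ) :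
    ∃ n ≥ N, ¬ J n := by
  by_contra! hJ
  obtain ⟨N₁, hN₁⟩ := Filter.eventually_atTop.1 (hX.eventually_ge_atTop (1000000 * M))
  have hM := h.one_le
  set N₂ := max N N₁ with hN₂
  have hadj : ∀ i ≥ N₂, A (i + 2) * B (i + 3) = B (i + 2) * A (i + 3) := by
    intro i hi
    have hiN : N ≤ i := (le_max_left _ _).trans hi
    have hlarge := hN₁ (i + 2) (by have := le_max_right N N₁; omega)
    have t1 := h.allJ_first hlam (hJ i hiN) (hJ (i + 1) (by omega))
    have t2 := h.allJ_second hlam (hJ (i + 1) (by omega)) (hJ (i + 2) (by omega))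
    exact h.det_eq_zero (n := i + 1)
      (by simp only [add_assoc, Nat.reduceAdd] at *; linarith)
      (by simp only [add_assoc, Nat.reduceAdd] at *; linarith)
  have hall : ∀ i ≥ N₂, A (N₂ + 2) * B (i + 2) = B (N₂ + 2) * A (i + 2) := by
    intro i hi
    induction i, hi using Nat.le_induction with
    | base => ring
    | succ i hi ih =>
      exact det_eq_zero_trans (h.AB_ne (i + 1)) ih (hadj i hi)
  obtain ⟨ε, hε, hmin⟩ := exists_lower_bound_linear_form hξ
    (max |(A (N₂ + 2) : ℝ)| |(B (N₂ + 2) : ℝ)|)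
  have h0 := hmin _ _ (h.AB_ne (N₂ + 1)) (le_max_left _ _) (le_max_right _ _)
  set R := max |(A (N₂ + 2) : ℝ)| |(B (N₂ + 2) : ℝ)| with hR
  have hlow : ∀ i ≥ N₂, ε ≤ R * |(B (i + 2) : ℝ) - A (i + 2) * ξ| := by
    intro i hi
    obtain ⟨d, hdA, hdB, hd⟩ := exists_dvd_of_det_eq_zero (h.AB_ne (i + 1)) (hall i hi) ξ
    have hdR : |(d : ℝ)| ≤ R := by
      rcases h.AB_ne (N₂ + 1) with hne | hne
      · have : |d| ≤ |A (N₂ + 2)| :=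
          Int.le_of_dvd (abs_pos.2 hne) ((abs_dvd_abs _ _).2 hdA)
        exact le_max_of_le_left (by exact_mod_cast this)
      · have : |d| ≤ |B (N₂ + 2)| :=
          Int.le_of_dvd (abs_pos.2 hne) ((abs_dvd_abs _ _).2 hdB)
        exact le_max_of_le_right (by exact_mod_cast this)
    exact h0.trans (hd.trans (by gcongr))
  have hRpos : 0 < R := by
    by_contra! hneg
    have := hlow N₂ le_rfl
    have : R * |(B (N₂ + 2) : ℝ) - A (N₂ + 2) * ξ| ≤ 0 :=
      mul_nonpos_of_nonpos_of_nonneg hneg (abs_nonneg _)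
    linarith
  obtain ⟨N₃, hN₃⟩ := Filter.eventually_atTop.1
    (hX.eventually_ge_atTop (1000 * (101 * M + 1 - Real.log (ε / R))))
  set i := max N₂ N₃ with hi
  have hi2 : N₂ ≤ i := le_max_left _ _
  have hlarge := hN₃ (i + 2) (by have := le_max_right N₂ N₃; omega)
  have hn0 := h.X_nonneg (i + 2)
  have hs := h.eval_small hlam (hJ (i + 1) (by have := le_max_left N N₁; omega))
  have h1 := hlow i hi2
  have h2 : ε / R ≤ Real.exp (M + X (i + 1) - l (i + 2) - k (i + 2)) := by
    rw [div_le_iff₀' hRpos]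
    exact h1.trans (mul_le_mul_of_nonneg_left (h.AB_eval (i + 1)) hRpos.le)
  have h3 := Real.log_le_log (by positivity) h2
  rw [Real.log_exp] at h3
  simp only [add_assoc, Nat.reduceAdd] at *
  linarith

/-- Three consecutive indices in `J` occur only finitely often. -/
theorem not_frequently_three (h : PolyChain ξ lam M X Y l k J A B P Q)
    (hlam : 849 / 2000 ≤ lam) (hlam' : lam ≤ 42451 / 100000) (hg : 1618 / 1000 ≤ g)
    (hg' : g ≤ 16181 / 10000) (hgg : g ^ 2 = g + 1)
    (hrel : lam ^ 2 - (2 * g + 1) * lam + g = 0)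
    (hξ : Irrational ξ) (hX : Filter.Tendsto X Filter.atTop Filter.atTop)
    (hinf : ∀ N, ∃ n ≥ N, J n ∧ J (n + 1) ∧ J (n + 2)) : False := by
  have hM := h.one_le
  obtain ⟨D1, hD1⟩ := h.exists_sum_le hlam hξ (100 * M)
  set E1 := max (100 * M) D1 with hE1
  obtain ⟨D2, hD2⟩ := h.exists_sum_le hlam hξ (100000 * E1)
  set E2 := max (100000 * E1) D2 with hE2
  have hME1 : 100 * M ≤ E1 := le_max_left _ _
  have hE12 : 100000 * E1 ≤ E2 := le_max_left _ _
  obtain ⟨N₁, hN₁⟩ := Filter.eventually_atTop.1 (hX.eventually_ge_atTop (100000000000 * E2))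
  obtain ⟨i₀, hi₀, j0, j1, j2⟩ := hinf N₁
  obtain ⟨t, ht, hJt, htmin⟩ : ∃ t, i₀ ≤ t ∧ ¬ J t ∧ ∀ s, i₀ ≤ s → s < t → J s := by
    classical
    have hex := h.not_eventually_mem hlam hξ hX i₀
    refine ⟨Nat.find hex, (Nat.find_spec hex).1, (Nat.find_spec hex).2, fun s hs hst => ?_⟩
    by_contra hns
    exact Nat.find_min hex hst ⟨hs, hns⟩
  obtain ⟨i, rfl⟩ : ∃ i, t = i + 3 := by
    have : t ≠ i₀ := fun e => hJt (e ▸ j0)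
    have : t ≠ i₀ + 1 := fun e => hJt (e ▸ j1)
    have : t ≠ i₀ + 2 := fun e => hJt (e ▸ j2)
    exact ⟨t - 3, by omega⟩
  have hii : i₀ ≤ i := by
    by_contra hlt
    have : i + 3 = i₀ ∨ i + 3 = i₀ + 1 ∨ i + 3 = i₀ + 2 := by omega
    rcases this with e | e | e <;> rw [e] at hJt <;> contradiction
  have hJi := htmin i hii (by omega)
  have hJj := htmin (i + 1) (by omega) (by omega)
  have hJm : J (i + 4) := by
    by_contra hm
    classical
    have hex : ∃ s, i + 3 < s ∧ J s := by
      obtain ⟨s, hs, hsJ, -⟩ := hinf (i + 4)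
      exact ⟨s, by omega, hsJ⟩
    obtain ⟨s, hs1, hs2, hmin⟩ : ∃ s, i + 3 < s ∧ J s ∧ ∀ t, i + 3 < t → t < s → ¬ J t :=
      ⟨Nat.find hex, (Nat.find_spec hex).1, (Nat.find_spec hex).2,
        fun t ht hts hJ => Nat.find_min hex hts ⟨ht, hJ⟩⟩
    have hs4 : s ≠ i + 4 := by
      rintro rfl
      exact hm hs2
    obtain ⟨u, rfl⟩ : ∃ u, s = u + 2 := ⟨s - 2, by omega⟩
    have hu : ¬ J u := by
      rcases Nat.lt_or_ge (i + 3) u with hlt | hge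
      · exact hmin u hlt (by omega)
      · have : u = i + 3 := by omega
        rwa [this]
    have hb := h.bound_of_not_not_mem hlam hu
      (hmin (u + 1) (by omega) (by omega)) hs2
    have := hN₁ u (by omega)
    linarith
  have hr := h.rigid hlam hlam' hg hg' hgg hrel hJt hJm
  have hlarge : ∀ n, 100000000000 * E2 ≤ X (i + n) := fun n => hN₁ _ (by omega)
  have x1 := hlarge 1
  have x2 := hlarge 2
  have x3 := hlarge 3
  have hDE1 : D1 ≤ E1 := le_max_right _ _
  have hDE2 : D2 ≤ E2 := le_max_right _ _
  obtain ⟨a1, a2, a3, a4⟩ := h.rigid_small (j := i + 1) hlam hlam' hg hJj hr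
  have d34 : A (i + 3) * B (i + 4) = B (i + 3) * A (i + 4) :=
    h.det_eq_zero (n := i + 2) (by simp only [add_assoc, Nat.reduceAdd] at *; linarith)
      (by simp only [add_assoc, Nat.reduceAdd] at *; linarith)
  have d45 : A (i + 4) * B (i + 5) = B (i + 4) * A (i + 5) :=
    h.det_eq_zero (n := i + 3) (by simp only [add_assoc, Nat.reduceAdd] at *; linarith)
      (by simp only [add_assoc, Nat.reduceAdd] at *; linarith)
  have d35 := det_eq_zero_trans (h.AB_ne (i + 3)) d34 d45
  have g1 := hD1 (i + 2) (i + 4) (by linarith) (by have := hr.sum_ge; linarith) d35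
  obtain ⟨b1, b2⟩ := h.rigid_pred (p := i + 2) (D := E1) hlam hlam' hg hg' hgg hrel hr
    (by linarith) (by simp only [add_assoc, Nat.reduceAdd] at *; linarith)
  obtain ⟨c1, c2⟩ := h.pred_small (D := 100000 * E1) hlam hlam' hJi (by linarith) b1 b2
    (hr.k_le.trans (by linarith)) (by have := hr.sum_ge; linarith)
  have d23 : A (i + 2) * B (i + 3) = B (i + 2) * A (i + 3) :=
    h.det_eq_zero (n := i + 1) (by simp only [add_assoc, Nat.reduceAdd] at *; linarith)
      (by simp only [add_assoc, Nat.reduceAdd] at *; linarith)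
  have d25 := det_eq_zero_trans (h.AB_ne (i + 2)) d23 d35
  have g2 := hD2 (i + 1) (i + 4) (by linarith) b2 d25
  have hfin := h.pred_bound (j := i + 1) (D := E2) hlam hlam' hg hg' (by linarith)
    (b1.trans (by simp only [add_assoc, Nat.reduceAdd]; linarith))
    (b2.trans (by simp only [add_assoc, Nat.reduceAdd]; linarith))
    (hr.k_le.trans (by simp only [add_assoc, Nat.reduceAdd]; linarith)) hr
    (by simp only [add_assoc, Nat.reduceAdd] at *; linarith)
  simp only [add_assoc, Nat.reduceAdd] at hfin
  linarith

end PolyChain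

/-- A sequence of triples of points, any two successive ones spanning a common plane. -/
structure PointChain (ξ R lam M : ℝ) (c a b : ℕ → Fin 4 → ℤ) (J : ℕ → Prop) : Prop where
  step : ∀ n, Step ξ R (c n) (a n) (b n) (c (n + 1)) (a (n + 1)) (b (n + 1))
  norm_ba : ∀ n, znorm (b n) ≤ znorm (a (n + 1))
  lam_b : ∀ n, lam * Real.log (znorm (b n)) ≤ -Real.log (zL ξ (a n)) + M
  lam_a : ∀ n, lam * Real.log (znorm (a n)) ≤ -Real.log (zL ξ (c n)) + M
  contr_ab_ne : ∀ n, contr₀ (a n) (b n) ≠ 0 ∨ contr₁ (a n) (b n) ≠ 0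
  contr_ac_ne : ∀ n, contr₀ (a n) (c n) ≠ 0 ∨ contr₁ (a n) (c n) ≠ 0
  dep : ∀ r q, r ≤ q → J q → (∀ t, r ≤ t → t < q → ¬ J t) →
    ¬ LinearIndependent ℝ ![rvec (c r), rvec (a r), rvec (b r), rvec (a (q + 1))] ∧
    LinearIndependent ℝ ![rvec (c r), rvec (a r), rvec (b r), rvec (b (q + 1))]

theorem one_le_abs_or {p q : ℤ} (h : p ≠ 0 ∨ q ≠ 0) {r : ℝ} (hp : |(p : ℝ)| ≤ r)
    (hq : |(q : ℝ)| ≤ r) : 1 ≤ r := by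
  rcases h with h | h
  · exact le_trans (by exact_mod_cast Int.one_le_abs h) hp
  · exact le_trans (by exact_mod_cast Int.one_le_abs h) hq

theorem PointChain.exists_polyChain {ξ R lam M : ℝ} {c a b : ℕ → Fin 4 → ℤ} {J : ℕ → Prop}
    (h : PointChain ξ R lam M c a b J) :
    ∃ M', PolyChain ξ lam M' (fun n => Real.log (znorm (a n))) (fun n => Real.log (znorm (b n)))
      (fun n => -Real.log (zL ξ (a n))) (fun n => -Real.log (zL ξ (c n))) J
      (fun n => contr₀ (a (n - 1)) (b (n - 1))) (fun n => contr₁ (a (n - 1)) (b (n - 1)))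
      (fun n => contr₀ (a n) (c n)) (fun n => contr₁ (a n) (c n)) := by
  have T : ∀ n, Triple ξ R (c n) (a n) (b n) := fun n => (h.step n).left
  have hR1 := (T 0).pow.1
  have hR0 : 0 < R := (T 0).R_pos
  have pa : ∀ n, 0 < znorm (a n) := fun n => one_pos.trans_le (T n).one_le_a
  have pb : ∀ n, 0 < znorm (b n) := fun n => one_pos.trans_le (T n).one_le_b
  have qa : ∀ n, 0 < zL ξ (a n) := fun n => (T n).L_a_pos
  have qc : ∀ n, 0 < zL ξ (c n) := fun n => (T n).L_c_pos
  set M' := max (Real.log (1000 * R ^ 5)) M with hM'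
  have hlog : Real.log (1000 * R ^ 5) ≤ M' := le_max_left _ _
  have hMM : M ≤ M' := le_max_right _ _
  have hC0 : 0 < 1000 * R ^ 5 := by positivity
  have hexp : 1000 * R ^ 5 ≤ Real.exp M' := (Real.log_le_iff_le_exp hC0).1 hlog
  have hpow : ∀ i ≤ 5, R ^ i ≤ R ^ 5 := fun i hi => pow_le_pow_right₀ hR1 hi
  have h2 := hpow 2 (by norm_num)
  have hR5 : 0 < R ^ 5 := by positivity
  have c18 : 18 * R ^ 2 ≤ Real.exp M' := by linarith
  have c40 : 40 * R ^ 2 ≤ Real.exp M' := by linarith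
  have c108 : 108 * R ^ 2 ≤ Real.exp M' := by linarith
  have c840 : 840 * R ^ 5 ≤ Real.exp M' := by linarith
  have c760 : 760 * R ^ 5 ≤ Real.exp M' := by linarith
  have ea : ∀ n, Real.exp (Real.log (znorm (a n))) = znorm (a n) := fun n => Real.exp_log (pa n)
  have eb : ∀ n, Real.exp (Real.log (znorm (b n))) = znorm (b n) := fun n => Real.exp_log (pb n)
  have fa : ∀ n, Real.exp (Real.log (zL ξ (a n))) = zL ξ (a n) := fun n => Real.exp_log (qa n)
  have fc : ∀ n, Real.exp (Real.log (zL ξ (c n))) = zL ξ (c n) := fun n => Real.exp_log (qc n)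
  have hP : ∀ n, |(contr₀ (a n) (c n) : ℝ)| ≤
      Real.exp (M' + Real.log (znorm (a n)) - -Real.log (zL ξ (a n)) - -Real.log (zL ξ (c n))) ∧
      |(contr₁ (a n) (c n) : ℝ)| ≤
      Real.exp (M' + Real.log (znorm (a n)) - -Real.log (zL ξ (a n)) - -Real.log (zL ξ (c n))) := by
    intro n
    obtain ⟨k0, k1⟩ := (T n).abs_contr_ac_le
    have e : 40 * R ^ 2 * (znorm (a n) * zL ξ (a n) * zL ξ (c n)) ≤
        Real.exp (M' + Real.log (znorm (a n)) - -Real.log (zL ξ (a n)) -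
          -Real.log (zL ξ (c n))) := by
      simp only [sub_neg_eq_add, Real.exp_add, ea, fa, fc, mul_assoc]
      have := pa n
      have := qa n
      have := qc n
      rw [← mul_assoc]
      gcongr
    exact ⟨k0.trans e, k1.trans e⟩
  refine ⟨M', ⟨?_, ?_, ?_, ?_, ?_, ?_, ?_, ?_, ?_, ?_⟩, ?_, ?_, ?_, ?_, ?_, ?_, ?_, ?_⟩
  · refine le_trans ?_ hlog
    rw [Real.le_log_iff_exp_le hC0]
    have : (1 : ℝ) ≤ R ^ 5 := one_le_pow₀ hR1
    linarith [Real.exp_one_lt_d9]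
  · exact fun n => Real.log_nonneg (T n).one_le_a
  · exact fun n => Real.log_le_log (pa n) (T n).norm_ab
  · exact fun n => Real.log_le_log (pb n) (h.norm_ba n)
  · exact fun n => (h.lam_b n).trans (by linarith)
  · exact fun n => (h.lam_a n).trans (by linarith)
  · intro n
    have := one_le_abs_or (h.contr_ac_ne n) (hP n).1 (hP n).2
    rw [Real.one_le_exp_iff] at this
    linarith
  · intro n
    rw [← Real.exp_le_exp]
    simp only [sub_neg_eq_add, Real.exp_add, ea, eb, fa, fc]
    have := pb n
    have := qa n
    refine (h.step n).area_le.trans ?_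
    rw [mul_comm _ (Real.exp M')]
    gcongr
  · intro n
    rw [← Real.exp_le_exp]
    simp only [sub_neg_eq_add, Real.exp_add, ea, eb, fa, fc]
    have := pa (n + 1)
    have := qc (n + 1)
    refine (h.step n).area_ge.trans ?_
    rw [mul_comm _ (Real.exp M')]
    gcongr
  · intro r q hrq hq hJ
    obtain ⟨d1, d2⟩ := h.dep r q hrq hq hJ
    have hv := (T r).volume_le (T (q + 1)) d1 d2
    have e : Real.log (znorm (a (q + 1))) ≤ M' + Real.log (znorm (b r)) + Real.log (zL ξ (a r)) +
        Real.log (zL ξ (c r)) + Real.log (znorm (b (q + 1))) + Real.log (zL ξ (a (q + 1))) := by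
      rw [← Real.exp_le_exp]
      simp only [Real.exp_add, ea, eb, fa, fc]
      refine hv.trans ?_
      have := pb r
      have := qa r
      have := qc r
      have := pb (q + 1)
      have := qa (q + 1)
      calc _ ≤ Real.exp M' * (znorm (b r) * zL ξ (a r) * zL ξ (c r) *
            (znorm (b (q + 1)) * zL ξ (a (q + 1)))) := by gcongr
        _ = _ := by ring
    linarith
  · exact fun n => h.contr_ab_ne n
  · exact h.contr_ac_ne
  · intro n
    refine (T n).abs_contr_ab_le.1.trans ?_
    simp only [mul_neg, sub_neg_eq_add, two_mul, Real.exp_add, eb, fa]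
    have := pb n
    have := qa n
    calc _ ≤ Real.exp M' * (znorm (b n) * zL ξ (a n) * zL ξ (a n)) := by gcongr
      _ = _ := by ring
  · intro n
    refine (h.step n).abs_eval_contr_le.trans ?_
    simp only [sub_neg_eq_add, Real.exp_add, ea, fa, fc]
    have := pa n
    have := qa (n + 1)
    have := qc (n + 1)
    calc _ ≤ Real.exp M' * (znorm (a n) * zL ξ (a (n + 1)) * zL ξ (c (n + 1))) := by gcongr
      _ = _ := by ring
  · exact fun n => (hP n).1
  · exact fun n => (hP n).2
  · intro n
    simp only [sub_neg_eq_add, Real.exp_add, ea, fa, fc]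
    refine (h.step n).abs_eval_contr_right_le.trans ?_
    have := pa (n + 1)
    have := qa (n + 1)
    have := qc (n + 1)
    have := qa n
    simp only [Nat.add_sub_cancel]
    gcongr
  · exact fun n d h0 h1 => (h.step n).dvd_contr h0 h1

section LinearAlgebra
variable {V : Type*}

theorem range_cons_pair (u v : V) : Set.range ![u, v] = {u, v} := by
  simp [Set.pair_comm]

theorem range_cons_triple (u v w : V) : Set.range ![u, v, w] = {u, v, w} := by
  ext z
  simp
  tauto

variable [AddCommGroup V] [Module ℝ V]

theorem linearIndependent_triple_iff {u v w : V} (h : LinearIndependent ℝ ![u, v]) :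
    LinearIndependent ℝ ![u, v, w] ↔ w ∉ Submodule.span ℝ {u, v} := by
  have e : Fin.init ![u, v, w] = ![u, v] := by
    ext i
    fin_cases i <;> rfl
  rw [linearIndependent_finSucc', e, range_cons_pair]
  exact ⟨fun h => h.2, fun h' => ⟨h, h'⟩⟩

theorem linearIndependent_quadruple_iff {u v w y : V} (h : LinearIndependent ℝ ![u, v, w]) :
    LinearIndependent ℝ ![u, v, w, y] ↔ y ∉ Submodule.span ℝ {u, v, w} := by
  have e : Fin.init ![u, v, w, y] = ![u, v, w] := by
    ext i
    fin_cases i <;> rfl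
  rw [linearIndependent_finSucc', e, range_cons_triple]
  exact ⟨fun h => h.2, fun h' => ⟨h, h'⟩⟩

end LinearAlgebra

namespace Triple
variable {ξ R M : ℝ} {c a b : Fin 4 → ℤ}

theorem minor_ne_zero_of_large (h : Triple ξ R c a b)
    (ha : 849 / 2000 * Real.log (znorm a) ≤ -Real.log (zL ξ c) + M)
    (hX : 3 * M + Real.log ((4 * R ^ 2) ^ 3) < 1 / 4 * Real.log (znorm a)) : minor a ≠ 0 := by
  apply h.minor_ne_zero
  have hR := h.R_pos
  have p1 : 0 < znorm a := one_pos.trans_le h.one_le_a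
  have p2 := h.L_c_pos
  have p3 := Real.log_nonneg h.one_le_a
  rw [← Real.log_neg_iff (by positivity), Real.log_mul (by positivity) (by positivity),
    Real.log_mul (by positivity) (by positivity), Real.log_pow (zL ξ c)]
  push_cast
  linarith

theorem contr_ne_zero_of_large (h : Triple ξ R c a b) (hm : minor a ≠ 0) (hM : 0 ≤ M)
    (ha : 849 / 2000 * Real.log (znorm a) ≤ -Real.log (zL ξ c) + M)
    (hb : 849 / 2000 * Real.log (znorm b) ≤ -Real.log (zL ξ a) + M)
    (hX : 5 * M + Real.log (36 * R ^ 2) + Real.log (432 * R ^ 3) < 1 / 50 * Real.log (znorm a)) :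
    contr₀ a b ≠ 0 ∨ contr₁ a b ≠ 0 := by
  by_contra! h0
  obtain ⟨Q, h1, h2, h3⟩ := h.exists_of_contr_eq_zero hm h0.1 h0.2
  have hR := h.R_pos
  have hR1 := h.pow.1
  have p1 : 0 < znorm a := one_pos.trans_le h.one_le_a
  have p2 := h.L_c_pos
  have p3 : 0 < znorm b := one_pos.trans_le h.one_le_b
  have p4 := h.L_a_pos
  have l1 := Real.log_nonneg h.one_le_a
  have l2 := Real.log_nonneg h.one_le_b
  have k1 : 0 ≤ Real.log (36 * R ^ 2) := Real.log_nonneg (by nlinarith)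
  have k2 : 0 ≤ Real.log (432 * R ^ 3) := by
    have : 1 ≤ R ^ 3 := one_le_pow₀ hR1
    exact Real.log_nonneg (by linarith)
  have e1 : 1 ≤ 36 * R ^ 2 * (znorm a * zL ξ a * zL ξ c) := by
    calc 1 ≤ 6 * R * (Q * zL ξ c) := h3
      _ ≤ 6 * R * (6 * R * (znorm a * zL ξ a) * zL ξ c) := by gcongr
      _ = _ := by ring
  have e2 : 1 ≤ 432 * R ^ 3 * (znorm b * zL ξ a * zL ξ c ^ 2) := by
    calc 1 ≤ (6 * R * (Q * zL ξ c)) ^ 2 := one_le_pow₀ h3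
      _ = (6 * R) ^ 2 * (Q ^ 2 * zL ξ c ^ 2) := by ring
      _ ≤ (6 * R) ^ 2 * (12 * R * (znorm b * zL ξ a) * zL ξ c ^ 2) := by gcongr
      _ = _ := by ring
  have f1 := Real.log_nonneg e1
  have f2 := Real.log_nonneg e2
  rw [Real.log_mul (by positivity) (by positivity),
    Real.log_mul (x := znorm a * zL ξ a) (by positivity) (by positivity),
    Real.log_mul (x := znorm a) (by positivity) (by positivity)] at f1
  rw [Real.log_mul (by positivity) (by positivity),
    Real.log_mul (x := znorm b * zL ξ a) (by positivity) (by positivity),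
    Real.log_mul (x := znorm b) (by positivity) (by positivity), Real.log_pow (x := zL ξ c)] at f2
  push_cast at f2
  linarith

end Triple

namespace IsMinimalSeq
variable {ξ : ℝ} {x : ℕ → Fin 4 → ℤ}

theorem indep_of_mem (h : IsMinimalSeq ξ x) {i : ℕ} (hi : i ∈ Iset x) :
    LinearIndependent ℝ ![rvec (x (i - 1)), rvec (x i), rvec (x (i + 1))] := by
  obtain ⟨h2, hW⟩ := hi
  obtain ⟨m, rfl⟩ : ∃ m, i = m + 1 := ⟨i - 1, by omega⟩
  have hm : 1 ≤ m := by omega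
  have p1 := h.pair_indep hm
  have p2 := h.pair_indep (show 1 ≤ m + 1 by omega)
  simp only [Nat.add_sub_cancel]
  rw [linearIndependent_triple_iff p1]
  intro hmem
  apply hW
  symm
  have f : ∀ u v : Fin 4 → ℝ, LinearIndependent ℝ ![u, v] →
      Module.finrank ℝ (Submodule.span ℝ {u, v}) = 2 := by
    intro u v huv
    have := finrank_span_eq_card huv
    rw [range_cons_pair] at this
    simpa using this
  apply Submodule.eq_of_le_of_finrank_eq
  · simp only [Wspace, Nat.add_sub_cancel]
    rw [Submodule.span_le]
    rintro z (rfl | rfl)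
    · exact Submodule.subset_span (by simp)
    · exact hmem
  · exact (f _ _ p2).trans (f _ _ p1).symm

theorem Uspace_eq (x : ℕ → Fin 4 → ℤ) (i : ℕ) :
    Uspace x i = Submodule.span ℝ {rvec (x (i - 1)), rvec (x i), rvec (x (i + 1))} := by
  simp only [Uspace, Wspace, Nat.add_sub_cancel]
  rw [← Submodule.span_union]
  congr 1
  ext z
  simp
  tauto

theorem finrank_Uspace (h : IsMinimalSeq ξ x) {i : ℕ} (hi : i ∈ Iset x) :
    Module.finrank ℝ (Uspace x i) = 3 := by
  have := finrank_span_eq_card (h.indep_of_mem hi)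
  rw [range_cons_triple, ← Uspace_eq] at this
  simpa using this

theorem Wspace_eq_of_consecIn {i j : ℕ} (hij : ConsecIn (Iset x) i j) :
    Wspace x (i + 1) = Wspace x j := by
  obtain ⟨hi, hj, hlt, hmin⟩ := hij
  have key : ∀ m, i + 1 ≤ m → m ≤ j → Wspace x (i + 1) = Wspace x m := by
    intro m hm
    induction m, hm using Nat.le_induction with
    | base => exact fun _ => rfl
    | succ m hm ih =>
      intro hmj
      rw [ih (by omega)]
      by_contra hne
      have := hmin m ⟨by have := hi.1; omega, hne⟩ (by omega)
      omega
  exact key j hlt le_rfl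

theorem exists_comb (h : IsMinimalSeq ξ x) {i j : ℕ} (hij : ConsecIn (Iset x) i j)
    {k : Fin 4} (hk : plucker (x i) (x (i + 1)) 0 k ≠ 0) :
    ∃ α β γ δ : ℤ, (∀ t, x j t = α * x i t + β * x (i + 1) t) ∧
      (∀ t, x (j - 1) t = γ * x i t + δ * x (i + 1) t) ∧ |α * δ - β * γ| = 1 := by
  have hW := Wspace_eq_of_consecIn hij
  obtain ⟨hi, hj, hlt, hmin⟩ := hij
  have h2 := hi.1
  obtain ⟨m, rfl⟩ : ∃ m, j = m + 1 := ⟨j - 1, by omega⟩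
  simp only [Wspace, Nat.add_sub_cancel] at hW ⊢
  obtain ⟨α, β, h1⟩ := h.exists_int_combination (m := i) (by omega) (z := x (m + 1))
    (by rw [hW]; exact Submodule.subset_span (by simp))
  obtain ⟨γ, δ, h3⟩ := h.exists_int_combination (m := i) (by omega) (z := x m)
    (by rw [hW]; exact Submodule.subset_span (by simp))
  obtain ⟨p, q, h4⟩ := h.exists_int_combination (m := m) (by omega) (z := x i)
    (by rw [← hW]; exact Submodule.subset_span (by simp))
  obtain ⟨r, s, h5⟩ := h.exists_int_combination (m := m) (by omega) (z := x (i + 1))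
    (by rw [← hW]; exact Submodule.subset_span (by simp))
  refine ⟨α, β, γ, δ, h1, h3, ?_⟩
  rw [← Int.isUnit_iff_abs_eq]
  have e1 : plucker (x i) (x (i + 1)) 0 k = (q * r - p * s) * plucker (x (m + 1)) (x m) 0 k := by
    simp only [plucker]
    rw [h4 0, h4 k, h5 0, h5 k]
    ring
  have e2 : plucker (x (m + 1)) (x m) 0 k =
      (α * δ - β * γ) * plucker (x i) (x (i + 1)) 0 k := by
    simp only [plucker]
    rw [h1 0, h1 k, h3 0, h3 k]
    ring
  refine IsUnit.of_mul_eq_one (q * r - p * s) ?_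
  apply mul_right_cancel₀ hk
  linear_combination -e1 - (q * r - p * s) * e2

/-- The points attached to large elements of `I` satisfy all the required estimates. -/
theorem exists_good (h : IsMinimalSeq ξ x) (hξ : ξ ≠ 0) {c lam : ℝ} (hc : 0 < c)
    (hlam : 849 / 2000 ≤ lam) (happ : ApproxHyp ξ c lam) :
    ∃ (R M : ℝ) (N : ℕ), (∀ m ≥ N, 2 ≤ m ∧ znorm (x m) ≤ R * |(x m 0 : ℝ)| ∧
      lam * Real.log (znorm (x (m + 1))) ≤ -Real.log (zL ξ (x m)) + M ∧
      ∃ j, |(x (m + 1) 0 : ℝ)| * zL ξ (x m) ≤ 3 * |(plucker (x m) (x (m + 1)) 0 j : ℝ)|) ∧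
      ∀ i > N, i ∈ Iset x → Triple ξ R (x (i - 1)) (x i) (x (i + 1)) ∧ minor (x i) ≠ 0 ∧
        (contr₀ (x i) (x (i + 1)) ≠ 0 ∨ contr₁ (x i) (x (i + 1)) ≠ 0) := by
  obtain ⟨k, hk⟩ := Finite.exists_max fun i : Fin 4 => |ξ ^ (i : ℕ)|
  obtain ⟨k', hk'⟩ := Finite.exists_min fun i : Fin 4 => |ξ ^ (i : ℕ)|
  have hρ : 0 < |ξ ^ (k' : ℕ)| := abs_pos.2 (pow_ne_zero _ hξ)
  set ρ := |ξ ^ (k' : ℕ)| with hρdef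
  set R := |ξ ^ (k : ℕ)| with hRdef
  have hR1 : 1 ≤ R := by simpa using hk 0
  have hR : PowBound ξ R := ⟨hR1, hk⟩
  have hR' : PowBound ξ (R + 1) := ⟨by linarith, fun i => (hk i).trans (by linarith)⟩
  have hlam0 : 0 < lam := by linarith
  obtain ⟨M₀, N₁, hM₀⟩ := h.exists_log_bound hR hc hlam0 happ
  obtain ⟨N₂, hN₂⟩ := h.exists_zL_le hlam0 hM₀ (ε := min (1 / 2) (ρ / 2)) (by positivity)
  have hM : ∀ m ≥ N₁, lam * Real.log (znorm (x (m + 1))) ≤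
      -Real.log (zL ξ (x m)) + max M₀ 0 := fun m hm =>
    (hM₀ m hm).trans (by linarith [le_max_left M₀ 0])
  have hM0 : 0 ≤ max M₀ 0 := le_max_right _ _
  set M := max M₀ 0
  have hlogt : Filter.Tendsto (fun m : ℕ => Real.log m) Filter.atTop Filter.atTop :=
    Real.tendsto_log_atTop.comp tendsto_natCast_atTop_atTop
  obtain ⟨N₃, hN₃⟩ := Filter.eventually_atTop.1 (hlogt.eventually_gt_atTop
    (max (4 * (3 * M + Real.log ((4 * (R + 1) ^ 2) ^ 3)))
      (50 * (5 * M + Real.log (36 * (R + 1) ^ 2) + Real.log (432 * (R + 1) ^ 3)))))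
  have lead : ∀ m, 1 ≤ m → N₂ ≤ m → znorm (x m) ≤ (R + 1) * |(x m 0 : ℝ)| := fun m h1 h2 =>
    znorm_le_lead hR (h.1 m h1) ((hN₂ m h2).trans (min_le_left _ _))
  have ne0 : ∀ m, 1 ≤ m → N₂ ≤ m → x m 0 ≠ 0 := by
    intro m h1 h2 h0
    have := lead m h1 h2
    simp [h0] at this
    linarith [one_le_znorm (h.1 m h1)]
  refine ⟨R + 1, M, N₁ + N₂ + N₃ + 2, ?_, ?_⟩
  · intro m hm
    refine ⟨by omega, lead m (by omega) (by omega), hM m (by omega), ?_⟩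
    refine h.exists_le_plucker (by omega) (ne0 m (by omega) (by omega))
      (ne0 (m + 1) (by omega) (by omega)) fun i => ?_
    calc zL ξ (x m) ≤ ρ / 2 := (hN₂ m (by omega)).trans (min_le_right _ _)
      _ < ρ := by linarith
      _ ≤ _ := hk' i
  · intro i hi hI
    obtain ⟨m, rfl⟩ : ∃ m, i = m + 1 := ⟨i - 1, by omega⟩
    have hind := h.indep_of_mem hI
    simp only [Nat.add_sub_cancel] at hind ⊢
    have hT : Triple ξ (R + 1) (x m) (x (m + 1)) (x (m + 1 + 1)) :=
      { pow := hR'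
        one_le := one_le_znorm (h.1 m (by omega))
        norm_ca := (h.2.1 m (by omega)).le
        norm_ab := (h.2.1 (m + 1) (by omega)).le
        L_ac := (h.2.2.1 m (by omega)).le
        L_ba := (h.2.2.1 (m + 1) (by omega)).le
        L_le := (hN₂ m (by omega)).trans ((min_le_left _ _).trans (by norm_num))
        L_pos := h.zL_pos (by omega)
        lead_a := lead (m + 1) (by omega) (by omega)
        indep := hind }
    have g1 : 849 / 2000 * Real.log (znorm (x (m + 1))) ≤ -Real.log (zL ξ (x m)) + M :=
      (mul_le_mul_of_nonneg_right hlam (Real.log_nonneg hT.one_le_a)).trans (hM m (by omega))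
    have g2 : 849 / 2000 * Real.log (znorm (x (m + 1 + 1))) ≤ -Real.log (zL ξ (x (m + 1))) + M :=
      (mul_le_mul_of_nonneg_right hlam (Real.log_nonneg hT.one_le_b)).trans (hM (m + 1) (by omega))
    have g3 := hN₃ (m + 1) (by omega)
    have g4 : Real.log ((m + 1 : ℕ) : ℝ) ≤ Real.log (znorm (x (m + 1))) :=
      Real.log_le_log (by positivity) (h.le_znorm (by omega))
    rw [max_lt_iff] at g3
    have hm := hT.minor_ne_zero_of_large g1 (by linarith)
    exact ⟨hT, hm, hT.contr_ne_zero_of_large hm hM0 g1 g2 (by linarith)⟩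

theorem dependence (h : IsMinimalSeq ξ x) {s : ℕ → ℕ}
    (hs : ∀ n, ConsecIn (Iset x) (s n) (s (n + 1))) {r q : ℕ} (hrq : r ≤ q) (hq : s q ∈ Jset x)
    (hJ : ∀ t, r ≤ t → t < q → s t ∉ Jset x) :
    ¬ LinearIndependent ℝ
        ![rvec (x (s r - 1)), rvec (x (s r)), rvec (x (s r + 1)), rvec (x (s (q + 1)))] ∧
    LinearIndependent ℝ
        ![rvec (x (s r - 1)), rvec (x (s r)), rvec (x (s r + 1)), rvec (x (s (q + 1) + 1))] := by
  have hU : ∀ t, r ≤ t → t ≤ q → Uspace x (s r) = Uspace x (s t) := by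
    intro t ht
    induction t, ht using Nat.le_induction with
    | base => exact fun _ => rfl
    | succ t ht ih =>
      intro htq
      rw [ih (by omega)]
      by_contra hne
      refine hJ t ht (by omega) ⟨(hs t).1, fun j hj => ?_⟩
      have e : j = s (t + 1) := le_antisymm (hj.2.2.2 _ (hs t).2.1 (hs t).2.2.1)
        ((hs t).2.2.2 _ hj.2.1 hj.2.2.1)
      rwa [e]
  have hUrq := hU q hrq le_rfl
  have hW := Wspace_eq_of_consecIn (hs q)
  have hWle : Wspace x (s (q + 1)) ≤ Uspace x (s q) := by
    rw [← hW]
    exact le_sup_right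
  have hind := h.indep_of_mem (hs r).1
  rw [linearIndependent_quadruple_iff hind, linearIndependent_quadruple_iff hind, not_not,
    ← Uspace_eq, hUrq]
  have hmem : rvec (x (s (q + 1))) ∈ Uspace x (s q) :=
    hWle (Submodule.subset_span (by simp))
  refine ⟨hmem, fun hmem' => hq.2 _ (hs q) ?_⟩
  symm
  apply Submodule.eq_of_le_of_finrank_eq
  · refine sup_le hWle ?_
    simp only [Wspace, Nat.add_sub_cancel]
    rw [Submodule.span_le]
    rintro z (rfl | rfl)
    · exact hmem
    · exact hmem'
  · rw [h.finrank_Uspace (hs q).1, h.finrank_Uspace (hs q).2.1]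

end IsMinimalSeq

theorem irrational_of_linearIndependent {ξ : ℝ}
    (hξ : LinearIndependent ℚ ![(1 : ℝ), ξ, ξ ^ 2, ξ ^ 3]) : Irrational ξ := by
  rintro ⟨q, hq⟩
  have := Fintype.linearIndependent_iff.1 hξ ![q, -1, 0, 0]
    (by simp [Fin.sum_univ_four, Rat.smul_def, hq]) 1
  simp at this

theorem gold_sq : gold ^ 2 = gold + 1 := by
  have h5 : Real.sqrt 5 ^ 2 = 5 := Real.sq_sqrt (by norm_num)
  unfold gold
  linear_combination h5 / 4

theorem gold_bounds : 16180339 / 10000000 ≤ gold ∧ gold ≤ 16180340 / 10000000 := by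
  have h1 : 2.2360678 ≤ Real.sqrt 5 := Real.le_sqrt_of_sq_le (by norm_num)
  have h2 : Real.sqrt 5 ≤ 2.236068 := Real.sqrt_le_iff.2 (by norm_num)
  unfold gold
  constructor <;> norm_num at * <;> linarith

theorem lambda3_eq : lambda3 = (2 * gold + 1 - Real.sqrt (4 * gold + 5)) / 2 := by
  have h := gold_sq
  have h3 : gold ^ 3 = 2 * gold + 1 := by linear_combination (gold + 1) * h
  have h6 : gold ^ 6 - 4 * gold = 4 * gold + 5 := by
    linear_combination (gold ^ 3 + 2 * gold + 1) * h3 + 4 * h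
  unfold lambda3
  rw [h3, h6]

theorem lambda3_root : lambda3 ^ 2 - (2 * gold + 1) * lambda3 + gold = 0 := by
  have h0 : 0 ≤ 4 * gold + 5 := by linarith [gold_bounds.1]
  have hs := Real.sq_sqrt h0
  rw [lambda3_eq]
  linear_combination hs / 4 - gold_sq

theorem lambda3_bounds : 849 / 2000 ≤ lambda3 ∧ lambda3 ≤ 42451 / 100000 := by
  obtain ⟨g1, g2⟩ := gold_bounds
  have h1 : 3.38705 ≤ Real.sqrt (4 * gold + 5) := Real.le_sqrt_of_sq_le (by norm_num; linarith)
  have h2 : Real.sqrt (4 * gold + 5) ≤ 3.38706 :=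
    Real.sqrt_le_iff.2 ⟨by norm_num, by norm_num; linarith⟩
  rw [lambda3_eq]
  constructor <;> norm_num at * <;> linarith

theorem exists_nth_eq {S : Set ℕ} (hS : S.Infinite) {i : ℕ} (hi : i ∈ S) :
    ∃ n, Nat.nth (· ∈ S) n = i := by
  have : i ∈ Set.range (Nat.nth (· ∈ S)) := by
    rw [Nat.range_nth_of_infinite (p := (· ∈ S)) hS]
    exact hi
  exact this

theorem consecIn_nth {S : Set ℕ} (hS : S.Infinite) (n : ℕ) :
    ConsecIn S (Nat.nth (· ∈ S) n) (Nat.nth (· ∈ S) (n + 1)) := by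
  refine ⟨Nat.nth_mem_of_infinite hS n, Nat.nth_mem_of_infinite hS (n + 1),
    Nat.nth_strictMono hS n.lt_succ_self, fun k hk hlt => ?_⟩
  obtain ⟨m, rfl⟩ := exists_nth_eq hS hk
  exact (Nat.nth_strictMono hS).monotone ((Nat.nth_strictMono hS).lt_iff_lt.1 hlt)

theorem IsMinimalSeq.exists_pointChain {ξ c lam : ℝ} {x : ℕ → Fin 4 → ℤ} (h : IsMinimalSeq ξ x)
    (hξ : ξ ≠ 0) (hc : 0 < c) (hlam : 849 / 2000 ≤ lam) (happ : ApproxHyp ξ c lam) {e : ℕ → ℕ}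
    (he : ∀ n, ConsecIn (Iset x) (e n) (e (n + 1))) :
    ∃ (R M : ℝ) (N : ℕ), PointChain ξ R lam M (fun n => x (e (n + N) - 1))
      (fun n => x (e (n + N))) (fun n => x (e (n + N) + 1)) (fun n => e (n + N) ∈ Jset x) := by
  obtain ⟨R, M, N, hN, hI⟩ := h.exists_good hξ hc hlam happ
  have hmono : StrictMono e := strictMono_nat_of_lt_succ fun n => (he n).2.2.1
  have hge : ∀ n, N + 1 ≤ n → N < e n := fun n hn => hn.trans (hmono.le_apply)
  have hstep : ∀ n, N + 1 ≤ n → Step ξ R (x (e n - 1)) (x (e n)) (x (e n + 1))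
      (x (e (n + 1) - 1)) (x (e (n + 1))) (x (e (n + 1) + 1)) := by
    intro n hn
    have g1 := hge n hn
    have g2 := hge (n + 1) (by omega)
    have T := (hI _ g1 (he n).1).1
    obtain ⟨k, hk⟩ := not_forall.1 T.not_proportional_right
    refine ⟨T, (hI _ g2 (he n).2.1).1, h.exists_comb (he n) (k := k) ?_,
      (hN (e n + 1) (by omega)).2.1, (hN (e n) (by omega)).2.2.2, ?_⟩
    · intro h0
      apply hk
      simp only [plucker] at h0
      linarith
    · have := (hN (e (n + 1) - 1) (by omega)).2.2.2
      rwa [Nat.sub_add_cancel (by omega)] at this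
  have hge' : ∀ n, N < e (n + (N + 2)) := fun n => hge _ (by omega)
  refine ⟨R, M, N + 2, ?_, ?_, ?_, ?_, ?_, ?_, ?_⟩
  · intro n
    have := hstep (n + (N + 2)) (by omega)
    rwa [show n + 1 + (N + 2) = n + (N + 2) + 1 by ring]
  · intro n
    simp only [show n + 1 + (N + 2) = n + (N + 2) + 1 by ring]
    exact h.znorm_mono (by omega) (he _).2.2.1
  · exact fun n => (hN _ (hge' n).le).2.2.1
  · intro n
    have := (hN (e (n + (N + 2)) - 1) (by have := hge' n; omega)).2.2.1
    rwa [Nat.sub_add_cancel (by have := hge' n; omega)] at this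
  · exact fun n => (hI _ (hge' n) (he _).1).2.2
  · intro n
    have g := hge (n + (N + 1)) (by omega)
    have := (hstep (n + (N + 1)) (by omega)).contr_right_ne (hI _ g (he _).1).2.2
      (hI _ (hge' n) (he _).1).2.1
    exact this
  · intro r q hrq hq hJ
    have hs : ∀ n, ConsecIn (Iset x) (e (n + (N + 2))) (e (n + 1 + (N + 2))) := by
      intro n
      rw [show n + 1 + (N + 2) = n + (N + 2) + 1 by ring]
      exact he _
    exact h.dependence (s := fun n => e (n + (N + 2))) hs hrq hq hJ

theorem statement15 (ξ : ℝ)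
    (hξ : LinearIndependent ℚ ![(1 : ℝ), ξ, ξ ^ 2, ξ ^ 3])
    (c : ℝ) (hc : 0 < c)
    (happrox : ApproxHyp ξ c lambda3)
    (x : ℕ → Fin 4 → ℤ) (hmin : IsMinimalSeq ξ x) :
    {i : ℕ | ∃ j k : ℕ, ConsecIn (Iset x) i j ∧ ConsecIn (Iset x) j k ∧
      i ∈ Jset x ∧ j ∈ Jset x ∧ k ∈ Jset x}.Finite := by
  by_contra hinf
  rw [← Set.Infinite] at hinf
  have hI : (Iset x).Infinite := hinf.mono (by
    rintro i ⟨j, k, hij, -⟩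
    exact hij.1)
  set e := Nat.nth (· ∈ Iset x)
  have he : ∀ n, ConsecIn (Iset x) (e n) (e (n + 1)) := consecIn_nth hI
  have hmono : StrictMono e := Nat.nth_strictMono hI
  have hirr := irrational_of_linearIndependent hξ
  obtain ⟨R, M, N, hchain⟩ :=
    hmin.exists_pointChain hirr.ne_zero hc lambda3_bounds.1 happrox he
  obtain ⟨M', hpoly⟩ := hchain.exists_polyChain
  refine hpoly.not_frequently_three lambda3_bounds.1 lambda3_bounds.2
    (g := gold) (by linarith [gold_bounds.1]) (by linarith [gold_bounds.2]) gold_sq lambda3_root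
    hirr ?_ ?_
  · refine Filter.tendsto_atTop_mono (f := fun n : ℕ => Real.log n) (fun n => ?_)
      (Real.tendsto_log_atTop.comp tendsto_natCast_atTop_atTop)
    have h1 : n + N ≤ e (n + N) := hmono.le_apply
    rcases Nat.eq_zero_or_pos n with rfl | hn
    · simpa using hpoly.X_nonneg 0
    refine Real.log_le_log (by exact_mod_cast hn) (le_trans ?_ (hmin.le_znorm (by omega)))
    exact_mod_cast (by omega : n ≤ e (n + N))
  · intro K
    obtain ⟨i, ⟨j, k, hij, hjk, h1, h2, h3⟩, hi⟩ := hinf.exists_gt (e (K + N))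
    obtain ⟨n, rfl⟩ : ∃ n, e n = i := exists_nth_eq hI hij.1
    have uniq : ∀ {i j j' : ℕ}, ConsecIn (Iset x) i j → ConsecIn (Iset x) i j' → j = j' :=
      fun u v => le_antisymm (u.2.2.2 _ v.2.1 v.2.2.1) (v.2.2.2 _ u.2.1 u.2.2.1)
    obtain rfl := uniq hij (he n)
    obtain rfl := uniq hjk (he (n + 1))
    have hKn : K + N < n := hmono.lt_iff_lt.1 hi
    refine ⟨n - N, by omega, ?_⟩
    rw [show n - N + N = n by omega, show n - N + 1 + N = n + 1 by omega,
      show n - N + 2 + N = n + 1 + 1 by omega]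
    exact ⟨h1, h2, h3⟩
end
end

section
/- Let y = (y₀, y₁, y₂) ∈ ℝ³ with ‖y‖ = max(|y₀|,|y₁|,|y₂|) = 1, and let δ = |y₀y₂ − y₁²|. Then there exists a point (r,s) ∈ ℝ² with max(|r|,|s|) = 1 and a sign σ ∈ {−1,+1} such that ‖y − σ(r², rs, s²)‖ ≤ 2δ, where ‖·‖ on ℝ³ is the maximum of the absolute values of the coordinates. -/
noncomputable section

/-- If the first coordinate is a sign, the point `(1, a * b)` of the conic has error `δ`. -/
theorem exists_conic_point_of_abs_left_eq_one {a b c : ℝ} (ha : |a| = 1) (hb : |b| ≤ 1) :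
    ∃ r s σ : ℝ, max |r| |s| = 1 ∧ (σ = 1 ∨ σ = -1) ∧
      max (max |a - σ * r ^ 2| |b - σ * (r * s)|) |c - σ * s ^ 2| ≤ 2 * |a * c - b ^ 2| := by
  have hsq : a * a = 1 := by rw [← abs_mul_abs_self, ha, one_mul]
  refine ⟨1, a * b, a, by simp [abs_mul, ha, hb], (abs_eq zero_le_one).1 ha, ?_⟩
  have h1 : a - a * 1 ^ 2 = 0 := by ring
  have h2 : b - a * (1 * (a * b)) = 0 := by linear_combination -b * hsq
  have h3 : c - a * (a * b) ^ 2 = a * (a * c - b ^ 2) := by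
    linear_combination (-c - a * b ^ 2) * hsq
  rw [h1, h2, h3, abs_mul, ha]
  have := abs_nonneg (a * c - b ^ 2)
  simp only [abs_zero, max_self, max_le_iff]
  constructor <;> linarith

/-- If the middle coordinate is a sign, the points `(1, ± b)` of the conic suffice. -/
theorem exists_conic_point_of_abs_middle_eq_one {a b c : ℝ} (ha : |a| ≤ 1) (hb : |b| = 1)
    (hc : |c| ≤ 1) :
    ∃ r s σ : ℝ, max |r| |s| = 1 ∧ (σ = 1 ∨ σ = -1) ∧
      max (max |a - σ * r ^ 2| |b - σ * (r * s)|) |c - σ * s ^ 2| ≤ 2 * |a * c - b ^ 2| := by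
  have hsq : b ^ 2 = 1 := by rw [← sq_abs, hb, one_pow]
  obtain ⟨ha₁, ha₂⟩ := abs_le.1 ha
  obtain ⟨hc₁, hc₂⟩ := abs_le.1 hc
  have hδ : 1 - a * c ≤ |a * c - 1| := by
    rw [abs_sub_comm]
    exact le_abs_self _
  have hδ₀ := abs_nonneg (a * c - 1)
  rw [hsq]
  rcases le_total 0 (a + c) with h | h
  · refine ⟨1, b, 1, by simp [hb], Or.inl rfl, max_le (max_le ?_ ?_) ?_⟩
    · rw [abs_le]
      constructor <;> rcases le_total 0 a with h' | h' <;> nlinarith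
    · simp
    · rw [hsq, abs_le]
      constructor <;> rcases le_total 0 c with h' | h' <;> nlinarith
  · refine ⟨1, -b, -1, by simp [hb], Or.inr rfl, max_le (max_le ?_ ?_) ?_⟩
    · rw [abs_le]
      constructor <;> rcases le_total 0 a with h' | h' <;> nlinarith
    · simp
    · rw [neg_sq, hsq, abs_le]
      constructor <;> rcases le_total 0 c with h' | h' <;> nlinarith

theorem statement17 (y : Fin 3 → ℝ)
    (hy : max (max |y 0| |y 1|) |y 2| = 1) :
    ∃ r s σ : ℝ, max |r| |s| = 1 ∧ (σ = 1 ∨ σ = -1) ∧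
      max (max |y 0 - σ * r ^ 2| |y 1 - σ * (r * s)|) |y 2 - σ * s ^ 2|
        ≤ 2 * |y 0 * y 2 - y 1 ^ 2| := by
  obtain ⟨h01, h2⟩ := max_le_iff.1 hy.le
  obtain ⟨h0, h1⟩ := max_le_iff.1 h01
  rcases max_choice (max |y 0| |y 1|) |y 2| with h | h
  · rcases max_choice |y 0| |y 1| with h' | h'
    · exact exists_conic_point_of_abs_left_eq_one (h'.symm.trans (h.symm.trans hy)) h1
    · exact exists_conic_point_of_abs_middle_eq_one h0 (h'.symm.trans (h.symm.trans hy)) h2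
  · obtain ⟨r, s, σ, hrs, hσ, hle⟩ :=
      exists_conic_point_of_abs_left_eq_one (c := y 0) (h.symm.trans hy) h1
    refine ⟨s, r, σ, by rwa [max_comm], hσ, ?_⟩
    rw [mul_comm s r, mul_comm (y 0)]
    simp only [max_le_iff] at hle ⊢
    exact ⟨⟨hle.2, hle.1.2⟩, hle.1.1⟩
end
end

section
/- Let ξ ∈ ℝ. For any x, y, z ∈ ℝ⁴, the point w = Ξ(x,y,z) ∈ ℝ⁴ satisfies C(w,x) = det(C(z,x), C(z,y)) · det(C(x,y), C(x,z)) · C(x,z) and C(x,w) = det(C(x,y), C(x,z)) · C(z,x). -/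
noncomputable section

/-- x⁻ = (x₀,x₁,x₂). -/
def vm (x : Fin 4 → ℝ) : Fin 3 → ℝ := ![x 0, x 1, x 2]

/-- x⁺ = (x₁,x₂,x₃). -/
def vp (x : Fin 4 → ℝ) : Fin 3 → ℝ := ![x 1, x 2, x 3]

/-- Determinant of the 3×3 matrix with rows a, b, c. -/
def det3 (a b c : Fin 3 → ℝ) : ℝ := Matrix.det (Matrix.of ![a, b, c])

/-- Determinant of the 2×2 matrix with rows a, b. -/
def det2 (a b : Fin 2 → ℝ) : ℝ := Matrix.det (Matrix.of ![a, b])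

/-- The map C(x,y) = (det(x⁻,x⁺,y⁻), det(x⁻,x⁺,y⁺)). -/
def Cmap (x y : Fin 4 → ℝ) : Fin 2 → ℝ :=
  ![det3 (vm x) (vp x) (vm y), det3 (vm x) (vp x) (vp y)]

/-- The trilinear map E. -/
def Emap (w x y : Fin 4 → ℝ) : Fin 2 → ℝ :=
  ![det3 (vm w) (vp x) (vm y) - det3 (vp w) (vm x) (vm y),
    det3 (vm w) (vp x) (vp y) - det3 (vp w) (vm x) (vp y)]

/-- Ψ₋(x,y,z) = C(y,z)⁻x + E(y,z,x)⁻y − C(y,x)⁻z. -/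
def PsiM (x y z : Fin 4 → ℝ) : Fin 4 → ℝ :=
  Cmap y z 0 • x + Emap y z x 0 • y - Cmap y x 0 • z

/-- Ψ₊(x,y,z) = C(y,z)⁺x + E(y,z,x)⁺y − C(y,x)⁺z. -/
def PsiP (x y z : Fin 4 → ℝ) : Fin 4 → ℝ :=
  Cmap y z 1 • x + Emap y z x 1 • y - Cmap y x 1 • z

/-- Ξ(x,y,z) = C(z,x)⁻ Ψ₊(y,x,z) − C(z,x)⁺ Ψ₋(y,x,z). -/
def Xi (x y z : Fin 4 → ℝ) : Fin 4 → ℝ :=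
  Cmap z x 0 • PsiP y x z - Cmap z x 1 • PsiM y x z

/-- The symmetric trilinear companion of `Cmap`: the polarization of `w ↦ Cmap w x`. -/
def Fmap (y z x : Fin 4 → ℝ) : Fin 2 → ℝ :=
  ![det3 (vm y) (vp z) (vm x) + det3 (vm z) (vp y) (vm x),
    det3 (vm y) (vp z) (vp x) + det3 (vm z) (vp y) (vp x)]

theorem det3_eq (a b c : Fin 3 → ℝ) : det3 a b c =
    a 0 * (b 1 * c 2 - b 2 * c 1) - a 1 * (b 0 * c 2 - b 2 * c 0)
      + a 2 * (b 0 * c 1 - b 1 * c 0) := by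
  simp [det3, Matrix.det_fin_three]
  ring

theorem det2_eq (a b : Fin 2 → ℝ) : det2 a b = a 0 * b 1 - a 1 * b 0 := by
  simp [det2, Matrix.det_fin_two]

theorem Cmap_comb_right (x y z : Fin 4 → ℝ) (a b c : ℝ) :
    Cmap x (a • y + b • x - c • z) = a • Cmap x y - c • Cmap x z := by
  ext i
  fin_cases i <;> simp [Cmap, det3_eq, vm, vp] <;> ring

theorem Cmap_comb_left (x y z : Fin 4 → ℝ) (a b c : ℝ) :
    Cmap (a • y + b • x - c • z) x = a ^ 2 • Cmap y x + c ^ 2 • Cmap z x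
      - (a * c) • Fmap y z x - b • (a • Cmap x y - c • Cmap x z) := by
  ext i
  fin_cases i <;> simp [Cmap, Fmap, det3_eq, vm, vp] <;> ring

theorem Xi_eq_comb (x y z : Fin 4 → ℝ) :
    Xi x y z = det2 (Cmap z x) (Cmap x z) • y + det2 (Cmap z x) (Emap x z y) • x
      - det2 (Cmap z x) (Cmap x y) • z := by
  ext i
  simp only [Xi, PsiP, PsiM, det2_eq, Pi.sub_apply, Pi.add_apply, Pi.smul_apply, smul_eq_mul]
  ring

theorem det2_smul_eq (u v w : Fin 2 → ℝ) :
    det2 u v • w = det2 w v • u + det2 u w • v := by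
  ext i
  fin_cases i <;> simp [det2_eq] <;> ring

theorem det2_Cmap_Fmap_left (x y z : Fin 4 → ℝ) :
    det2 (Cmap z x) (Cmap x z) * det2 (Cmap z x) (Cmap y x)
      - det2 (Cmap z x) (Cmap x y) * det2 (Cmap z x) (Fmap y z x)
      = det2 (Cmap z x) (Cmap z y) * det2 (Cmap x y) (Cmap x z) := by
  simp [Cmap, Fmap, det2_eq, det3_eq, vm, vp]
  ring

theorem det2_Cmap_Fmap_right (x y z : Fin 4 → ℝ) :
    det2 (Cmap z x) (Cmap x z) * det2 (Cmap y x) (Cmap x z)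
      - det2 (Cmap z x) (Cmap x y) * det2 (Fmap y z x) (Cmap x z)
      = det2 (Cmap z x) (Emap x z y) * det2 (Cmap x y) (Cmap x z)
        - det2 (Cmap z x) (Cmap x y) ^ 2 := by
  simp [Cmap, Emap, Fmap, det2_eq, det3_eq, vm, vp]
  ring

theorem statement18 (ξ : ℝ) (x y z : Fin 4 → ℝ) :
    Cmap (Xi x y z) x
      = (det2 (Cmap z x) (Cmap z y) * det2 (Cmap x y) (Cmap x z)) • Cmap x z ∧
    Cmap x (Xi x y z) = det2 (Cmap x y) (Cmap x z) • Cmap z x := by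
  have hlin : det2 (Cmap z x) (Cmap x z) • Cmap x y - det2 (Cmap z x) (Cmap x y) • Cmap x z
      = det2 (Cmap x y) (Cmap x z) • Cmap z x := by
    rw [det2_smul_eq, add_sub_cancel_right]
  rw [Xi_eq_comb, Cmap_comb_left, Cmap_comb_right, hlin]
  refine ⟨?_, rfl⟩
  have hl := det2_Cmap_Fmap_left x y z
  have hr := det2_Cmap_Fmap_right x y z
  have hs := det2_smul_eq (Cmap z x) (Cmap x z) (Cmap y x)
  have hF := det2_smul_eq (Cmap z x) (Cmap x z) (Fmap y z x)
  ext i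
  have hsi := congrFun hs i
  have hFi := congrFun hF i
  simp only [Pi.sub_apply, Pi.add_apply, Pi.smul_apply, smul_eq_mul] at hsi hFi ⊢
  linear_combination det2 (Cmap z x) (Cmap x z) * hsi - det2 (Cmap z x) (Cmap x y) * hFi
    + Cmap z x i * hr + Cmap x z i * hl
end
end
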